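/- Let n ∈ ℕ, E a complex Banach space, n/(n+1) < p < ∞, 0 < q ≤ ∞, s > σ_{p,q}, d > 1, and K ∈ ℕ₀ with K ≥ 1 + ⌊s⌋. Then an f ∈ S'(ℝ^n,E) belongs to F^s_{p,q}(E) if and only if there exist coefficients λ = {λ_{ν,m}} ∈ f_{p,q} and functions a_{ν,m} : ℝ^n → E, where each a_{0,m} is an E-valued 1_K-atom supported in d·Q_{0,m} and each a_{ν,m} (ν ≥ 1) is an E-valued (s,p)_{K,−1}-atom associated with Q_{ν,m} (i.e. no moment conditions), such that f = Σ_{ν=0}^∞ Σ_{m∈ℤ^n} λ_{ν,m} a_{ν,m} with convergence in S'(ℝ^n,E). Moreover, ‖f|F^s_{p,q}(E)‖ is equivalent to inf ‖λ|f_{p,q}‖, the infimum taken over all such admissible representations of f: there are constants c₁, c₂ > 0 independent of f with c₁ ‖f|F^s_{p,q}(E)‖ ≤ inf ‖λ|f_{p,q}‖ ≤ c₂ ‖f|F^s_{p,q}(E)‖. -/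

import Mathlib

noncomputable section

open MeasureTheory Filter Metric Real Set SchwartzMap
open scoped ENNReal NNReal Topology FourierTransform

/-- Euclidean space ℝⁿ. -/
abbrev Rn (n : ℕ) : Type := EuclideanSpace ℝ (Fin n)

/-- The Schwartz space 𝓢(ℝⁿ, ℂ). -/
abbrev Sch (n : ℕ) : Type := SchwartzMap (Rn n) ℂ

/-- Partial derivative in the `i`-th coordinate direction. -/
def pd {F : Type*} [NormedAddCommGroup F] [NormedSpace ℝ F] {n : ℕ} (i : Fin n)
    (g : Rn n → F) : Rn n → F :=
  fun x => lineDeriv ℝ g x (EuclideanSpace.single i (1 : ℝ))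

/-- Multi-index derivative `D^α = ∂₁^{α₁} ⋯ ∂ₙ^{αₙ}`. -/
def mderiv {F : Type*} [NormedAddCommGroup F] [NormedSpace ℝ F] {n : ℕ} (α : Fin n → ℕ)
    (g : Rn n → F) : Rn n → F :=
  (List.finRange n).foldr (fun i h => (pd i)^[α i] h) g

/-- The order `|α|` of a multi-index. -/
def mdeg {n : ℕ} (α : Fin n → ℕ) : ℕ := ∑ i, α i

/-- The Schwartz seminorm `‖φ‖_{K,L} = sup_x (1+|x|²)^{K/2} ∑_{|α| ≤ L} |D^α φ(x)|`. -/
def schSemi {n : ℕ} (K L : ℕ) (φ : Sch n) : ℝ :=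
  ⨆ x : Rn n, (1 + ‖x‖ ^ 2) ^ ((K : ℝ) / 2) *
    ∑ α : Fin n → Fin (L + 1), if mdeg (fun i => (α i : ℕ)) ≤ L
      then ‖mderiv (fun i => (α i : ℕ)) (fun y => φ y) x‖ else 0

/-- `E`-valued tempered distributions: linear maps `𝓢(ℝⁿ) → E` bounded by some
Schwartz seminorm. -/
structure TDist (n : ℕ) (E : Type*) [NormedAddCommGroup E] [NormedSpace ℂ E] where
  toFun : Sch n →ₗ[ℂ] E
  bound : ∃ (c : ℝ) (K L : ℕ), ∀ φ : Sch n, ‖toFun φ‖ ≤ c * schSemi K L φ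

namespace Aux

lemma hasTemperateGrowth_sub_left {n : ℕ} (x : Rn n) :
    Function.HasTemperateGrowth (fun y : Rn n => x - y) := by
  apply Function.HasTemperateGrowth.of_fderiv (k := 1) (C := ‖x‖ + 1)
  · have h : (fderiv ℝ (fun y : Rn n => x - y)) =
        fun _ : Rn n => -(ContinuousLinearMap.id ℝ (Rn n)) := by
      ext1 y
      rw [fderiv_const_sub]
      simp
    rw [h]
    exact .const _
  · exact (differentiable_const x).sub differentiable_id
  · intro y
    have h1 : ‖x - y‖ ≤ ‖x‖ + ‖y‖ := norm_sub_le x y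
    have h2 : (0:ℝ) ≤ ‖y‖ := norm_nonneg y
    have h3 : (0:ℝ) ≤ ‖x‖ := norm_nonneg x
    calc ‖x - y‖ ≤ ‖x‖ + ‖y‖ := h1
      _ ≤ (‖x‖ + 1) * (1 + ‖y‖) ^ 1 := by nlinarith

lemma antilipschitz_sub_left {n : ℕ} (x : Rn n) :
    AntilipschitzWith 1 (fun y : Rn n => x - y) := by
  refine (Isometry.antilipschitz ?_)
  intro y z
  simp only [edist_dist, dist_eq_norm, sub_sub_sub_cancel_left, norm_sub_rev]

end Aux

/-- The Schwartz function `y ↦ ψ(x - y)`. -/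
def shiftReflect {n : ℕ} (ψ : Sch n) (x : Rn n) : Sch n :=
  SchwartzMap.compCLMOfAntilipschitz (𝕜 := ℝ)
    (Aux.hasTemperateGrowth_sub_left x) (Aux.antilipschitz_sub_left x) ψ

/-- The dilated Schwartz function `ψ(t ·)` (junk value `0` when `t = 0`). -/
def dilate {n : ℕ} (ψ : Sch n) (t : ℝ) : Sch n :=
  if h : t = 0 then 0 else
    SchwartzMap.compCLM (𝕜 := ℝ) (g := fun y : Rn n => t • y)
      (by
        have := (t • ContinuousLinearMap.id ℝ (Rn n)).hasTemperateGrowth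
        exact this)
      (⟨1, |t|⁻¹, fun y => by
        have ht : 0 < |t| := abs_pos.mpr h
        have : ‖t • y‖ = |t| * ‖y‖ := by rw [norm_smul]; simp [Real.norm_eq_abs]
        rw [pow_one, this]
        rw [mul_add, mul_one]
        have : |t|⁻¹ * (|t| * ‖y‖) = ‖y‖ := by field_simp
        nlinarith [norm_nonneg y, inv_pos.mpr ht]⟩) ψ

/-- Fourier transform on Schwartz space. -/
def fourierS {n : ℕ} (φ : Sch n) : Sch n := FourierTransform.fourierCLE ℂ (Sch n) φ

/-- Inverse Fourier transform on Schwartz space. -/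
def invFourierS {n : ℕ} (φ : Sch n) : Sch n := (FourierTransform.fourierCLE ℂ (Sch n)).symm φ

variable {n : ℕ} {E : Type*} [NormedAddCommGroup E] [NormedSpace ℂ E]

/-- Convolution `(ψ * f)(x) := (2π)^{-n/2} f(ψ(x - ·))` of a Schwartz function with an
`E`-valued tempered distribution. -/
def tdConv (ψ : Sch n) (f : TDist n E) : Rn n → E :=
  fun x => ((2 * π) ^ (-(n : ℝ) / 2) : ℝ) • f.toFun (shiftReflect ψ x)

/-- The operator `f ↦ (φ f̂)ˇ = φ̌ * f`. -/
def mOp (φ : Sch n) (f : TDist n E) : Rn n → E := tdConv (invFourierS φ) f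

/-- `L_p`-norm (in `[0,∞]`) of an `ℝ≥0∞`-valued function. -/
def lpNormENN {n : ℕ} (p : ℝ≥0∞) (g : Rn n → ℝ≥0∞) : ℝ≥0∞ :=
  if p = ∞ then essSup g volume else (∫⁻ x, (g x) ^ p.toReal) ^ (1 / p.toReal)

/-- `ℓ_q`-norm (in `[0,∞]`) of a sequence, with the usual modification for `q = ∞`. -/
def lqSum (q : ℝ≥0∞) (a : ℕ → ℝ≥0∞) : ℝ≥0∞ :=
  if q = ∞ then ⨆ j, a j else (∑' j, (a j) ^ q.toReal) ^ (1 / q.toReal)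

/-- A smooth dyadic resolution of unity. -/
structure SmoothResolution (n : ℕ) (φ : ℕ → Sch n) : Prop where
  supp0 : Function.support (φ 0) ⊆ {ξ : Rn n | ‖ξ‖ ≤ 2}
  suppj : ∀ j : ℕ, 0 < j →
    Function.support (φ j) ⊆ {ξ : Rn n | 2 ^ ((j : ℝ) - 1) ≤ ‖ξ‖ ∧ ‖ξ‖ ≤ 2 ^ ((j : ℝ) + 1)}
  sum_eq : ∀ ξ : Rn n, ∑' j : ℕ, φ j ξ = 1
  deriv_bound : ∀ α : Fin n → ℕ, ∃ c : ℝ, ∀ (j : ℕ) (ξ : Rn n),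
    ‖mderiv α (fun y => φ j y) ξ‖ ≤ c * 2 ^ (-(j : ℝ) * (mdeg α : ℝ))

/-- The Besov quasi-norm `‖f | B^s_{p,q}(E)‖` w.r.t. the resolution of unity `φ`. -/
def besovNorm (s : ℝ) (p q : ℝ≥0∞) (φ : ℕ → Sch n) (f : TDist n E) : ℝ≥0∞ :=
  lqSum q fun j => (2 : ℝ≥0∞) ^ ((j : ℝ) * s) * eLpNorm (mOp (φ j) f) p volume

/-- The Triebel–Lizorkin quasi-norm `‖f | F^s_{p,q}(E)‖` w.r.t. the resolution of unity `φ`. -/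
def triebelNorm (s : ℝ) (p q : ℝ≥0∞) (φ : ℕ → Sch n) (f : TDist n E) : ℝ≥0∞ :=
  lpNormENN p fun x =>
    lqSum q fun j => (2 : ℝ≥0∞) ^ ((j : ℝ) * s) * (‖mOp (φ j) f x‖₊ : ℝ≥0∞)

/-- The closed cube `d·Q_{ν,m}` with centre `2^{-ν}m` and side length `d·2^{-ν}`. -/
def dQ {n : ℕ} (d : ℝ) (ν : ℕ) (m : Fin n → ℤ) : Set (Rn n) :=
  {x : Rn n | ∀ i, |x i - 2 ^ (-(ν : ℝ)) * (m i : ℝ)| ≤ d * 2 ^ (-(ν : ℝ)) / 2}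

/-- The lattice point `m ∈ ℤⁿ` as a point of `ℝⁿ`. -/
def zpt {n : ℕ} (m : Fin n → ℤ) : Rn n := WithLp.toLp 2 fun i => (m i : ℝ)

/-- `σ_p = n(1/p - 1)_+`. -/
def sigmaP (n : ℕ) (p : ℝ≥0∞) : ℝ := max ((n : ℝ) * (1 / p.toReal - 1)) 0

/-- `σ_{p,q} = n(1/min(p,q) - 1)_+`. -/
def sigmaPQ (n : ℕ) (p q : ℝ≥0∞) : ℝ := max ((n : ℝ) * (1 / (min p q).toReal - 1)) 0

/-- An `E`-valued `1_K`-atom supported in `d·Q_{0,m}`. -/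
def Is1Atom {n : ℕ} {E : Type*} [NormedAddCommGroup E] [NormedSpace ℝ E]
    (K : ℕ) (d : ℝ) (m : Fin n → ℤ) (a : Rn n → E) : Prop :=
  ContDiff ℝ K a ∧ Function.support a ⊆ dQ d 0 m ∧
    ∀ α : Fin n → ℕ, mdeg α ≤ K → ∀ x, ‖mderiv α a x‖ ≤ 1

/-- An `E`-valued `(s,p)_{K,L}`-atom associated with the cube `Q_{ν,m}` (support in
`d·Q_{ν,m}`, derivative bounds, and moment conditions up to order `L`). -/
def IsSPAtom {n : ℕ} {E : Type*} [NormedAddCommGroup E] [NormedSpace ℝ E]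
    (s : ℝ) (p : ℝ≥0∞) (K : ℕ) (L : ℤ) (d : ℝ) (ν : ℕ) (m : Fin n → ℤ)
    (a : Rn n → E) : Prop :=
  ContDiff ℝ K a ∧ Function.support a ⊆ dQ d ν m ∧
    (∀ α : Fin n → ℕ, mdeg α ≤ K → ∀ x,
      ‖mderiv α a x‖ ≤ 2 ^ (-(ν : ℝ) * (s - (n : ℝ) / p.toReal) + (mdeg α : ℝ) * (ν : ℝ))) ∧
    ∀ β : Fin n → ℕ, (mdeg β : ℤ) ≤ L →
      (∫ x : Rn n, (∏ i, (x i) ^ (β i)) • a x) = 0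

/-- The sequence space norm `‖λ|b_{p,q}‖`. -/
def bNorm {n : ℕ} (p q : ℝ≥0∞) (lam : ℕ → (Fin n → ℤ) → ℂ) : ℝ≥0∞ :=
  lqSum q fun ν =>
    if p = ∞ then ⨆ m : Fin n → ℤ, (‖lam ν m‖₊ : ℝ≥0∞)
    else (∑' m : Fin n → ℤ, (‖lam ν m‖₊ : ℝ≥0∞) ^ p.toReal) ^ (1 / p.toReal)

open Classical in
/-- The `L_p`-normalised characteristic function `χ^{(p)}_{ν,m}` of `Q_{ν,m}`. -/
def chiP {n : ℕ} (p : ℝ≥0∞) (ν : ℕ) (m : Fin n → ℤ) (x : Rn n) : ℝ≥0∞ :=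
  if x ∈ dQ 1 ν m then (2 : ℝ≥0∞) ^ ((ν : ℝ) * (n : ℝ) / p.toReal) else 0

/-- The sequence space norm `‖λ|f_{p,q}‖`. -/
def fNorm {n : ℕ} (p q : ℝ≥0∞) (lam : ℕ → (Fin n → ℤ) → ℂ) : ℝ≥0∞ :=
  lpNormENN p fun x =>
    if q = ∞ then ⨆ (ν : ℕ) (m : Fin n → ℤ), (‖lam ν m‖₊ : ℝ≥0∞) * chiP p ν m x
    else (∑' (ν : ℕ) (m : Fin n → ℤ),
      ((‖lam ν m‖₊ : ℝ≥0∞) * chiP p ν m x) ^ q.toReal) ^ (1 / q.toReal)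

/-- `f = ∑_{ν,m} λ_{ν,m} a_{ν,m}` with unconditional convergence in `S'(ℝⁿ,E)`:
for every test function the pairings sum to `f(φ)`. -/
def RepresentsAtomic {n : ℕ} {E : Type*} [NormedAddCommGroup E] [NormedSpace ℂ E]
    (f : TDist n E) (lam : ℕ → (Fin n → ℤ) → ℂ)
    (a : ℕ → (Fin n → ℤ) → Rn n → E) : Prop :=
  ∀ φ : Sch n, HasSum
    (fun νm : ℕ × (Fin n → ℤ) => lam νm.1 νm.2 • ∫ x : Rn n, φ x • a νm.1 νm.2 x)
    (f.toFun φ)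

/-- The set of coefficient norms `‖λ|f_{p,q}‖` over all admissible atomic
representations of `f` (atoms without moment conditions, `L = -1`). -/
def atomRepSetF {n : ℕ} {E : Type*} [NormedAddCommGroup E] [NormedSpace ℂ E]
    (s : ℝ) (p q : ℝ≥0∞) (K : ℕ) (d : ℝ) (f : TDist n E) : Set ℝ≥0∞ :=
  {r | ∃ (lam : ℕ → (Fin n → ℤ) → ℂ) (a : ℕ → (Fin n → ℤ) → Rn n → E),
    (∀ m, Is1Atom K d m (a 0 m)) ∧
    (∀ ν m, 0 < ν → IsSPAtom s p K (-1) d ν m (a ν m)) ∧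
    fNorm p q lam < ∞ ∧ RepresentsAtomic f lam a ∧ r = fNorm p q lam}


namespace AT
def hlM (h : Rn n → ℝ≥0∞) (x : Rn n) : ℝ≥0∞ :=
  ⨆ k : ℤ, (volume (closedBall (0 : Rn n) ((2:ℝ)^k)))⁻¹ * ∫⁻ y in closedBall x ((2:ℝ)^k), h y
lemma vol_cb (x : Rn n) (r : ℝ) : volume (closedBall x r) = volume (closedBall (0:Rn n) r) :=
  Measure.addHaar_closedBall_center _ _ _
lemma vol_scale (c r : ℝ) (hc : 0 ≤ c) (hr : 0 ≤ r) : volume (closedBall (0:Rn n) (c*r)) =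
    ENNReal.ofReal (c^n) * volume (closedBall (0:Rn n) r) := by
  rw [Measure.addHaar_closedBall_mul _ _ hc hr]
  simp
lemma meas_cbint {h : Rn n → ℝ≥0∞} (hh : Measurable h) (r : ℝ) :
    Measurable (fun x : Rn n => ∫⁻ y in closedBall x r, h y) := by
  have : (fun x : Rn n => ∫⁻ y in closedBall x r, h y) =
      fun x => ∫⁻ y, ({q : Rn n × Rn n | dist q.2 q.1 ≤ r}.indicator (fun q => h q.2)) (x, y) := by
    ext x
    rw [← lintegral_indicator isClosed_closedBall.measurableSet]
    rfl
  rw [this]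
  apply Measurable.lintegral_prod_right'
  refine (hh.comp measurable_snd).indicator ?_
  exact measurableSet_le (by fun_prop) measurable_const
lemma meas_hlM {h : Rn n → ℝ≥0∞} (hh : Measurable h) : Measurable (hlM h) :=
  Measurable.iSup fun _ => (meas_cbint hh _).const_mul _
lemma vol_cb_pos (r : ℝ) (hr : 0 < r) : volume (closedBall (0:Rn n) r) ≠ 0 :=
  (measure_closedBall_pos _ _ hr).ne'
lemma weak_type (h : Rn n → ℝ≥0∞) (l : ℝ≥0∞) (l0 : l ≠ 0) (l1 : l ≠ ∞) :
    volume {x | l < hlM h x} ≤ l⁻¹ * (ENNReal.ofReal (5^n) * ∫⁻ y, h y) := by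
  let O : ℕ → Set (Rn n) := fun R => {x | ∃ k : ℤ, k ≤ R ∧
    l < (volume (closedBall (0 : Rn n) ((2:ℝ)^k)))⁻¹ * ∫⁻ y in closedBall x ((2:ℝ)^k), h y}
  have hO : {x | l < hlM h x} = ⋃ R, O R := by
    ext x
    simp only [hlM, mem_ofPred_eq, lt_iSup_iff, mem_iUnion, O]
    constructor
    · rintro ⟨k, hk⟩
      exact ⟨k.toNat, k, Int.self_le_toNat k, hk⟩
    · rintro ⟨R, k, _, hk⟩
      exact ⟨k, hk⟩
  have hmono : Monotone O := by
    intro R R' hR x ⟨k, hk, hx⟩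
    exact ⟨k, hk.trans (by exact_mod_cast hR), hx⟩
  rw [hO, hmono.measure_iUnion]
  refine iSup_le fun R => ?_
  choose! k hk using fun (x : Rn n) (hx : x ∈ O R) => hx
  obtain ⟨u, hut, hdis, hcov⟩ := Vitali.exists_disjoint_subfamily_covering_enlargement_closedBall
    (O R) (fun x => x) (fun x => (2:ℝ)^(k x)) ((2:ℝ)^(R:ℤ))
    (fun a ha => zpow_le_zpow_right₀ (by norm_num) (hk a ha).1) 5 (by norm_num)
  have hcount : u.Countable := by
    refine hdis.countable_of_nonempty_interior fun a _ => ?_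
    refine ⟨a, ball_subset_interior_closedBall (mem_ball_self (by positivity))⟩
  have h1 : O R ⊆ ⋃ b ∈ u, closedBall b (5 * (2:ℝ)^(k b)) := by
    intro x hx
    obtain ⟨b, hb, hsub⟩ := hcov x hx
    exact mem_biUnion hb (hsub (mem_closedBall_self (by positivity)))
  have hb : ∀ b : u, volume (closedBall (b : Rn n) (5 * (2:ℝ)^(k b))) ≤
      l⁻¹ * (ENNReal.ofReal (5^n) * ∫⁻ y in closedBall (b:Rn n) ((2:ℝ)^(k b)), h y) := by
    intro b
    have hV := vol_cb_pos (n := n) ((2:ℝ)^(k b)) (by positivity)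
    have hV' : volume (closedBall (0:Rn n) ((2:ℝ)^(k b))) ≠ ∞ := measure_closedBall_lt_top.ne
    have := (hk b (hut b.2)).2.le
    rw [vol_cb, vol_scale _ _ (by norm_num) (by positivity), mul_left_comm]
    gcongr
    rw [← ENNReal.mul_le_iff_le_inv hV hV'] at this
    rw [← ENNReal.mul_le_iff_le_inv l0 l1]
    rwa [mul_comm]
  calc volume (O R) ≤ ∑' b : u, volume (closedBall (b : Rn n) (5 * (2:ℝ)^(k b))) :=
        (measure_mono h1).trans (measure_biUnion_le _ hcount _)
    _ ≤ ∑' b : u, l⁻¹ * (ENNReal.ofReal (5^n) * ∫⁻ y in closedBall (b:Rn n) ((2:ℝ)^(k b)), h y) :=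
        ENNReal.tsum_le_tsum hb
    _ = l⁻¹ * (ENNReal.ofReal (5^n) * ∫⁻ y in ⋃ b ∈ u, closedBall (b:Rn n) ((2:ℝ)^(k b)), h y) := by
        rw [ENNReal.tsum_mul_left, ENNReal.tsum_mul_left,
          lintegral_biUnion hcount (fun b _ => isClosed_closedBall.measurableSet) hdis]
    _ ≤ _ := by gcongr; exact Measure.restrict_le_self
lemma hlM_add_le {h g : Rn n → ℝ≥0∞} (c : ℝ≥0∞) (hg : Measurable g) (hle : ∀ x, h x ≤ g x + c)
    (x : Rn n) : hlM h x ≤ hlM g x + c := by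
  refine iSup_le fun k => ?_
  set V := volume (closedBall (0 : Rn n) ((2:ℝ)^k)) with hVd
  have hV : V ≠ 0 := vol_cb_pos (n := n) ((2:ℝ)^k) (by positivity)
  have hV' : V ≠ ∞ := measure_closedBall_lt_top.ne
  calc V⁻¹ * ∫⁻ y in closedBall x ((2:ℝ)^k), h y
      ≤ V⁻¹ * ∫⁻ y in closedBall x ((2:ℝ)^k), (g y + c) := by gcongr; exact hle _
    _ = V⁻¹ * (∫⁻ y in closedBall x ((2:ℝ)^k), g y) + V⁻¹ * V * c := by
        rw [lintegral_add_left hg, setLIntegral_const, vol_cb, mul_add]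
        ring
    _ ≤ hlM g x + c := by
        rw [ENNReal.inv_mul_cancel hV hV', one_mul]
        gcongr
        exact le_iSup (fun k : ℤ => (volume (closedBall (0 : Rn n) ((2:ℝ)^k)))⁻¹ *
          ∫⁻ y in closedBall x ((2:ℝ)^k), g y) k
lemma inner_int (U : ℝ) (hU : 1 < U) (a : ℝ≥0∞) :
    ∫⁻ t in Ioi (0:ℝ), (if ENNReal.ofReal (t/2) < a then ENNReal.ofReal (t^(U-2)) * a else 0) ≤
      ENNReal.ofReal (2^(U-1)/(U-1)) * a^U := by
  by_cases ha : a = ∞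
  · subst ha
    rw [ENNReal.top_rpow_of_pos (by linarith), ENNReal.mul_top]
    · exact le_top
    · simp only [ne_eq, ENNReal.ofReal_eq_zero, not_le]
      have : 0 < U - 1 := by linarith
      positivity
  lift a to ℝ≥0 using ha
  have e1 : ∀ t ∈ Ioi (0:ℝ), (if ENNReal.ofReal (t/2) < a then ENNReal.ofReal (t^(U-2)) * a else 0)
      = (Ioo (0:ℝ) (2*a)).indicator (fun t => ENNReal.ofReal (t^(U-2)) * (a:ℝ≥0∞)) t := by
    intro t ht
    have ht' : 0 < t := ht
    have : ENNReal.ofReal (t/2) < a ↔ t ∈ Ioo (0:ℝ) (2*a) := by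
      rw [ENNReal.ofReal, ENNReal.coe_lt_coe, Real.toNNReal_lt_iff_lt_coe (by positivity)]
      simp only [mem_Ioo, ht', true_and]
      constructor <;> intro h <;> linarith
    simp only [indicator, this]
  rw [setLIntegral_congr_fun measurableSet_Ioi e1]
  refine (setLIntegral_le_lintegral _ _).trans ?_
  rw [lintegral_indicator measurableSet_Ioo, lintegral_mul_const _ (by fun_prop)]
  have e2 : ∫⁻ t in Ioo (0:ℝ) (2*a), ENNReal.ofReal (t^(U-2)) =
      ENNReal.ofReal ((2*a)^(U-1)/(U-1)) := by
    rw [← Measure.restrict_congr_set Ioo_ae_eq_Ioc.symm, ← ofReal_integral_eq_lintegral_ofReal]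
    · rw [← intervalIntegral.integral_of_le (by positivity), integral_rpow (by left; linarith)]
      congr 1
      rw [show U - 2 + 1 = U - 1 by ring, Real.zero_rpow (by linarith)]
      simp
    · have := intervalIntegral.intervalIntegrable_rpow' (a := 0) (b := 2*(a:ℝ)) (r := U-2) (by linarith)
      rwa [intervalIntegrable_iff_integrableOn_Ioc_of_le (by positivity)] at this
    · filter_upwards [self_mem_ae_restrict measurableSet_Ioc] with t ht
      exact Real.rpow_nonneg ht.1.le _
  rw [e2]
  apply le_of_eq
  rw [← ENNReal.ofReal_coe_nnreal, ENNReal.ofReal_rpow_of_nonneg (by positivity) (by linarith),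
    ← ENNReal.ofReal_mul (by have : 0 < U-1 := by linarith
                             positivity),
    ← ENNReal.ofReal_mul (by have : 0 < U-1 := by linarith
                             positivity)]
  congr 1
  rw [Real.mul_rpow (by norm_num) (by positivity)]
  rcases eq_or_lt_of_le a.2 with h0 | h0
  · have h0' : (a:ℝ) = 0 := h0.symm
    rw [h0', Real.zero_rpow (by linarith), Real.zero_rpow (by linarith)]; simp
  · have h0 : (0:ℝ) < a := h0
    have : (a:ℝ)^U = (a:ℝ)^(U-1) * a := by
      conv_lhs => rw [show U = (U-1)+1 by ring]
      rw [Real.rpow_add_one h0.ne']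
    rw [this]; ring
lemma strong_type (U : ℝ) (hU : 1 < U) : ∃ C : ℝ≥0∞, C ≠ ∞ ∧ ∀ h : Rn n → ℝ≥0∞, Measurable h →
    ∫⁻ x, (hlM h x)^U ≤ C * ∫⁻ x, (h x)^U := by
  refine ⟨ENNReal.ofReal U * (ENNReal.ofReal 2 * (ENNReal.ofReal (5^n) *
    ENNReal.ofReal (2^(U-1)/(U-1)))), by finiteness, fun h hh => ?_⟩
  have hMm := meas_hlM hh
  have key : ∀ N : ℕ, ∫⁻ x, (min (hlM h x) N)^U ≤ ENNReal.ofReal U * (ENNReal.ofReal 2 *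
      (ENNReal.ofReal (5^n) * ENNReal.ofReal (2^(U-1)/(U-1)))) * ∫⁻ x, (h x)^U := by
    intro N
    let v : Rn n → ℝ := fun x => (min (hlM h x) N).toReal
    have hfin : ∀ x, min (hlM h x) N ≠ ∞ := fun x => ne_top_of_le_ne_top (by simp) (min_le_right _ _)
    have e1 : ∀ x, (min (hlM h x) N)^U = ENNReal.ofReal (v x ^ U) := by
      intro x
      rw [← ENNReal.ofReal_rpow_of_nonneg ENNReal.toReal_nonneg (by linarith),
        ENNReal.ofReal_toReal (hfin x)]
    simp_rw [e1]
    rw [lintegral_rpow_eq_lintegral_meas_lt_mul volume (ae_of_all _ fun x => ENNReal.toReal_nonneg)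
      (by fun_prop) (by linarith)]
    rw [mul_assoc]
    gcongr
    calc ∫⁻ t in Ioi (0:ℝ), volume {a | t < v a} * ENNReal.ofReal (t^(U-1))
        ≤ ∫⁻ t in Ioi (0:ℝ), (ENNReal.ofReal 2 * ENNReal.ofReal (5^n)) *
          ∫⁻ y, (if ENNReal.ofReal (t/2) < h y then ENNReal.ofReal (t^(U-2)) * h y else 0) := by
          refine setLIntegral_mono' measurableSet_Ioi fun t ht => ?_
          have ht' : (0:ℝ) < t := ht
          let g : Rn n → ℝ≥0∞ := fun y => if ENNReal.ofReal (t/2) < h y then h y else 0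
          have hg : Measurable g := Measurable.ite (measurableSet_lt measurable_const hh) hh measurable_const
          have hsub : {a | t < v a} ⊆ {x | ENNReal.ofReal (t/2) < hlM g x} := by
            intro x hx
            have h1 : ENNReal.ofReal t < hlM h x := by
              refine lt_of_lt_of_le ?_ (min_le_left _ (N:ℝ≥0∞))
              exact (ENNReal.ofReal_lt_iff_lt_toReal ht'.le (hfin x)).2 hx
            have h2 := hlM_add_le (h := h) (ENNReal.ofReal (t/2)) hg (fun y => by
              simp only [g]; split_ifs with hy
              · exact le_self_add
              · simpa using not_lt.1 hy) x
            by_contra h3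
            have h3' : hlM g x ≤ ENNReal.ofReal (t/2) := not_lt.1 h3
            have : hlM h x ≤ ENNReal.ofReal t := by
              refine h2.trans ?_
              calc hlM g x + ENNReal.ofReal (t/2) ≤ ENNReal.ofReal (t/2) + ENNReal.ofReal (t/2) := by gcongr
                _ = ENNReal.ofReal t := by rw [← ENNReal.ofReal_add (by positivity) (by positivity)]; ring_nf
            exact absurd this (not_le.2 h1)
          have hw := (measure_mono hsub).trans (weak_type g (ENNReal.ofReal (t/2))
            (by simpa using ht') (by simp))
          have e3 : ∀ y, (if ENNReal.ofReal (t/2) < h y then ENNReal.ofReal (t^(U-2)) * h y else 0) =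
            ENNReal.ofReal (t^(U-2)) * g y := by intro y; simp only [g]; split_ifs <;> simp
          simp_rw [e3]
          rw [lintegral_const_mul _ hg]
          calc _ ≤ (ENNReal.ofReal (t/2))⁻¹ * (ENNReal.ofReal (5^n) * ∫⁻ y, g y) * ENNReal.ofReal (t^(U-1)) := by gcongr
            _ = ((ENNReal.ofReal (t/2))⁻¹ * ENNReal.ofReal (t^(U-1))) * ENNReal.ofReal (5^n) * ∫⁻ y, g y := by ring
            _ = (ENNReal.ofReal 2 * ENNReal.ofReal (t^(U-2))) * ENNReal.ofReal (5^n) * ∫⁻ y, g y := by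
              congr 2
              rw [← ENNReal.ofReal_inv_of_pos (by positivity), ← ENNReal.ofReal_mul (by positivity),
                ← ENNReal.ofReal_mul (by positivity)]
              congr 1
              rw [show U - 1 = (U-2)+1 by ring, Real.rpow_add_one ht'.ne']
              field_simp
            _ = _ := by ring
      _ = (ENNReal.ofReal 2 * ENNReal.ofReal (5^n)) * ∫⁻ y, ∫⁻ t in Ioi (0:ℝ),
          (if ENNReal.ofReal (t/2) < h y then ENNReal.ofReal (t^(U-2)) * h y else 0) := by
          rw [lintegral_const_mul' _ _ (by finiteness), lintegral_lintegral_swap]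
          refine Measurable.aemeasurable ?_
          refine Measurable.ite (measurableSet_lt ?_ ?_) ?_ measurable_const <;> fun_prop
      _ ≤ (ENNReal.ofReal 2 * ENNReal.ofReal (5^n)) * ∫⁻ y, ENNReal.ofReal (2^(U-1)/(U-1)) * (h y)^U := by
          gcongr with y
          exact inner_int U hU (h y)
      _ = _ := by
          rw [lintegral_const_mul _ (by fun_prop)]; ring
  have hmono : ∀ x, (hlM h x)^U = ⨆ N : ℕ, (min (hlM h x) N)^U := by
    intro x
    have h1 : hlM h x = ⨆ N : ℕ, min (hlM h x) (N:ℝ≥0∞) := by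
      rw [← inf_iSup_eq, ENNReal.iSup_natCast, inf_top_eq]
    have := (ENNReal.orderIsoRpow U (by linarith)).map_iSup (fun N : ℕ => min (hlM h x) (N:ℝ≥0∞))
    simp only [ENNReal.orderIsoRpow_apply] at this
    rw [← h1] at this
    exact this
  simp_rw [hmono]
  rw [lintegral_iSup (fun N => by fun_prop)]
  · exact iSup_le key
  · intro N N' hN x
    simp only
    gcongr
def ker (i : ℕ) (z : Rn n) : ℝ≥0∞ :=
  ENNReal.ofReal ((2^i)^n / (1 + 2^i * ‖z‖)^(n+1))
lemma ker_neg (i : ℕ) (z : Rn n) : ker i (-z) = ker i z := by simp [ker]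
lemma meas_ker (i : ℕ) : Measurable (ker (n := n) i) := by unfold ker; fun_prop
def Tk (i : ℕ) (h : Rn n → ℝ≥0∞) (x : Rn n) : ℝ≥0∞ := ∫⁻ y, ker i (x - y) * h y
lemma ker_le (i : ℕ) (z : Rn n) : ker i z ≤ ∑' k : ℕ,
    ENNReal.ofReal ((2^i)^n * 2^(n+1) * ((2^(n+1))⁻¹)^k) *
      (closedBall (0:Rn n) ((2:ℝ)^((k:ℤ)-(i:ℤ)))).indicator 1 z := by
  obtain ⟨m, hm⟩ := pow_unbounded_of_one_lt (2^i * ‖z‖) (one_lt_two)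
  have hex : ∃ k : ℕ, 2^i * ‖z‖ ≤ 2^k := ⟨m, hm.le⟩
  classical
  set k := Nat.find hex with hk
  have hk1 : 2^i * ‖z‖ ≤ 2^k := Nat.find_spec hex
  have hz : z ∈ closedBall (0:Rn n) ((2:ℝ)^((k:ℤ)-(i:ℤ))) := by
    rw [mem_closedBall_zero_iff, zpow_sub₀ (by norm_num), zpow_natCast, zpow_natCast,
      le_div_iff₀ (by positivity)]
    linarith
  refine le_trans ?_ (ENNReal.le_tsum k)
  rw [indicator_of_mem hz]
  simp only [Pi.one_apply, mul_one, ker]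
  apply ENNReal.ofReal_le_ofReal
  rw [div_eq_mul_inv, mul_assoc]
  gcongr
  rcases Nat.eq_zero_or_pos k with h0 | h0
  · rw [h0]
    have : (1:ℝ) ≤ (1 + 2^i * ‖z‖)^(n+1) := one_le_pow₀ (by
      have : 0 ≤ 2^i * ‖z‖ := by positivity
      linarith)
    calc _ ≤ (1:ℝ) := inv_le_one_of_one_le₀ this
      _ ≤ _ := by simpa using one_le_pow₀ (by norm_num)
  · have h1 := Nat.find_min hex (m := k-1) (by omega)
    rw [not_le] at h1
    have h2 : (2:ℝ)^k ≤ 2 * (1 + 2^i * ‖z‖) := by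
      have : (2:ℝ)^k = 2 * 2^(k-1) := by rw [← pow_succ']; congr 1; omega
      rw [this]; linarith
    rw [inv_pow, ← div_eq_mul_inv, inv_eq_one_div, div_le_div_iff₀ (by positivity) (by positivity), one_mul,
      ← pow_mul, mul_comm (n+1) k, pow_mul, ← mul_pow]
    gcongr
lemma Tk_le : ∃ C : ℝ≥0∞, C ≠ ∞ ∧ ∀ (i : ℕ) (h : Rn n → ℝ≥0∞), Measurable h → ∀ x,
    Tk i h x ≤ C * hlM h x := by
  set V := volume (closedBall (0:Rn n) 1)
  have hVt : V ≠ ∞ := measure_closedBall_lt_top.ne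
  refine ⟨ENNReal.ofReal (2^(n+1)) * V * ∑' k : ℕ, (2⁻¹:ℝ≥0∞)^k, ?_, fun i h hh x => ?_⟩
  · rw [ENNReal.tsum_geometric]
    refine ENNReal.mul_ne_top (ENNReal.mul_ne_top (by simp) hVt) ?_
    rw [ENNReal.one_sub_inv_two]; simp
  have h1 : Tk i h x ≤ ∫⁻ y, ∑' k : ℕ, ENNReal.ofReal ((2^i)^n * 2^(n+1) * ((2^(n+1))⁻¹)^k) *
      (closedBall x ((2:ℝ)^((k:ℤ)-(i:ℤ)))).indicator h y := by
    refine lintegral_mono fun y => ?_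
    refine (mul_le_mul' (ker_le i (x-y)) le_rfl).trans ?_
    rw [← ENNReal.tsum_mul_right]
    refine ENNReal.tsum_le_tsum fun k => ?_
    rw [mul_assoc]
    gcongr
    apply le_of_eq
    have : x - y ∈ closedBall (0:Rn n) ((2:ℝ)^((k:ℤ)-(i:ℤ))) ↔ y ∈ closedBall x ((2:ℝ)^((k:ℤ)-(i:ℤ))) := by
      rw [mem_closedBall_zero_iff, mem_closedBall, dist_comm, dist_eq_norm]
    by_cases hy : y ∈ closedBall x ((2:ℝ)^((k:ℤ)-(i:ℤ)))
    · rw [indicator_of_mem (this.2 hy), indicator_of_mem hy]; simp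
    · rw [indicator_of_notMem (fun h => hy (this.1 h)), indicator_of_notMem hy]; simp
  refine h1.trans ?_
  rw [lintegral_tsum (fun k => by
    refine (Measurable.const_mul ?_ _).aemeasurable
    exact hh.indicator isClosed_closedBall.measurableSet)]
  rw [← ENNReal.tsum_mul_left, ← ENNReal.tsum_mul_right]
  refine ENNReal.tsum_le_tsum fun k => ?_
  rw [lintegral_const_mul _ (hh.indicator isClosed_closedBall.measurableSet),
    lintegral_indicator isClosed_closedBall.measurableSet]
  have h2 := le_iSup (fun k : ℤ => (volume (closedBall (0 : Rn n) ((2:ℝ)^k)))⁻¹ *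
          ∫⁻ y in closedBall x ((2:ℝ)^k), h y) ((k:ℤ)-(i:ℤ))
  have hV := vol_cb_pos (n := n) ((2:ℝ)^((k:ℤ)-(i:ℤ))) (by positivity)
  have hV' : volume (closedBall (0:Rn n) ((2:ℝ)^((k:ℤ)-(i:ℤ)))) ≠ ∞ := measure_closedBall_lt_top.ne
  change _ ≤ hlM h x at h2
  rw [mul_comm _⁻¹, ← div_eq_mul_inv, ENNReal.div_le_iff hV hV'] at h2
  have h3 : volume (closedBall (0:Rn n) ((2:ℝ)^((k:ℤ)-(i:ℤ)))) =
      ENNReal.ofReal (((2:ℝ)^((k:ℤ)-(i:ℤ)))^n) * V := by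
    have := vol_scale (n := n) ((2:ℝ)^((k:ℤ)-(i:ℤ))) 1 (by positivity) (by positivity)
    rwa [mul_one] at this
  rw [h3] at h2
  refine (mul_le_mul' le_rfl h2).trans (le_of_eq ?_)
  have h4 : (2⁻¹:ℝ≥0∞)^k = ENNReal.ofReal ((2⁻¹:ℝ)^k) := by
    rw [ENNReal.ofReal_pow (by norm_num), ENNReal.ofReal_inv_of_pos (by norm_num)]; simp
  have h5 : ENNReal.ofReal ((2^i)^n * 2^(n+1) * ((2^(n+1))⁻¹)^k) *
      ENNReal.ofReal (((2:ℝ)^((k:ℤ)-(i:ℤ)))^n) = ENNReal.ofReal (2^(n+1)) * (2⁻¹:ℝ≥0∞)^k := by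
    rw [h4, ← ENNReal.ofReal_mul (by positivity), ← ENNReal.ofReal_mul (by positivity)]
    congr 1
    rw [zpow_sub₀ (by norm_num), zpow_natCast, zpow_natCast]
    have e1 : (((2:ℝ)^(n+1))⁻¹)^k = ((2^k)^(n+1))⁻¹ := by
      rw [inv_pow, ← pow_mul, ← pow_mul, mul_comm]
    have e2 : ((2:ℝ)⁻¹)^k = (2^k)⁻¹ := by rw [inv_pow]
    rw [e1, e2]
    have h2i : (2:ℝ)^i ≠ 0 := by positivity
    have h2k : (2:ℝ)^k ≠ 0 := by positivity
    generalize (2:ℝ)^i = a at *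
    generalize (2:ℝ)^k = b at *
    rw [div_pow]
    field_simp
    try ring
  calc _ = (ENNReal.ofReal ((2^i)^n * 2^(n+1) * ((2^(n+1))⁻¹)^k) *
      ENNReal.ofReal (((2:ℝ)^((k:ℤ)-(i:ℤ)))^n)) * V * hlM h x := by ring
    _ = _ := by rw [h5]; ring
lemma hlM_le_of_le (h : Rn n → ℝ≥0∞) (B : ℝ≥0∞) (hB : ∀ x, h x ≤ B) (x : Rn n) : hlM h x ≤ B := by
  refine iSup_le fun k => ?_
  have h0 := vol_cb_pos (n := n) ((2:ℝ)^k) (by positivity)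
  have h1 : volume (closedBall (0:Rn n) ((2:ℝ)^k)) ≠ ∞ := measure_closedBall_lt_top.ne
  calc _ ≤ (volume (closedBall (0 : Rn n) ((2:ℝ)^k)))⁻¹ * ∫⁻ y in closedBall x ((2:ℝ)^k), B := by
        gcongr; exact hB _
    _ = (volume (closedBall (0 : Rn n) ((2:ℝ)^k)))⁻¹ * volume (closedBall (0 : Rn n) ((2:ℝ)^k)) * B := by
        rw [setLIntegral_const, vol_cb x]; ring
    _ = B := by rw [ENNReal.inv_mul_cancel h0 h1, one_mul]
lemma hlM_mono {h k : Rn n → ℝ≥0∞} (hB : ∀ x, h x ≤ k x) (x : Rn n) : hlM h x ≤ hlM k x :=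
  iSup_mono fun _ => mul_le_mul' le_rfl (lintegral_mono hB)
def Aop (w : ℕ → ℕ → ℝ≥0∞) (g : ℕ → Rn n → ℝ≥0∞) (j : ℕ) (x : Rn n) : ℝ≥0∞ :=
  ∑' v, w j v * Tk (min j v) (g v) x
lemma meas_Tk (i : ℕ) {h : Rn n → ℝ≥0∞} (hh : Measurable h) : Measurable (Tk i h) := by
  unfold Tk
  apply Measurable.lintegral_prod_right' (f := fun q : Rn n × Rn n => ker i (q.1 - q.2) * h q.2)
  have := meas_ker (n := n) i
  fun_prop
lemma meas_Aop (w : ℕ → ℕ → ℝ≥0∞) {g : ℕ → Rn n → ℝ≥0∞} (hg : ∀ j, Measurable (g j)) (j : ℕ) :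
    Measurable (Aop w g j) := by
  unfold Aop
  exact Measurable.tsum fun v => (meas_Tk _ (hg v)).const_mul _
lemma Tk_symm (i : ℕ) {g h : Rn n → ℝ≥0∞} (hg : Measurable g) (hh : Measurable h) :
    ∫⁻ x, Tk i g x * h x = ∫⁻ x, g x * Tk i h x := by
  have hk := meas_ker (n := n) i
  calc ∫⁻ x, Tk i g x * h x = ∫⁻ x, ∫⁻ y, ker i (x - y) * g y * h x := by
        congr with x; rw [Tk, lintegral_mul_const _ (by fun_prop)]
    _ = ∫⁻ y, ∫⁻ x, ker i (x - y) * g y * h x := by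
        rw [lintegral_lintegral_swap]
        exact Measurable.aemeasurable (by fun_prop)
    _ = _ := by
        congr with y
        rw [Tk, ← lintegral_const_mul _ (by fun_prop)]
        congr with x
        rw [← ker_neg, neg_sub]; ring
lemma Aop_symm (w : ℕ → ℕ → ℝ≥0∞) (hw : ∀ j v, w j v = w v j) {g h : ℕ → Rn n → ℝ≥0∞}
    (hg : ∀ j, Measurable (g j)) (hh : ∀ j, Measurable (h j)) :
    ∑' j, ∫⁻ x, Aop w g j x * h j x = ∑' j, ∫⁻ x, g j x * Aop w h j x := by
  have e1 : ∀ j, ∫⁻ x, Aop w g j x * h j x = ∑' v, w j v * ∫⁻ x, Tk (min j v) (g v) x * h j x := by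
    intro j
    unfold Aop
    simp_rw [← ENNReal.tsum_mul_right]
    rw [lintegral_tsum]
    · congr with v
      simp_rw [mul_assoc]
      rw [lintegral_const_mul]
      exact (meas_Tk _ (hg v)).mul (hh j)
    · exact fun v => (((meas_Tk _ (hg v)).const_mul _).mul (hh j)).aemeasurable
  have e2 : ∀ j, ∫⁻ x, g j x * Aop w h j x = ∑' v, w j v * ∫⁻ x, g j x * Tk (min j v) (h v) x := by
    intro j
    unfold Aop
    simp_rw [← ENNReal.tsum_mul_left]
    rw [lintegral_tsum]
    · congr with v
      simp_rw [mul_left_comm (g j _)]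
      rw [lintegral_const_mul]
      exact (hg j).mul (meas_Tk _ (hh v))
    · exact fun v => ((hg j).mul ((meas_Tk _ (hh v)).const_mul _)).aemeasurable
  simp_rw [e1, e2]
  rw [ENNReal.tsum_comm]
  refine tsum_congr fun v => tsum_congr fun j => ?_
  rw [Tk_symm _ (hg v) (hh j), hw, min_comm]
lemma jensen {α : Type*} [MeasurableSpace α] (μ : Measure α) {k g : α → ℝ≥0∞} (hk : Measurable k)
    (hg : Measurable g) (Q : ℝ) (hQ : 1 ≤ Q) :
    (∫⁻ a, k a * g a ∂μ)^Q ≤ (∫⁻ a, k a ∂μ)^(Q-1) * ∫⁻ a, k a * (g a)^Q ∂μ := by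
  rcases eq_or_lt_of_le hQ with rfl | hQ
  · simp
  have hc : Q.HolderConjugate (Q.conjExponent) := Real.HolderConjugate.conjExponent hQ
  set Q' := Q.conjExponent
  have h1 := ENNReal.lintegral_mul_le_Lp_mul_Lq μ hc (f := fun a => (k a)^(1/Q) * g a)
    (g := fun a => (k a)^(1/Q')) (by fun_prop) (by fun_prop)
  have e1 : ∀ a, ((fun a => (k a)^(1/Q) * g a) * fun a => (k a)^(1/Q')) a = k a * g a := by
    intro a
    simp only [Pi.mul_apply]
    rw [mul_right_comm, ← ENNReal.rpow_add_of_nonneg _ _ (by have := hc.pos; positivity) (by have := hc.symm.pos; positivity)]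
    rw [one_div, one_div, hc.inv_add_inv_eq_one, ENNReal.rpow_one]
  simp_rw [e1] at h1
  have e2 : ∀ a, ((k a)^(1/Q) * g a)^Q = k a * (g a)^Q := by
    intro a
    rw [ENNReal.mul_rpow_of_nonneg _ _ hc.nonneg, ← ENNReal.rpow_mul, one_div, inv_mul_cancel₀ hc.ne_zero,
      ENNReal.rpow_one]
  have e3 : ∀ a, ((k a)^(1/Q'))^Q' = k a := by
    intro a
    rw [← ENNReal.rpow_mul, one_div, inv_mul_cancel₀ hc.symm.ne_zero, ENNReal.rpow_one]
  simp_rw [e2, e3] at h1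
  calc _ ≤ _ := ENNReal.rpow_le_rpow h1 hc.nonneg
    _ = _ := by
      rw [ENNReal.mul_rpow_of_nonneg _ _ hc.nonneg, ← ENNReal.rpow_mul, ← ENNReal.rpow_mul,
        one_div, inv_mul_cancel₀ hc.ne_zero, ENNReal.rpow_one, mul_comm]
      congr 2
      have := hc.inv_add_inv_eq_one
      have h0 := hc.ne_zero
      field_simp at this ⊢
      have h0' := hc.symm.ne_zero
      field_simp at this ⊢
      linarith
lemma jensen_tsum {k g : ℕ → ℝ≥0∞} (Q : ℝ) (hQ : 1 ≤ Q) :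
    (∑' a, k a * g a)^Q ≤ (∑' a, k a)^(Q-1) * ∑' a, k a * (g a)^Q := by
  have := jensen Measure.count (measurable_of_countable k) (measurable_of_countable g) Q hQ
  simpa only [lintegral_count] using this
lemma Tk_one : ∃ C : ℝ≥0∞, C ≠ ∞ ∧ ∀ (i : ℕ) (x : Rn n), ∫⁻ y, ker i (x - y) ≤ C := by
  obtain ⟨C, hC, h⟩ := Tk_le (n := n)
  refine ⟨C, hC, fun i x => ?_⟩
  have := h i (fun _ => 1) measurable_const x
  simp only [Tk, mul_one] at this
  refine this.trans ?_
  calc _ ≤ C * 1 := by gcongr; exact hlM_le_of_le _ _ (fun _ => le_rfl) _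
    _ = _ := mul_one _
lemma Aop_props (w : ℕ → ℕ → ℝ≥0∞) (W : ℝ≥0∞) (hW : W ≠ ∞) (hwW : ∀ j, ∑' v, w j v ≤ W) :
    ∃ C : ℝ≥0∞, C ≠ ∞ ∧
      (∀ (g : ℕ → Rn n → ℝ≥0∞) (h : Rn n → ℝ≥0∞), Measurable h → (∀ v x, g v x ≤ h x) →
        ∀ j x, Aop w g j x ≤ C * hlM h x) ∧
      (∀ Q : ℝ, 1 ≤ Q → ∃ D : ℝ≥0∞, D ≠ ∞ ∧ ∀ (g : ℕ → Rn n → ℝ≥0∞), (∀ v, Measurable (g v)) →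
        ∀ j x, (Aop w g j x)^Q ≤ D * Aop w (fun v x => (g v x)^Q) j x) := by
  obtain ⟨C, hC, h⟩ := Tk_le (n := n)
  obtain ⟨C', hC', h'⟩ := Tk_one (n := n)
  refine ⟨W * C, ENNReal.mul_ne_top hW hC, fun g k hk hgk j x => ?_, fun Q hQ => ?_⟩
  · calc Aop w g j x ≤ ∑' v, w j v * (C * hlM k x) := by
          refine ENNReal.tsum_le_tsum fun v => ?_
          gcongr
          refine le_trans ?_ (h (min j v) k hk x)
          exact lintegral_mono fun y => mul_le_mul' le_rfl (hgk v y)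
      _ ≤ _ := by rw [ENNReal.tsum_mul_right, mul_assoc]; gcongr; exact hwW j
  · refine ⟨W^(Q-1) * C'^(Q-1), ENNReal.mul_ne_top (ENNReal.rpow_ne_top_of_nonneg (by linarith) hW)
      (ENNReal.rpow_ne_top_of_nonneg (by linarith) hC'), fun g hg j x => ?_⟩
    refine (jensen_tsum Q hQ).trans ?_
    rw [mul_assoc]
    refine mul_le_mul' (ENNReal.rpow_le_rpow (hwW j) (by linarith)) ?_
    rw [Aop, ← ENNReal.tsum_mul_left]
    refine ENNReal.tsum_le_tsum fun v => ?_
    rw [mul_left_comm]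
    gcongr
    have hm := meas_ker (n := n) (min j v)
    refine (jensen volume (k := fun y => ker (min j v) (x - y)) (by fun_prop) (hg v) Q hQ).trans ?_
    refine mul_le_mul' (ENNReal.rpow_le_rpow (h' _ _) (by linarith)) le_rfl
def trc (N : ℕ) (S : Rn n → ℝ≥0∞) : Rn n → ℝ≥0∞ :=
  (closedBall 0 (N:ℝ)).indicator fun x => min (S x) N
lemma meas_trc (N : ℕ) {S : Rn n → ℝ≥0∞} (hS : Measurable S) : Measurable (trc N S) :=
  (hS.min measurable_const).indicator isClosed_closedBall.measurableSet
lemma trc_le (N : ℕ) (S : Rn n → ℝ≥0∞) (x) : trc N S x ≤ S x := by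
  unfold trc; by_cases h : x ∈ closedBall 0 (N:ℝ) <;> simp [indicator, h]
lemma trc_le_ind (N : ℕ) (S : Rn n → ℝ≥0∞) (x) :
    trc N S x ≤ (closedBall 0 (N:ℝ)).indicator (fun _ => (N:ℝ≥0∞)) x := by
  unfold trc; by_cases h : x ∈ closedBall 0 (N:ℝ) <;> simp [indicator, h]
lemma trc_mono (S : Rn n → ℝ≥0∞) (x) : Monotone fun N => trc N S x := by
  intro N M hNM
  have hc : (N:ℝ) ≤ M := by exact_mod_cast hNM
  have hc' : (N:ℝ≥0∞) ≤ M := by exact_mod_cast hNM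
  simp only [trc, indicator]
  split_ifs with h1 h2
  · exact min_le_min_left _ hc'
  · exact absurd (closedBall_subset_closedBall hc h1) h2
  · exact zero_le
  · exact le_rfl
lemma trc_iSup (S : Rn n → ℝ≥0∞) (x) : ⨆ N, trc N S x = S x := by
  apply le_antisymm (iSup_le fun N => trc_le N S x)
  refine le_of_forall_lt fun c hc => ?_
  obtain ⟨N, hN⟩ := exists_nat_ge ‖x‖
  obtain ⟨M, hM⟩ := ENNReal.exists_nat_gt (ne_top_of_lt hc)
  refine lt_of_lt_of_le ?_ (le_iSup _ (max N M))
  rw [trc, indicator_of_mem]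
  · refine lt_min hc (hM.trans_le ?_)
    exact_mod_cast le_max_right _ _
  · rw [mem_closedBall_zero_iff]
    refine hN.trans ?_
    exact_mod_cast le_max_left _ _
lemma lint_ind_lt (N : ℕ) (b : ℝ≥0∞) (hb : b ≠ ∞) (R : ℝ) (hR : 0 < R) :
    ∫⁻ x : Rn n, ((closedBall 0 (N:ℝ)).indicator (fun _ => b) x)^R ≠ ∞ := by
  have : ∀ x : Rn n, ((closedBall 0 (N:ℝ)).indicator (fun _ => b) x)^R =
      (closedBall 0 (N:ℝ)).indicator (fun _ => b^R) x := by
    intro x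
    by_cases h : x ∈ closedBall 0 (N:ℝ) <;> simp [indicator, h, hR]
  simp_rw [this]
  rw [lintegral_indicator isClosed_closedBall.measurableSet, setLIntegral_const]
  exact ENNReal.mul_ne_top (ENNReal.rpow_ne_top_of_nonneg hR.le hb) measure_closedBall_lt_top.ne
lemma absorb {a B : ℝ≥0∞} (ha : a ≠ ∞) {R R' : ℝ} (hc : R.HolderConjugate R')
    (h : a ≤ B * a^(1/R')) : a ≤ B^R := by
  rcases eq_or_ne a 0 with h0 | h0
  · rw [h0]; exact zero_le
  have h1 : a^(1/R) ≤ B := by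
    have e : a = a^(1/R) * a^(1/R') := by
      rw [← ENNReal.rpow_add _ _ h0 ha, one_div, one_div, hc.inv_add_inv_eq_one, ENNReal.rpow_one]
    nth_rw 1 [e] at h
    refine (ENNReal.mul_le_mul_iff_left (c := a^(1/R')) ?_ ?_).1 h
    · simp [ENNReal.rpow_eq_zero_iff, h0, ha]
    · exact ENNReal.rpow_ne_top_of_nonneg (by have := hc.symm.pos; positivity) ha
  calc a = (a^(1/R))^R := by rw [← ENNReal.rpow_mul, one_div, inv_mul_cancel₀ hc.ne_zero, ENNReal.rpow_one]
    _ ≤ _ := ENNReal.rpow_le_rpow h1 hc.nonneg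
lemma dualD {R R' : ℝ} (hc : R.HolderConjugate R') {S : Rn n → ℝ≥0∞} (hS : Measurable S) (B : ℝ≥0∞)
    (h : ∀ k : Rn n → ℝ≥0∞, Measurable k → ∫⁻ x, S x * k x ≤ B * (∫⁻ x, (k x)^R')^(1/R')) :
    ∫⁻ x, (S x)^R ≤ B^R := by
  have e : ∫⁻ x, (S x)^R = ⨆ N, ∫⁻ x, (trc N S x)^R := by
    rw [← lintegral_iSup]
    · congr with x
      rw [← trc_iSup S x]
      exact (ENNReal.orderIsoRpow R hc.pos).map_iSup _
    · exact fun N => (meas_trc N hS).pow_const _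
    · exact fun N M hNM x => ENNReal.rpow_le_rpow (trc_mono S x hNM) hc.nonneg
  rw [e]
  refine iSup_le fun N => ?_
  have hfin : ∫⁻ x, (trc N S x)^R ≠ ∞ := ne_top_of_le_ne_top (lint_ind_lt (n := n) N N (by simp) R hc.pos)
    (lintegral_mono fun x => ENNReal.rpow_le_rpow (trc_le_ind N S x) hc.nonneg)
  refine absorb hfin hc ?_
  have h1 := h (fun x => (trc N S x)^(R-1)) ((meas_trc N hS).pow_const _)
  refine le_trans (lintegral_mono fun x => ?_) (h1.trans (le_of_eq ?_))
  · have : (trc N S x)^R = trc N S x * (trc N S x)^(R-1) := by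
      nth_rw 2 [← ENNReal.rpow_one (trc N S x)]
      rw [← ENNReal.rpow_add_of_nonneg _ _ (by norm_num) (by have := hc.lt; linarith)]
      congr 1; ring
    simp only [this]
    gcongr
    exact trc_le N S x
  · congr 3 with x
    rw [← ENNReal.rpow_mul, hc.sub_one_mul_conj]
lemma V1 (w : ℕ → ℕ → ℝ≥0∞) (hw : ∀ j v, w j v = w v j) (W : ℝ≥0∞) (hW : W ≠ ∞)
    (hwW : ∀ j, ∑' v, w j v ≤ W) (P Q : ℝ) (hQ : 1 < Q) (hPQ : Q ≤ P) :
    ∃ C : ℝ≥0∞, C ≠ ∞ ∧ ∀ g : ℕ → Rn n → ℝ≥0∞, (∀ v, Measurable (g v)) →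
      ∫⁻ x, (∑' j, (Aop w g j x)^Q)^(P/Q) ≤ C * ∫⁻ x, (∑' j, (g j x)^Q)^(P/Q) := by
  obtain ⟨C, hC, h1, h2⟩ := Aop_props (n := n) w W hW hwW
  obtain ⟨D, hD, h2⟩ := h2 Q hQ.le
  have hQ0 : 0 < Q := by linarith
  have key : ∀ (g : ℕ → Rn n → ℝ≥0∞), (∀ v, Measurable (g v)) → ∀ k : Rn n → ℝ≥0∞, Measurable k →
      ∫⁻ x, (∑' j, (Aop w g j x)^Q) * k x ≤ D * C * ∫⁻ x, (∑' j, (g j x)^Q) * hlM k x := by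
    intro g hg k hk
    have hgQ : ∀ v, Measurable (fun x => (g v x)^Q) := fun v => (hg v).pow_const _
    calc ∫⁻ x, (∑' j, (Aop w g j x)^Q) * k x
        ≤ ∫⁻ x, ∑' j, D * (Aop w (fun v x => (g v x)^Q) j x * k x) := by
          refine lintegral_mono fun x => ?_
          rw [← ENNReal.tsum_mul_right]
          refine ENNReal.tsum_le_tsum fun j => ?_
          rw [← mul_assoc]; gcongr; exact h2 g hg j x
      _ = D * ∑' j, ∫⁻ x, Aop w (fun v x => (g v x)^Q) j x * k x := by
          rw [lintegral_tsum, ← ENNReal.tsum_mul_left]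
          · refine tsum_congr fun j => ?_
            exact lintegral_const_mul _ ((meas_Aop w hgQ j).mul hk)
          · exact fun j => (((meas_Aop w hgQ j).mul hk).const_mul _).aemeasurable
      _ = D * ∑' j, ∫⁻ x, (g j x)^Q * Aop w (fun _ => k) j x := by
          rw [Aop_symm w hw hgQ (fun _ => hk)]
      _ ≤ D * ∑' j, ∫⁻ x, C * ((g j x)^Q * hlM k x) := by
          refine mul_le_mul' le_rfl (ENNReal.tsum_le_tsum fun j => lintegral_mono fun x => ?_)
          rw [mul_left_comm C]
          gcongr
          exact h1 (fun _ => k) k hk (fun _ _ => le_rfl) j x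
      _ = _ := by
          have hM := meas_hlM hk
          rw [mul_assoc]
          congr 1
          rw [← lintegral_tsum, ← lintegral_const_mul]
          · congr with x
            rw [ENNReal.tsum_mul_left, ENNReal.tsum_mul_right]
          · exact (Measurable.tsum hgQ).mul hM
          · exact fun j => (((hgQ j).mul hM).const_mul _).aemeasurable
  rcases eq_or_lt_of_le hPQ with rfl | hPQ
  · refine ⟨D * C, ENNReal.mul_ne_top hD hC, fun g hg => ?_⟩
    have := key g hg (fun _ => 1) measurable_const
    simp only [mul_one] at this
    rw [div_self hQ0.ne']
    simp only [ENNReal.rpow_one]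
    refine this.trans ?_
    gcongr with x
    calc _ ≤ _ * (1:ℝ≥0∞) := mul_le_mul' le_rfl (hlM_le_of_le _ _ (fun _ => le_rfl) _)
      _ = _ := mul_one _
  · have hR : 1 < P/Q := by rw [lt_div_iff₀ hQ0]; linarith
    have hc : (P/Q).HolderConjugate ((P/Q).conjExponent) := Real.HolderConjugate.conjExponent hR
    set R := P/Q
    set R' := R.conjExponent
    obtain ⟨M, hM, hst⟩ := strong_type (n := n) R' hc.symm.lt
    refine ⟨(D * C * M^(1/R'))^R, ?_, fun g hg => ?_⟩
    · refine ENNReal.rpow_ne_top_of_nonneg hc.nonneg (ENNReal.mul_ne_top (ENNReal.mul_ne_top hD hC)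
        (ENNReal.rpow_ne_top_of_nonneg (by have := hc.symm.pos; positivity) hM))
    have hS : Measurable fun x => ∑' j, (Aop w g j x)^Q :=
      Measurable.tsum fun j => (meas_Aop w hg j).pow_const _
    have hG : Measurable fun x => ∑' j, (g j x)^Q := Measurable.tsum fun j => (hg j).pow_const _
    have := dualD hc hS (D * C * M^(1/R') * (∫⁻ x, (∑' j, (g j x)^Q)^R)^(1/R)) ?_
    · refine this.trans (le_of_eq ?_)
      rw [ENNReal.mul_rpow_of_nonneg _ _ hc.nonneg, ← ENNReal.rpow_mul,
        one_div_mul_cancel hc.ne_zero, ENNReal.rpow_one]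
    · intro k hk
      refine (key g hg k hk).trans ?_
      have hh := ENNReal.lintegral_mul_le_Lp_mul_Lq volume hc hG.aemeasurable (meas_hlM hk).aemeasurable
      simp only [Pi.mul_apply] at hh
      have h3 : (∫⁻ x, (hlM k x)^R')^(1/R') ≤ M^(1/R') * (∫⁻ x, (k x)^R')^(1/R') := by
        have hp : 0 ≤ 1/R' := by have := hc.symm.pos; positivity
        rw [← ENNReal.mul_rpow_of_nonneg _ _ hp]
        exact ENNReal.rpow_le_rpow (hst k hk) hp
      calc _ ≤ D * C * ((∫⁻ x, (∑' j, (g j x)^Q)^R)^(1/R) * (M^(1/R') * (∫⁻ x, (k x)^R')^(1/R'))) := by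
            gcongr; exact hh.trans (by gcongr)
        _ = _ := by ring
def trs (N : ℕ) (g : ℕ → Rn n → ℝ≥0∞) (j : ℕ) (x : Rn n) : ℝ≥0∞ := if j < N then trc N (g j) x else 0
lemma meas_trs (N : ℕ) {g : ℕ → Rn n → ℝ≥0∞} (hg : ∀ v, Measurable (g v)) (j : ℕ) :
    Measurable (trs N g j) := by
  unfold trs; split_ifs
  · exact meas_trc N (hg j)
  · exact measurable_const
lemma trs_le (N : ℕ) (g : ℕ → Rn n → ℝ≥0∞) (j x) : trs N g j x ≤ g j x := by
  unfold trs; split_ifs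
  · exact trc_le N _ x
  · exact zero_le
lemma trs_mono (g : ℕ → Rn n → ℝ≥0∞) (j x) : Monotone fun N => trs N g j x := by
  intro N M h
  simp only [trs]
  split_ifs with h1 h2
  · exact trc_mono _ x h
  · omega
  · exact zero_le
  · exact le_rfl
lemma trs_iSup (g : ℕ → Rn n → ℝ≥0∞) (j x) : ⨆ N, trs N g j x = g j x := by
  apply le_antisymm (iSup_le fun N => trs_le N g j x)
  rw [← trc_iSup (g j) x]
  refine iSup_le fun N => ?_
  refine le_trans ?_ (le_iSup _ (max N (j+1)))
  rw [trs, if_pos (by omega)]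
  exact trc_mono _ x (by omega)
lemma V2 (w : ℕ → ℕ → ℝ≥0∞) (hw : ∀ j v, w j v = w v j) (W : ℝ≥0∞) (hW : W ≠ ∞)
    (hwW : ∀ j, ∑' v, w j v ≤ W) (P Q : ℝ) (hP : 1 < P) (hPQ : P < Q) :
    ∃ C : ℝ≥0∞, C ≠ ∞ ∧ ∀ g : ℕ → Rn n → ℝ≥0∞, (∀ v, Measurable (g v)) →
      ∫⁻ x, (∑' j, (Aop w g j x)^Q)^(P/Q) ≤ C * ∫⁻ x, (∑' j, (g j x)^Q)^(P/Q) := by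
  have hP0 : 0 < P := by linarith
  have hQ1 : 1 < Q := by linarith
  have hQ0 : 0 < Q := by linarith
  have hcP : P.HolderConjugate (P.conjExponent) := Real.HolderConjugate.conjExponent hP
  have hcQ : Q.HolderConjugate (Q.conjExponent) := Real.HolderConjugate.conjExponent hQ1
  have eP : P.conjExponent = P/(P-1) := rfl
  have eQ : Q.conjExponent = Q/(Q-1) := rfl
  set P' := P.conjExponent
  set Q' := Q.conjExponent
  have hP'0 : 0 < P' := hcP.symm.pos
  have hQ'0 : 0 < Q' := hcQ.symm.pos
  have hQP' : Q' ≤ P' := by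
    rw [eP, eQ, div_le_div_iff₀ (by linarith) (by linarith)]; nlinarith
  obtain ⟨C, hC, hV⟩ := V1 (n := n) w hw W hW hwW P' Q' hcQ.symm.lt hQP'
  refine ⟨(C^(1/P'))^P, ENNReal.rpow_ne_top_of_nonneg hP0.le
    (ENNReal.rpow_ne_top_of_nonneg (by positivity) hC), fun g hg => ?_⟩
  have hAg := meas_Aop w hg
  have hX : ∀ x, ⨆ N, (∑' j, (trs N (Aop w g) j x)^Q)^(P/Q) = (∑' j, (Aop w g j x)^Q)^(P/Q) := by
    intro x
    refine ((ENNReal.orderIsoRpow (P/Q) (by positivity)).map_iSup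
      (fun N => ∑' j, (trs N (Aop w g) j x)^Q)).symm.trans ?_
    simp only [ENNReal.orderIsoRpow_apply]
    congr 1
    simp_rw [← lintegral_count]
    rw [← lintegral_iSup]
    · congr with j
      rw [← trs_iSup (Aop w g) j x]
      exact ((ENNReal.orderIsoRpow Q hQ0).map_iSup fun N => trs N (Aop w g) j x).symm
    · exact fun N => measurable_of_countable _
    · exact fun N M h j => ENNReal.rpow_le_rpow (trs_mono _ j x h) hQ0.le
  simp_rw [← hX]
  rw [lintegral_iSup]
  rotate_left
  · exact fun N => (Measurable.tsum fun j => (meas_trs N hAg j).pow_const _).pow_const _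
  · refine fun N M h x => ENNReal.rpow_le_rpow (ENNReal.tsum_le_tsum fun j => ?_) (by positivity)
    exact ENNReal.rpow_le_rpow (trs_mono _ j x h) hQ0.le
  refine iSup_le fun N => ?_
  set u := trs N (Aop w g)
  have hu : ∀ j, Measurable (u j) := meas_trs N hAg
  set Us : Rn n → ℝ≥0∞ := fun x => ∑' j, (u j x)^Q with hUs
  have hUm : Measurable Us := Measurable.tsum fun j => (hu j).pow_const _
  have hUb : ∀ x, Us x ≤ (closedBall 0 (N:ℝ)).indicator (fun _ => (N:ℝ≥0∞) * (N:ℝ≥0∞)^Q) x := by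
    intro x
    rw [hUs]
    simp only
    rw [tsum_eq_sum (s := Finset.range N)]
    · have : ∀ j ∈ Finset.range N, (u j x)^Q ≤ (closedBall 0 (N:ℝ)).indicator (fun _ => (N:ℝ≥0∞)^Q) x := by
        intro j hj
        have h1 : u j x = trc N (Aop w g j) x := if_pos (Finset.mem_range.1 hj)
        rw [h1]
        refine (ENNReal.rpow_le_rpow (trc_le_ind N _ x) hQ0.le).trans ?_
        by_cases h : x ∈ closedBall 0 (N:ℝ) <;> simp [indicator, h, hQ0]
      refine (Finset.sum_le_sum this).trans ?_
      rw [Finset.sum_const, Finset.card_range, nsmul_eq_mul]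
      by_cases h : x ∈ closedBall 0 (N:ℝ) <;> simp [indicator, h]
    · intro j hj
      have h1 : u j x = 0 := if_neg (by simpa using hj)
      rw [h1, ENNReal.zero_rpow_of_pos hQ0]
  have hNN : (N:ℝ≥0∞) * (N:ℝ≥0∞)^Q ≠ ∞ := ENNReal.mul_ne_top (by simp)
    (ENNReal.rpow_ne_top_of_nonneg hQ0.le (by simp))
  have hUt : ∀ x, Us x ≠ ∞ := by
    intro x
    refine ne_top_of_le_ne_top ?_ (hUb x)
    by_cases h : x ∈ closedBall 0 (N:ℝ)
    · rw [indicator_of_mem h]; exact hNN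
    · rw [indicator_of_notMem h]; simp
  have hfin : ∫⁻ x, (Us x)^(P/Q) ≠ ∞ :=
    ne_top_of_le_ne_top (lint_ind_lt (n := n) N _ hNN (P/Q) (by positivity))
      (lintegral_mono fun x => ENNReal.rpow_le_rpow (hUb x) (by positivity))
  set g' : ℕ → Rn n → ℝ≥0∞ := fun j x => (u j x)^(Q-1) * (Us x)^((P-Q)/Q)
  have hg' : ∀ j, Measurable (g' j) := fun j => ((hu j).pow_const _).mul (hUm.pow_const _)
  have hu0 : ∀ x, Us x = 0 → ∀ j, u j x = 0 := by
    intro x hx j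
    have := ENNReal.tsum_eq_zero.1 hx j
    simpa [ENNReal.rpow_eq_zero_iff, hQ0, hQ0.not_gt] using this
  have p1 : ∀ x, (Us x)^(P/Q) ≤ ∑' j, Aop w g j x * g' j x := by
    intro x
    rcases eq_or_ne (Us x) 0 with h0 | h0
    · rw [h0, ENNReal.zero_rpow_of_pos (by positivity)]; exact zero_le
    calc (Us x)^(P/Q) = (Us x) * (Us x)^((P-Q)/Q) := by
          nth_rw 2 [← ENNReal.rpow_one (Us x)]
          rw [← ENNReal.rpow_add _ _ h0 (hUt x)]
          congr 1; field_simp; ring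
      _ = ∑' j, u j x * g' j x := by
          rw [hUs]; simp only
          rw [← ENNReal.tsum_mul_right]
          refine tsum_congr fun j => ?_
          simp only [g']
          rw [← mul_assoc]
          congr 1
          nth_rw 2 [← ENNReal.rpow_one (u j x)]
          rw [← ENNReal.rpow_add_of_nonneg _ _ (by norm_num) (by linarith)]
          congr 1; ring
      _ ≤ _ := ENNReal.tsum_le_tsum fun j => mul_le_mul' (trs_le _ _ _ _) le_rfl
  have p2 : ∀ x, (∑' j, (g' j x)^Q')^(P'/Q') ≤ (Us x)^(P/Q) := by
    intro x
    rcases eq_or_ne (Us x) 0 with h0 | h0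
    · have : ∀ j, (g' j x)^Q' = 0 := by
        intro j
        simp only [g']
        rw [hu0 x h0 j, ENNReal.zero_rpow_of_pos (by linarith), zero_mul, ENNReal.zero_rpow_of_pos hQ'0]
      simp_rw [this]
      rw [tsum_zero, ENNReal.zero_rpow_of_pos (by positivity)]; exact zero_le
    apply le_of_eq
    have : ∀ j, (g' j x)^Q' = (u j x)^Q * (Us x)^((P-Q)/Q*Q') := by
      intro j
      simp only [g']
      rw [ENNReal.mul_rpow_of_nonneg _ _ hQ'0.le, ← ENNReal.rpow_mul, ← ENNReal.rpow_mul,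
        hcQ.sub_one_mul_conj]
    simp_rw [this]
    rw [ENNReal.tsum_mul_right]
    change ((Us x) * _)^_ = _
    nth_rw 1 [← ENNReal.rpow_one (Us x)]
    rw [← ENNReal.rpow_add _ _ h0 (hUt x), ← ENNReal.rpow_mul]
    congr 1
    rw [eP, eQ]
    have : P - 1 ≠ 0 := by linarith
    have : Q - 1 ≠ 0 := by linarith
    field_simp
    ring
  have hAg' := meas_Aop w hg'
  have hG : Measurable fun x => (∑' j, (g j x)^Q)^(1/Q) :=
    (Measurable.tsum fun j => (hg j).pow_const _).pow_const _
  have hG' : Measurable fun x => (∑' j, (Aop w g' j x)^Q')^(1/Q') :=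
    (Measurable.tsum fun j => (hAg' j).pow_const _).pow_const _
  have main : ∫⁻ x, (Us x)^(P/Q) ≤
      (C^(1/P') * (∫⁻ x, (∑' j, (g j x)^Q)^(P/Q))^(1/P)) * (∫⁻ x, (Us x)^(P/Q))^(1/P') := by
    calc ∫⁻ x, (Us x)^(P/Q) ≤ ∫⁻ x, ∑' j, Aop w g j x * g' j x := lintegral_mono p1
      _ = ∑' j, ∫⁻ x, Aop w g j x * g' j x := lintegral_tsum fun j => ((hAg j).mul (hg' j)).aemeasurable
      _ = ∑' j, ∫⁻ x, g j x * Aop w g' j x := Aop_symm w hw hg hg'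
      _ = ∫⁻ x, ∑' j, g j x * Aop w g' j x :=
          (lintegral_tsum fun j => ((hg j).mul (hAg' j)).aemeasurable).symm
      _ ≤ ∫⁻ x, (∑' j, (g j x)^Q)^(1/Q) * (∑' j, (Aop w g' j x)^Q')^(1/Q') := by
          refine lintegral_mono fun x => ?_
          have := ENNReal.lintegral_mul_le_Lp_mul_Lq Measure.count hcQ
            (measurable_of_countable fun j => g j x).aemeasurable
            (measurable_of_countable fun j => Aop w g' j x).aemeasurable
          simpa only [lintegral_count, Pi.mul_apply] using this
      _ ≤ _ := ENNReal.lintegral_mul_le_Lp_mul_Lq volume hcP hG.aemeasurable hG'.aemeasurable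
      _ = (∫⁻ x, (∑' j, (g j x)^Q)^(P/Q))^(1/P) *
          (∫⁻ x, (∑' j, (Aop w g' j x)^Q')^(P'/Q'))^(1/P') := by
          simp_rw [← ENNReal.rpow_mul, one_div_mul_eq_div]
      _ ≤ (∫⁻ x, (∑' j, (g j x)^Q)^(P/Q))^(1/P) * (C * ∫⁻ x, (Us x)^(P/Q))^(1/P') := by
          gcongr
          refine (hV g' hg').trans ?_
          gcongr
          exact p2 _
      _ = _ := by
          rw [ENNReal.mul_rpow_of_nonneg _ _ (by positivity)]; ring
  refine (absorb hfin hcP main).trans (le_of_eq ?_)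
  rw [ENNReal.mul_rpow_of_nonneg _ _ hP0.le, ← ENNReal.rpow_mul (∫⁻ x, (∑' j, (g j x)^Q)^(P/Q)),
    one_div_mul_cancel hP0.ne', ENNReal.rpow_one]
lemma VV (w : ℕ → ℕ → ℝ≥0∞) (hw : ∀ j v, w j v = w v j) (W : ℝ≥0∞) (hW : W ≠ ∞)
    (hwW : ∀ j, ∑' v, w j v ≤ W) (p q : ℝ≥0∞) (hp' : p ≠ ∞) (r : ℝ) (hr : 0 < r)
    (hrp : ENNReal.ofReal r < p) (hrq : ENNReal.ofReal r < q) :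
    ∃ C : ℝ≥0∞, C ≠ ∞ ∧ ∀ g : ℕ → Rn n → ℝ≥0∞, (∀ v, Measurable (g v)) →
      lpNormENN p (fun x => lqSum q fun j => (Aop w g j x)^(1/r)) ≤
        C * lpNormENN p (fun x => lqSum q fun j => (g j x)^(1/r)) := by
  have hrp' : r < p.toReal := by
    rw [← ENNReal.ofReal_lt_ofReal_iff_of_nonneg hr.le, ENNReal.ofReal_toReal hp']; exact hrp
  have hp0 : 0 < p.toReal := hr.trans hrp'
  have hP : 1 < p.toReal / r := by rw [lt_div_iff₀ hr]; linarith
  unfold lpNormENN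
  simp only [if_neg hp']
  suffices h : ∃ C : ℝ≥0∞, C ≠ ∞ ∧ ∀ g : ℕ → Rn n → ℝ≥0∞, (∀ v, Measurable (g v)) →
      ∫⁻ x, (lqSum q fun j => (Aop w g j x)^(1/r))^p.toReal ≤
        C * ∫⁻ x, (lqSum q fun j => (g j x)^(1/r))^p.toReal by
    obtain ⟨C, hC, h⟩ := h
    refine ⟨C^(1/p.toReal), ENNReal.rpow_ne_top_of_nonneg (by positivity) hC, fun g hg => ?_⟩
    rw [← ENNReal.mul_rpow_of_nonneg _ _ (by positivity)]
    exact ENNReal.rpow_le_rpow (h g hg) (by positivity)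
  by_cases hq : q = ∞
  · obtain ⟨C, hC, h1, -⟩ := Aop_props (n := n) w W hW hwW
    obtain ⟨M, hM, hst⟩ := strong_type (n := n) _ hP
    refine ⟨C^(p.toReal/r) * M, ENNReal.mul_ne_top (ENNReal.rpow_ne_top_of_nonneg (by positivity) hC) hM,
      fun g hg => ?_⟩
    simp only [lqSum, if_pos hq]
    have hs : ∀ t : ℕ → ℝ≥0∞, (⨆ j, (t j)^(1/r))^p.toReal = (⨆ j, t j)^(p.toReal/r) := by
      intro t
      have := (ENNReal.orderIsoRpow (1/r) (by positivity)).map_iSup t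
      simp only [ENNReal.orderIsoRpow_apply] at this
      rw [← this, ← ENNReal.rpow_mul, one_div_mul_eq_div]
    simp_rw [hs]
    have hgm : Measurable fun x => ⨆ j, g j x := Measurable.iSup hg
    calc _ ≤ ∫⁻ x, (C * hlM (fun x => ⨆ j, g j x) x)^(p.toReal/r) := by
          refine lintegral_mono fun x => ENNReal.rpow_le_rpow (iSup_le fun j => ?_) (by positivity)
          exact h1 g _ hgm (fun v x => le_iSup (fun j => g j x) v) j x
      _ = C^(p.toReal/r) * ∫⁻ x, (hlM (fun x => ⨆ j, g j x) x)^(p.toReal/r) := by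
          simp_rw [ENNReal.mul_rpow_of_nonneg _ _ (show 0 ≤ p.toReal/r by positivity)]
          exact lintegral_const_mul _ ((meas_hlM hgm).pow_const _)
      _ ≤ _ := by rw [mul_assoc]; gcongr; exact hst _ hgm
  · have hrq' : r < q.toReal := by
      rw [← ENNReal.ofReal_lt_ofReal_iff_of_nonneg hr.le, ENNReal.ofReal_toReal hq]; exact hrq
    have hq0 : 0 < q.toReal := hr.trans hrq'
    have hQ : 1 < q.toReal / r := by rw [lt_div_iff₀ hr]; linarith
    have key : ∃ C : ℝ≥0∞, C ≠ ∞ ∧ ∀ g : ℕ → Rn n → ℝ≥0∞, (∀ v, Measurable (g v)) →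
      ∫⁻ x, (∑' j, (Aop w g j x)^(q.toReal/r))^(p.toReal/r/(q.toReal/r)) ≤
        C * ∫⁻ x, (∑' j, (g j x)^(q.toReal/r))^(p.toReal/r/(q.toReal/r)) := by
      rcases le_or_gt (q.toReal/r) (p.toReal/r) with h | h
      · exact V1 w hw W hW hwW _ _ hQ h
      · exact V2 w hw W hW hwW _ _ hP h
    have e : p.toReal/r/(q.toReal/r) = 1/q.toReal * p.toReal := by field_simp
    simp only [lqSum, if_neg hq, ← ENNReal.rpow_mul]
    rw [e] at key
    simpa only [one_div_mul_eq_div] using key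
variable {F : Type*} [NormedAddCommGroup F] [NormedSpace ℝ F]
abbrev bv (i : Fin n) : Rn n := EuclideanSpace.single i (1:ℝ)
def LD (l : List (Fin n)) (g : Rn n → F) : Rn n → F := l.foldr pd g
lemma LD_cons (i : Fin n) (l : List (Fin n)) (g : Rn n → F) : LD (i :: l) g = pd i (LD l g) := rfl
lemma pd_eq {g : Rn n → F} (hg : ContDiff ℝ 1 g) (i : Fin n) :
    pd i g = fun x => fderiv ℝ g x (bv i) := by
  ext x
  exact ((hg.differentiable (by norm_num)) x).lineDeriv_eq_fderiv
lemma pd_contDiff {g : Rn n → F} {k : ℕ} (hg : ContDiff ℝ (k+1 : ℕ) g) (i : Fin n) :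
    ContDiff ℝ k (pd i g) := by
  rw [pd_eq (hg.of_le (by norm_cast; omega))]
  exact (hg.fderiv_right (m := k) (by norm_cast)).clm_apply contDiff_const
lemma LD_contDiff {g : Rn n → F} {m : ℕ} (hg : ContDiff ℝ m g) (l : List (Fin n)) :
    ∀ k, k + l.length ≤ m → ContDiff ℝ k (LD l g) := by
  induction l with
  | nil => exact fun k hk => hg.of_le (by norm_cast)
  | cons i l ih =>
    intro k hk
    rw [LD_cons]
    exact pd_contDiff (ih (k+1) (by simp at hk; omega)) i
lemma LD_eq {g : Rn n → F} {m : ℕ} (hg : ContDiff ℝ m g) (l : List (Fin n)) (hl : l.length ≤ m) (x : Rn n) :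
    LD l g x = iteratedFDeriv ℝ l.length g x (fun i => bv (l.get i)) := by
  induction l generalizing x with
  | nil => simp [LD]
  | cons i l ih =>
    simp only [List.length_cons] at hl
    rw [LD_cons, pd_eq (LD_contDiff hg l 1 (by omega))]
    simp only
    have e : LD l g = fun x => iteratedFDeriv ℝ l.length g x (fun i => bv (l.get i)) :=
      funext fun x => ih (by omega) x
    have hd : DifferentiableAt ℝ (iteratedFDeriv ℝ l.length g) x :=
      (hg.differentiable_iteratedFDeriv (m := l.length) (by norm_cast)) x
    rw [e, fderiv_continuousMultilinear_apply_const_apply hd]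
    simp only [List.length_cons]
    rw [iteratedFDeriv_succ_apply_left]
    rfl
lemma pd_comm {g : Rn n → F} (hg : ContDiff ℝ 2 g) (i j : Fin n) : pd i (pd j g) = pd j (pd i g) := by
  have h1 : ContDiff ℝ 1 g := hg.of_le (by norm_num)
  rw [pd_eq (pd_contDiff (k := 1) hg j), pd_eq (pd_contDiff (k := 1) hg i), pd_eq h1, pd_eq h1]
  ext x
  have hd : DifferentiableAt ℝ (fderiv ℝ g) x :=
    ((hg.fderiv_right (m := 1) (by norm_num)).differentiable (by norm_num)) x
  have e : ∀ v w, fderiv ℝ (fun y => fderiv ℝ g y v) x w = fderiv ℝ (fderiv ℝ g) x w v := by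
    intro v w
    rw [fderiv_clm_apply hd (differentiableAt_const v)]
    simp
  rw [e, e]
  exact (hg.contDiffAt.isSymmSndFDerivAt (by simp)) _ _
lemma LD_perm {g : Rn n → F} {m : ℕ} (hg : ContDiff ℝ m g) {l l' : List (Fin n)} (h : l.Perm l') :
    l.length ≤ m → LD l g = LD l' g := by
  induction h with
  | nil => intro _; rfl
  | cons i h ih => intro hl; rw [LD_cons, LD_cons, ih (by simp at hl; omega)]
  | swap i j l =>
    intro hl
    rw [LD_cons, LD_cons, LD_cons, LD_cons]
    exact pd_comm (LD_contDiff hg l 2 (by simp at hl; omega)) _ _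
  | trans h1 _ ih1 ih2 => intro hl; rw [ih1 hl, ih2 (by rw [← h1.length_eq]; exact hl)]
def ml (α : Fin n → ℕ) : List (Fin n) := (List.finRange n).flatMap fun i => List.replicate (α i) i
lemma mderiv_eq (α : Fin n → ℕ) (g : Rn n → F) : mderiv α g = LD (ml α) g := by
  unfold mderiv LD ml
  induction List.finRange n with
  | nil => rfl
  | cons i l ih =>
    rw [List.foldr_cons, ih, List.flatMap_cons, List.foldr_append]
    generalize List.foldr pd g _ = h
    induction α i with
    | zero => rfl
    | succ k ihk => rw [Function.iterate_succ', Function.comp_apply, ihk, List.replicate_succ, List.foldr_cons]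
lemma ml_length (α : Fin n → ℕ) : (ml α).length = mdeg α := by
  simp [ml, mdeg, List.length_flatMap, Fin.sum_univ_def]
lemma ml_count (α : Fin n → ℕ) (i : Fin n) : (ml α).count i = α i := by
  simp only [ml, List.count_flatMap, Function.comp_def, List.count_replicate]
  rw [← Fin.sum_univ_def]
  simp
lemma LD_eq_mderiv {g : Rn n → F} {m : ℕ} (hg : ContDiff ℝ m g) (l : List (Fin n)) (hl : l.length ≤ m) :
    LD l g = mderiv (fun i => l.count i) g := by
  rw [mderiv_eq]
  exact LD_perm hg (List.perm_iff_count.2 fun i => by rw [ml_count]) hl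
lemma mdeg_count (l : List (Fin n)) : mdeg (fun i => l.count i) = l.length := by
  rw [← ml_length]
  exact (List.perm_iff_count.2 fun i => by rw [ml_count]).length_eq
lemma norm_LD_le {g : Rn n → F} {m : ℕ} (hg : ContDiff ℝ m g) (l : List (Fin n)) (hl : l.length ≤ m) (x : Rn n) :
    ‖LD l g x‖ ≤ ‖iteratedFDeriv ℝ l.length g x‖ := by
  rw [LD_eq hg l hl]
  refine (ContinuousMultilinearMap.le_opNorm _ _).trans ?_
  simp
lemma norm_mderiv_le {g : Rn n → F} {m : ℕ} (hg : ContDiff ℝ m g) (α : Fin n → ℕ) (hl : mdeg α ≤ m) (x : Rn n) :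
    ‖mderiv α g x‖ ≤ ‖iteratedFDeriv ℝ (mdeg α) g x‖ := by
  rw [mderiv_eq, ← ml_length]
  exact norm_LD_le hg _ (by rwa [ml_length]) x
lemma norm_iteratedFDeriv_le {g : Rn n → F} {k : ℕ} (hg : ContDiff ℝ k g) (x : Rn n) (B : ℝ)
    (hB : ∀ α : Fin n → ℕ, mdeg α = k → ‖mderiv α g x‖ ≤ B) (hB0 : 0 ≤ B) :
    ‖iteratedFDeriv ℝ k g x‖ ≤ (n:ℝ)^k * B := by
  refine ContinuousMultilinearMap.opNorm_le_bound (by positivity) fun v => ?_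
  have hv : v = fun i => ∑ j, (v i j) • bv j := by
    ext i
    simp [Finset.sum_apply, Pi.single_apply]
  have hb : ∀ w : Fin k → Fin n, ‖iteratedFDeriv ℝ k g x (fun i => bv (w i))‖ ≤ B := by
    intro w
    have hlen : (List.ofFn w).length = k := List.length_ofFn
    have h1 := LD_eq hg (List.ofFn w) hlen.le x
    have h2 := LD_eq_mderiv hg (List.ofFn w) hlen.le
    have h3 := hB (fun i => (List.ofFn w).count i) (by rw [mdeg_count, hlen])
    rw [← h2, h1] at h3
    convert h3 using 2
    have : ∀ k' (h : k' = k) (u : Fin k' → Fin n), (∀ i, u i = w (Fin.cast h i)) →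
      iteratedFDeriv ℝ k g x (fun i => bv (w i)) = iteratedFDeriv ℝ k' g x (fun i => bv (u i)) := by
      intro k' h u hu
      subst h
      congr with i
      rw [hu]; rfl
    exact this _ hlen _ (fun i => by simp; rfl)
  nth_rw 1 [hv]
  rw [ContinuousMultilinearMap.map_sum]
  refine (norm_sum_le _ _).trans ?_
  calc ∑ w : Fin k → Fin n, ‖iteratedFDeriv ℝ k g x (fun i => v i (w i) • bv (w i))‖
      ≤ ∑ w : Fin k → Fin n, B * ∏ i, ‖v i‖ := by
        refine Finset.sum_le_sum fun w _ => ?_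
        rw [ContinuousMultilinearMap.map_smul_univ, norm_smul, mul_comm]
        refine mul_le_mul (hb w) ?_ (norm_nonneg _) hB0
        rw [norm_prod]
        exact Finset.prod_le_prod (fun _ _ => norm_nonneg _) fun i _ => PiLp.norm_apply_le (v i) (w i)
    _ = _ := by simp; ring
lemma pd_support {g : Rn n → F} {S : Set (Rn n)} (hS : IsClosed S) (hg : Function.support g ⊆ S) (i : Fin n) :
    Function.support (pd i g) ⊆ S := by
  intro x hx
  by_contra hxS
  apply hx
  have : g =ᶠ[𝓝 x] fun _ => 0 := by
    filter_upwards [hS.isOpen_compl.mem_nhds hxS] with y hy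
    by_contra h0
    exact hy (hg h0)
  rw [pd, this.lineDeriv_eq]; simp [lineDeriv]
lemma LD_support {g : Rn n → F} {S : Set (Rn n)} (hS : IsClosed S) (hg : Function.support g ⊆ S)
    (l : List (Fin n)) : Function.support (LD l g) ⊆ S := by
  induction l with
  | nil => exact hg
  | cons i l ih => exact pd_support hS ih i
def BF {ι : Type*} (G : ι → Sch n) : Prop :=
  ∀ k l : ℕ, ∃ C : ℝ, ∀ i, SchwartzMap.seminorm ℝ k l (G i) ≤ C
lemma BF.map {ι : Type*} {G : ι → Sch n} (hG : BF G) (T : Sch n →L[ℝ] Sch n) : BF fun i => T (G i) := by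
  intro k l
  obtain ⟨s, C, -, h⟩ := Seminorm.bound_of_continuous (schwartz_withSeminorms ℝ (Rn n) ℂ)
    ((SchwartzMap.seminorm ℝ k l : Seminorm ℝ (Sch n)).comp (T : Sch n →ₗ[ℝ] Sch n))
    (((schwartz_withSeminorms ℝ (Rn n) ℂ).continuous_seminorm (k,l)).comp T.continuous)
  choose D hD using hG
  refine ⟨C * ∑ m ∈ s, max (D m.1 m.2) 0, fun i => ?_⟩
  refine (h (G i)).trans ?_
  rw [Seminorm.smul_apply, NNReal.smul_def, smul_eq_mul]
  gcongr
  refine (Seminorm.finset_sup_apply_le (Finset.sum_nonneg fun _ _ => le_max_right _ _) fun m hm => ?_)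
  refine le_trans ?_ (Finset.single_le_sum (f := fun m : ℕ × ℕ => max (D m.1 m.2) 0) (fun _ _ => le_max_right _ _) hm)
  exact (hD m.1 m.2 i).trans (le_max_left _ _)
lemma BF.decay {ι : Type*} {G : ι → Sch n} (hG : BF G) (N l : ℕ) : ∃ C : ℝ, 0 < C ∧ ∀ i z,
    ‖iteratedFDeriv ℝ l (G i) z‖ ≤ C / (1 + ‖z‖)^N := by
  choose D hD using hG
  refine ⟨2^N * (∑ m ∈ Finset.Iic (N,l), max (D m.1 m.2) 0) + 1, ?_, fun i z => ?_⟩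
  · have : 0 ≤ ∑ m ∈ Finset.Iic (N,l), max (D m.1 m.2) 0 := Finset.sum_nonneg fun _ _ => le_max_right _ _
    positivity
  rw [le_div_iff₀ (by positivity), mul_comm]
  refine (SchwartzMap.one_add_le_sup_seminorm_apply (𝕜 := ℝ) (m := (N,l)) le_rfl le_rfl (G i) z).trans ?_
  refine le_trans ?_ (le_add_of_nonneg_right zero_le_one)
  gcongr
  refine (Seminorm.finset_sup_apply_le (Finset.sum_nonneg fun _ _ => le_max_right _ _) fun m hm => ?_)
  refine le_trans ?_ (Finset.single_le_sum (f := fun m : ℕ × ℕ => max (D m.1 m.2) 0) (fun _ _ => le_max_right _ _) hm)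
  exact (hD m.1 m.2 i).trans (le_max_left _ _)
lemma BF.decay0 {ι : Type*} {G : ι → Sch n} (hG : BF G) (N : ℕ) : ∃ C : ℝ, 0 < C ∧ ∀ i z,
    ‖G i z‖ ≤ C / (1 + ‖z‖)^N := by
  obtain ⟨C, hC, h⟩ := hG.decay N 0
  exact ⟨C, hC, fun i z => by simpa using h i z⟩
def iF : Sch n →L[ℝ] Sch n := (FourierTransform.fourierInvCLM ℂ (Sch n)).restrictScalars ℝ
lemma iF_eq (g : Sch n) : iF g = 𝓕⁻ g := rfl
lemma dilate_apply (ψ : Sch n) (t : ℝ) (ht : t ≠ 0) (x : Rn n) : dilate ψ t x = ψ (t • x) := by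
  rw [dilate, dif_neg ht]; rfl
lemma shiftReflect_apply (ψ : Sch n) (x y : Rn n) : shiftReflect ψ x y = ψ (x - y) := rfl
def Th (φ : ℕ → Sch n) (j : ℕ) : Sch n := dilate (φ j) (2^j)
lemma Th_apply (φ : ℕ → Sch n) (j : ℕ) (x : Rn n) : Th φ j x = φ j ((2:ℝ)^j • x) :=
  dilate_apply _ _ (by positivity) _
lemma Th_coe (φ : ℕ → Sch n) (j : ℕ) : (Th φ j : Rn n → ℂ) = fun x => φ j ((2:ℝ)^j • x) :=
  funext fun x => Th_apply φ j x
lemma Th_supp {φ : ℕ → Sch n} (hφ : SmoothResolution n φ) (j : ℕ) (x : Rn n) (hx : Th φ j x ≠ 0) :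
    ‖x‖ ≤ 2 ∧ (0 < j → 1/2 ≤ ‖x‖) := by
  rw [Th_apply] at hx
  have hn : ‖(2:ℝ)^j • x‖ = 2^j * ‖x‖ := by rw [norm_smul]; simp
  rcases Nat.eq_zero_or_pos j with rfl | hj
  · have := hφ.supp0 hx
    rw [mem_ofPred_eq, hn] at this
    exact ⟨by simpa using this, fun h => absurd h (lt_irrefl _)⟩
  · have := hφ.suppj j hj hx
    rw [mem_ofPred_eq, hn, rpow_sub (by norm_num), rpow_add (by norm_num), rpow_natCast, rpow_one] at this
    have h2 : (0:ℝ) < 2^j := by positivity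
    constructor
    · exact le_of_mul_le_mul_left this.2 h2
    · intro _
      refine le_of_mul_le_mul_left (le_trans (le_of_eq ?_) this.1) h2
      ring
lemma Th_BF {φ : ℕ → Sch n} (hφ : SmoothResolution n φ) : BF (Th φ) := by
  intro k l
  choose c hc using hφ.deriv_bound
  set B : ℝ := ∑ α : Fin n → Fin (l+1), |c (fun i => α i)|
  have hB0 : 0 ≤ B := Finset.sum_nonneg fun _ _ => abs_nonneg _
  refine ⟨2^k * ((n:ℝ)^l * B), fun j => ?_⟩
  refine SchwartzMap.seminorm_le_bound ℝ k l _ (by positivity) fun x => ?_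
  by_cases hx : ‖x‖ ≤ 2
  · gcongr
    rw [Th_coe, iteratedFDeriv_comp_const_smul _ ((φ j).smooth l), norm_smul, norm_pow, norm_pow]
    have h1 := norm_iteratedFDeriv_le ((φ j).smooth l) ((2:ℝ)^j • x) (B * ((2:ℝ)^j)⁻¹^l) (fun α hα => by
      refine (hc α j _).trans ?_
      rw [hα]
      have e : (2:ℝ)^(-(j:ℝ) * (l:ℝ)) = ((2:ℝ)^j)⁻¹^l := by
        rw [rpow_mul (by norm_num), rpow_neg (by norm_num), rpow_natCast, rpow_natCast]
      rw [e]
      gcongr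
      have hle : ∀ i, α i < l + 1 := fun i => by
        have : α i ≤ mdeg α := Finset.single_le_sum (f := α) (fun _ _ => Nat.zero_le _) (Finset.mem_univ i)
        omega
      refine le_trans (le_abs_self _) ?_
      exact Finset.single_le_sum (f := fun β : Fin n → Fin (l+1) => |c (fun i => β i)|)
        (fun _ _ => abs_nonneg _) (Finset.mem_univ (fun i => (⟨α i, hle i⟩ : Fin (l+1))))) (by positivity)
    calc _ ≤ (‖(2:ℝ)‖^j)^l * ((n:ℝ)^l * (B * ((2:ℝ)^j)⁻¹^l)) := by gcongr
      _ = _ := by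
        rw [Real.norm_ofNat, inv_pow]
        field_simp
  · have : iteratedFDeriv ℝ l (Th φ j) x = 0 := by
      by_contra h
      have h1 := support_iteratedFDeriv_subset (𝕜 := ℝ) l h
      have h2 : tsupport (Th φ j) ⊆ closedBall 0 2 := closure_minimal (fun y hy => by
        simpa using (Th_supp hφ j y hy).1) isClosed_closedBall
      exact hx (by simpa using h2 h1)
    rw [this, norm_zero, mul_zero]; positivity
lemma iF_scale (φ : Sch n) (j : ℕ) (x : Rn n) :
    (𝓕⁻ φ) x = ((2:ℝ)^j)^n • (𝓕⁻ (dilate φ (2^j))) ((2:ℝ)^j • x) := by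
  rw [SchwartzMap.fourierInv_coe, SchwartzMap.fourierInv_coe, Real.fourierInv_eq, Real.fourierInv_eq]
  have := Measure.integral_comp_smul (volume : Measure (Rn n))
    (fun v => (Real.fourierChar (inner ℝ v x) : Circle) • φ v) ((2:ℝ)^j)
  have e : ∀ v : Rn n, inner ℝ v ((2:ℝ)^j • x) = inner ℝ ((2:ℝ)^j • v) x := by
    intro v; rw [inner_smul_left, inner_smul_right]; simp
  simp_rw [dilate_apply _ _ (show (2:ℝ)^j ≠ 0 by positivity), e]
  rw [this, smul_smul, finrank_euclideanSpace, Fintype.card_fin, abs_inv, abs_of_nonneg (by positivity),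
    mul_inv_cancel₀ (by positivity), one_smul]
lemma exists_eta (n : ℕ) : ∃ η : Sch n, ∀ x : Rn n, 1/2 ≤ ‖x‖ → ‖x‖ ≤ 2 → η x * (‖x‖^2 : ℝ) = 1 := by
  let b1 : ContDiffBump (0 : Rn n) := ⟨2, 3, by norm_num, by norm_num⟩
  let b2 : ContDiffBump (0 : Rn n) := ⟨1/4, 1/2, by norm_num, by norm_num⟩
  let g : Rn n → ℂ := fun x => ((b1 x * (1 - b2 x) / ‖x‖^2 : ℝ) : ℂ)
  have hc : HasCompactSupport g := by
    refine b1.hasCompactSupport.mono fun x hx => ?_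
    rw [Function.mem_support] at hx ⊢
    intro h; apply hx; simp [g, h]
  have hs : ContDiff ℝ ((⊤:ℕ∞) : WithTop ℕ∞) g := by
    rw [contDiff_iff_contDiffAt]
    intro x
    by_cases hx : x = 0
    · have : g =ᶠ[𝓝 x] fun _ => 0 := by
        have := b2.eventuallyEq_one
        rw [hx]
        filter_upwards [this] with y hy
        simp only [Pi.one_apply] at hy
        simp [g, hy]
      exact contDiffAt_const.congr_of_eventuallyEq this
    · apply Complex.ofRealCLM.contDiff.contDiffAt.comp
      refine ContDiffAt.div ?_ (contDiff_norm_sq ℝ).contDiffAt ?_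
      · exact b1.contDiff.contDiffAt.mul (contDiffAt_const.sub b2.contDiff.contDiffAt)
      · simpa using hx
  refine ⟨hc.toSchwartzMap hs, fun x h1 h2 => ?_⟩
  have e1 : b1 x = 1 := b1.one_of_mem_closedBall (by simpa using h2)
  have e2 : b2 x = 0 := b2.zero_of_le_dist (by rw [dist_zero_right]; exact h1)
  change g x * _ = 1
  simp only [g, e1, e2]
  have : (‖x‖:ℂ) ≠ 0 := by
    have : 0 < ‖x‖ := by linarith
    exact_mod_cast this.ne'
  push_cast
  field_simp
  simp
lemma tg_inner (m : Rn n) : Function.HasTemperateGrowth (fun x : Rn n => inner ℝ x m) := by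
  fun_prop
def AF (Θ : ℕ → Sch n) : Prop := BF Θ ∧ ∀ j x, Θ j x ≠ 0 → 1/2 ≤ ‖x‖ ∧ ‖x‖ ≤ 2
lemma AF.div {Θ : ℕ → Sch n} (h : AF Θ) : ∃ H : Fin n → ℕ → Sch n, (∀ i, AF (H i)) ∧
    ∀ j, 𝓕⁻ (Θ j) = ∑ i, LineDeriv.lineDerivOp (bv i) (𝓕⁻ (H i j)) := by
  obtain ⟨η, hη⟩ := exists_eta n
  have hc : (2 * π * Complex.I : ℂ) ≠ 0 := by simp [Real.pi_ne_zero]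
  let M : Fin n → Sch n →L[ℝ] Sch n := fun i =>
    ((SchwartzMap.smulLeftCLM ℂ fun x : Rn n => (2 * π * Complex.I : ℂ)⁻¹ * η x).restrictScalars ℝ) ∘L
      (SchwartzMap.smulLeftCLM ℂ fun x : Rn n => inner ℝ x (bv i))
  have htg : Function.HasTemperateGrowth fun x : Rn n => (2 * π * Complex.I : ℂ)⁻¹ * η x := by
    have := η.hasTemperateGrowth
    fun_prop
  have hM : ∀ i (g : Sch n) x, M i g x = ((2 * π * Complex.I : ℂ)⁻¹ * η x) * ((inner ℝ x (bv i) : ℝ) * g x) := by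
    intro i g x
    simp only [M, ContinuousLinearMap.comp_apply, ContinuousLinearMap.coe_restrictScalars']
    rw [SchwartzMap.smulLeftCLM_apply_apply htg, SchwartzMap.smulLeftCLM_apply_apply (tg_inner _)]
    simp
  refine ⟨fun i j => M i (Θ j), fun i => ⟨h.1.map _, fun j x hx => ?_⟩, fun j => ?_⟩
  · apply h.2 j x
    intro h0; apply hx; rw [hM, h0]; simp
  · have : Θ j = ∑ i, (2 * π * Complex.I : ℂ) • SchwartzMap.smulLeftCLM ℂ (fun x : Rn n => inner ℝ x (bv i)) (M i (Θ j)) := by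
      ext x
      rw [sum_apply]
      simp only [smul_apply]
      simp_rw [SchwartzMap.smulLeftCLM_apply_apply (tg_inner _), hM]
      by_cases hx : Θ j x = 0
      · simp [hx]
      · obtain ⟨h1, h2⟩ := h.2 j x hx
        have h3 := hη x h1 h2
        have h4 : (‖x‖^2 : ℝ) = ∑ i, (inner ℝ x (bv i) : ℝ) * inner ℝ x (bv i) := by
          rw [EuclideanSpace.real_norm_sq_eq]
          refine Finset.sum_congr rfl fun i _ => ?_
          simp [EuclideanSpace.inner_single_right, sq]
        rw [h4] at h3
        calc Θ j x = η x * ((∑ i, (inner ℝ x (bv i) : ℝ) * inner ℝ x (bv i) : ℝ) : ℂ) * Θ j x := by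
              rw [h3, one_mul]
          _ = _ := by
              push_cast
              rw [Finset.mul_sum, Finset.sum_mul]
              refine Finset.sum_congr rfl fun i _ => ?_
              simp only [Complex.real_smul, smul_eq_mul]
              field_simp
    nth_rw 1 [this]
    have e := map_sum (FourierTransform.fourierInvCLM ℂ (Sch n)) (fun i => (2 * π * Complex.I : ℂ) •
      SchwartzMap.smulLeftCLM ℂ (fun x : Rn n => inner ℝ x (bv i)) (M i (Θ j))) Finset.univ
    refine e.trans (Finset.sum_congr rfl fun i _ => ?_)
    rw [SchwartzMap.lineDerivOp_fourierInv_eq]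
    rfl
lemma fderiv_scale (H : Sch n) (t : ℝ) (x y : Rn n) :
    HasFDerivAt (fun y => H (t • (x - y))) (-t • fderiv ℝ H (t • (x - y))) y := by
  have h1 : HasFDerivAt (fun y : Rn n => t • (x - y)) (t • -ContinuousLinearMap.id ℝ (Rn n)) y :=
    ((hasFDerivAt_id (𝕜 := ℝ) y).const_sub x).const_smul t
  have h2 : HasFDerivAt (fun y => H (t • (x - y))) _ y :=
    (H.differentiableAt (x := t • (x - y))).hasFDerivAt.comp y h1
  refine h2.congr_fderiv ?_
  ext v
  simp
lemma ibp (H : Sch n) (t : ℝ) (ht : 0 < t) (x : Rn n) (b : Rn n → E) (hb : ContDiff ℝ 1 b)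
    (hbc : HasCompactSupport b) (i : Fin n) :
    ∫ y, (LineDeriv.lineDerivOp (bv i) H : Sch n) (t • (x - y)) • b y =
      t⁻¹ • ∫ y, H (t • (x - y)) • pd i b y := by
  have hcont : Continuous fun y => H (t • (x - y)) := H.continuous.comp (by fun_prop)
  have hcont' : Continuous fun y => (LineDeriv.lineDerivOp (bv i) H : Sch n) (t • (x - y)) :=
    (LineDeriv.lineDerivOp (bv i) H : Sch n).continuous.comp (by fun_prop)
  have hd : ∀ y, fderiv ℝ (fun y => H (t • (x - y))) y (bv i) =
      -t • (LineDeriv.lineDerivOp (bv i) H : Sch n) (t • (x - y)) := by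
    intro y
    rw [(fderiv_scale H t x y).fderiv, SchwartzMap.lineDerivOp_apply,
      H.differentiableAt.lineDeriv_eq_fderiv]
    simp
  have hpc : HasCompactSupport (pd i b) := hbc.mono' (pd_support (isClosed_tsupport b) subset_closure i)
  have hpcont : Continuous (pd i b) := (pd_contDiff (k := 0) hb i).continuous
  have hpe := pd_eq hb i
  have key := integral_smul_fderiv_eq_neg_fderiv_smul_of_integrable (𝕜 := ℂ) (μ := (volume : Measure (Rn n)))
    (f := fun y => H (t • (x - y))) (g := b) (v := bv i) ?_ ?_ ?_ ?_ ?_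
  · have e : ∀ y, (fderiv ℝ b y) (bv i) = pd i b y := fun y => by rw [hpe]
    simp_rw [e, hd] at key
    rw [key, ← integral_neg, ← integral_smul]
    congr with y
    rw [smul_assoc, neg_smul, neg_neg, smul_smul, inv_mul_cancel₀ ht.ne', one_smul]
  · simp_rw [hd]
    exact ((hcont'.const_smul (-t)).smul hb.continuous).integrable_of_hasCompactSupport hbc.smul_left
  · have e : ∀ y, (fderiv ℝ b y) (bv i) = pd i b y := fun y => by rw [hpe]
    simp_rw [e]
    exact (hcont.smul hpcont).integrable_of_hasCompactSupport hpc.smul_left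
  · exact (hcont.smul hb.continuous).integrable_of_hasCompactSupport hbc.smul_left
  · exact fun y _ => (fderiv_scale H t x y).differentiableAt
  · exact fun y _ => (hb.differentiable (by norm_num)) y
def dI (N j : ℕ) (x : Rn n) (S : Set (Rn n)) : ℝ≥0∞ :=
  ∫⁻ y in S, ENNReal.ofReal (1 / (1 + 2^j * ‖x - y‖)^N)
lemma est0 {G : ℕ → Sch n} (hG : BF G) (N : ℕ) : ∃ C : ℝ, 0 < C ∧ ∀ (j : ℕ) (x : Rn n) (b : Rn n → E)
    (S : Set (Rn n)) (B : ℝ), MeasurableSet S → Function.support b ⊆ S → (∀ y, ‖b y‖ ≤ B) →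
    ‖∫ y, G j ((2:ℝ)^j • (x - y)) • b y‖ₑ ≤ ENNReal.ofReal (C * B) * dI N j x S := by
  obtain ⟨C, hC, h⟩ := hG.decay0 N
  refine ⟨C, hC, fun j x b S B hS hbS hB => ?_⟩
  have hB0 : 0 ≤ B := (norm_nonneg _).trans (hB 0)
  refine (enorm_integral_le_lintegral_enorm _).trans ?_
  rw [dI, ← lintegral_const_mul _ (by fun_prop), ← lintegral_indicator hS]
  refine lintegral_mono fun y => ?_
  by_cases hy : y ∈ S
  · rw [indicator_of_mem hy, ← ENNReal.ofReal_mul (by positivity), ← ofReal_norm]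
    apply ENNReal.ofReal_le_ofReal
    rw [norm_smul]
    have h1 := h j ((2:ℝ)^j • (x - y))
    rw [norm_smul, norm_pow, Real.norm_ofNat] at h1
    calc _ ≤ C / (1 + 2^j * ‖x - y‖)^N * B := by gcongr; exact hB y
      _ = _ := by ring
  · have : b y = 0 := by
      by_contra h0; exact hy (hbS h0)
    rw [this]; simp
lemma estA (N k : ℕ) : ∀ {Θ : ℕ → Sch n}, AF Θ → ∃ C : ℝ, 0 < C ∧ ∀ (j : ℕ) (x : Rn n) (b : Rn n → E)
    (S : Set (Rn n)) (B : ℝ), IsCompact S → Function.support b ⊆ S → ContDiff ℝ k b →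
    (∀ l : List (Fin n), l.length = k → ∀ y, ‖LD l b y‖ ≤ B) → 0 ≤ B →
    ‖∫ y, (𝓕⁻ (Θ j)) ((2:ℝ)^j • (x - y)) • b y‖ₑ ≤
      ENNReal.ofReal (C * ((2:ℝ)^j)⁻¹^k * B) * dI N j x S := by
  induction k with
  | zero =>
    intro Θ hΘ
    obtain ⟨C, hC, h⟩ := est0 (E := E) (hΘ.1.map iF) N
    refine ⟨C, hC, fun j x b S B hS hbS hb hB hB0 => ?_⟩
    have := h j x b S B hS.measurableSet hbS (fun y => hB [] rfl y)
    simpa [iF_eq] using this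
  | succ k ih =>
    intro Θ hΘ
    obtain ⟨H, hH, hdiv⟩ := hΘ.div
    choose C hC h using fun i => ih (hH i)
    refine ⟨∑ i, C i + 1, add_pos_of_nonneg_of_pos (Finset.sum_nonneg fun i _ => (hC i).le) one_pos,
      fun j x b S B hS hbS hb hB hB0 => ?_⟩
    have hbc : HasCompactSupport b := hS.of_isClosed_subset (isClosed_tsupport b)
      (closure_minimal hbS hS.isClosed)
    have hb1 : ContDiff ℝ 1 b := hb.of_le (by norm_cast; omega)
    have e : ∫ y, (𝓕⁻ (Θ j)) ((2:ℝ)^j • (x - y)) • b y =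
        ∑ i, ((2:ℝ)^j)⁻¹ • ∫ y, (𝓕⁻ (H i j)) ((2:ℝ)^j • (x - y)) • pd i b y := by
      rw [hdiv]
      simp_rw [sum_apply, Finset.sum_smul]
      rw [integral_finsetSum]
      · exact Finset.sum_congr rfl fun i _ => ibp _ _ (by positivity) x b hb1 hbc i
      · intro i _
        refine Continuous.integrable_of_hasCompactSupport ?_ hbc.smul_left
        exact ((LineDeriv.lineDerivOp (bv i) (𝓕⁻ (H i j)) : Sch n).continuous.comp (by fun_prop)).smul hb1.continuous
    rw [e]
    refine (enorm_sum_le _ _).trans ?_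
    calc _ ≤ ∑ i, ENNReal.ofReal (C i * ((2:ℝ)^j)⁻¹^(k+1) * B) * dI N j x S := by
          refine Finset.sum_le_sum fun i _ => ?_
          rw [enorm_smul]
          have := h i j x (pd i b) S B hS (pd_support hS.isClosed hbS i) (pd_contDiff hb i) (fun l hl y => by
            have hp : LD l (pd i b) = LD (l ++ [i]) b := by simp [LD, List.foldr_append]
            rw [hp]; exact hB _ (by simp [hl]) y) hB0
          refine (mul_le_mul' le_rfl this).trans (le_of_eq ?_)
          rw [← mul_assoc]
          congr 1
          rw [Real.enorm_of_nonneg (by positivity), ← ENNReal.ofReal_mul (by positivity)]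
          congr 1; ring
      _ = ENNReal.ofReal ((∑ i, C i) * ((2:ℝ)^j)⁻¹^(k+1) * B) * dI N j x S := by
          rw [← Finset.sum_mul, ← ENNReal.ofReal_sum_of_nonneg]
          · rw [Finset.sum_mul, Finset.sum_mul]
          · intro i _; have := hC i; positivity
      _ ≤ _ := by
          gcongr
          linarith
lemma two_rpow_neg (ν : ℕ) : (2:ℝ)^(-(ν:ℝ)) = ((2:ℝ)^ν)⁻¹ := by
  rw [Real.rpow_neg (by norm_num), Real.rpow_natCast]
lemma norm_le_of_coord (z : Rn n) (c : ℝ) (h : ∀ i, |z i| ≤ c) (hc : 0 ≤ c) : ‖z‖ ≤ n * c := by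
  rw [EuclideanSpace.norm_eq]
  apply Real.sqrt_le_iff.2 ⟨by positivity, ?_⟩
  calc ∑ i, ‖z i‖^2 ≤ ∑ _i : Fin n, c^2 := by
        refine Finset.sum_le_sum fun i _ => ?_
        exact pow_le_pow_left₀ (norm_nonneg _) (h i) 2
    _ = n * c^2 := by simp
    _ ≤ (n * c)^2 := by
        have : (n:ℝ) ≤ (n:ℝ)^2 := by exact_mod_cast Nat.le_self_pow (by norm_num) n
        rw [mul_pow]; gcongr
lemma dQ_dist {d : ℝ} (hd : 1 < d) {ν : ℕ} {m : Fin n → ℤ} {y y' : Rn n} (hy : y ∈ dQ d ν m)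
    (hy' : y' ∈ dQ d ν m) : 2^ν * ‖y - y'‖ ≤ n * d := by
  have h1 : ‖y - y'‖ ≤ n * (d * ((2:ℝ)^ν)⁻¹) := by
    refine norm_le_of_coord _ _ (fun i => ?_) (by positivity)
    have h1 := hy i
    have h2 := hy' i
    rw [two_rpow_neg] at h1 h2
    simp only [PiLp.sub_apply]
    rw [abs_le] at *
    constructor <;> linarith [h1.1, h1.2, h2.1, h2.2]
  calc _ ≤ 2^ν * (n * (d * ((2:ℝ)^ν)⁻¹)) := by gcongr
    _ = n * d := by field_simp
lemma dQ_mono {d : ℝ} (hd : 1 < d) (ν : ℕ) (m : Fin n → ℤ) : dQ 1 ν m ⊆ dQ d ν m := by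
  intro y hy i
  refine (hy i).trans ?_
  gcongr
lemma dQ_closed (d : ℝ) (ν : ℕ) (m : Fin n → ℤ) : IsClosed (dQ d ν m) := by
  simp only [dQ, Set.ofPred_forall]
  exact isClosed_iInter fun i => isClosed_le (by fun_prop) (by fun_prop)
lemma dQ_compact {d : ℝ} (hd : 1 < d) (ν : ℕ) (m : Fin n → ℤ) : IsCompact (dQ d ν m) := by
  rcases (dQ d ν m).eq_empty_or_nonempty with h | ⟨y', hy'⟩
  · rw [h]; exact isCompact_empty
  refine (isCompact_closedBall y' (n * d * ((2:ℝ)^ν)⁻¹)).of_isClosed_subset (dQ_closed _ _ _) fun y hy => ?_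
  rw [mem_closedBall, dist_eq_norm]
  have := dQ_dist hd hy hy'
  rw [← div_eq_mul_inv, le_div_iff₀ (by positivity)]
  linarith
lemma dQ_vol {d : ℝ} (hd : 1 < d) (ν : ℕ) (m : Fin n → ℤ) :
    volume (dQ d ν m) ≤ ENNReal.ofReal ((((2:ℝ)^ν)⁻¹)^n) * volume (closedBall (0:Rn n) (n*d)) := by
  rcases (dQ d ν m).eq_empty_or_nonempty with h | ⟨y', hy'⟩
  · rw [h]; simp
  rw [← vol_scale _ _ (by positivity) (by positivity), ← vol_cb y']
  refine measure_mono fun y hy => ?_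
  rw [mem_closedBall, dist_eq_norm]
  have := dQ_dist hd hy hy'
  rw [← div_eq_inv_mul, le_div_iff₀ (by positivity)]
  linarith
def mI (ν : ℕ) (y : Rn n) : Fin n → ℤ := fun i => ⌊2^ν * y i + 1/2⌋
lemma mI_meas (ν : ℕ) : Measurable (mI (n := n) ν) := by
  unfold mI
  refine measurable_pi_lambda _ fun i => ?_
  exact Int.measurable_floor.comp (by fun_prop)
lemma mI_mem (ν : ℕ) (y : Rn n) : y ∈ dQ 1 ν (mI ν y) := by
  intro i
  rw [two_rpow_neg, one_mul]
  have h1 := Int.floor_le (2^ν * y i + 1/2)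
  have h2 := Int.lt_floor_add_one (2^ν * y i + 1/2)
  have h3 : (0:ℝ) < 2^ν := by positivity
  have e : y i - ((2:ℝ)^ν)⁻¹ * (mI ν y i : ℝ) = ((2:ℝ)^ν)⁻¹ * (2^ν * y i - (mI ν y i : ℝ)) := by
    field_simp
  rw [e, abs_mul, abs_of_pos (inv_pos.2 h3), div_eq_mul_inv]
  gcongr
  rw [mI, abs_le]
  constructor <;> linarith
lemma mI_vol (ν : ℕ) (m : Fin n → ℤ) : volume {y : Rn n | mI ν y = m} = ENNReal.ofReal ((((2:ℝ)^ν)⁻¹)^n) := by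
  have h3 : (0:ℝ) < 2^ν := by positivity
  have e : {y : Rn n | mI ν y = m} = WithLp.ofLp ⁻¹' (Set.pi univ fun i =>
      Ico (((2:ℝ)^ν)⁻¹ * (m i - 1/2)) (((2:ℝ)^ν)⁻¹ * (m i + 1/2))) := by
    ext y
    simp only [mem_preimage, Set.mem_pi, mem_univ, forall_const, mem_Ico, funext_iff, mI, Set.mem_ofPred_eq]
    refine forall_congr' fun i => ?_
    rw [Int.floor_eq_iff, inv_mul_le_iff₀ h3, lt_inv_mul_iff₀ h3]
    constructor <;> rintro ⟨h1, h2⟩ <;> constructor <;> linarith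
  rw [e, (PiLp.volume_preserving_ofLp (Fin n)).measure_preimage
    (MeasurableSet.univ_pi fun i => measurableSet_Ico).nullMeasurableSet, Real.volume_pi_Ico,
    ← ENNReal.ofReal_prod_of_nonneg]
  · congr 1
    calc _ = ∏ _i : Fin n, ((2:ℝ)^ν)⁻¹ := Finset.prod_congr rfl fun i _ => by ring
      _ = _ := by simp
  · intro i _
    rw [← mul_sub]; exact mul_nonneg (by positivity) (by norm_num)
lemma lint_fib (ν : ℕ) (h : Rn n → ℝ≥0∞) : ∫⁻ y, h y = ∑' m, ∫⁻ y in {y : Rn n | mI ν y = m}, h y := by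
  rw [← lintegral_iUnion]
  · rw [show (⋃ m, {y : Rn n | mI ν y = m}) = univ from ?_, setLIntegral_univ]
    ext y; simp
  · exact fun m => mI_meas ν (measurableSet_singleton m)
  · intro m m' hm
    refine Set.disjoint_left.2 fun y hy hy' => hm ?_
    exact hy.symm.trans hy'
lemma tsum_rpow_le {ι : Type*} (a : ι → ℝ≥0∞) (r : ℝ) (hr : 0 < r) (hr1 : r ≤ 1) :
    (∑' i, a i)^r ≤ ∑' i, (a i)^r := by
  have h1 : ∀ s : Finset ι, (∑ i ∈ s, a i)^r ≤ ∑ i ∈ s, (a i)^r := by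
    classical
    intro s
    induction s using Finset.induction_on with
    | empty => simp [hr]
    | insert b s hb ih =>
      rw [Finset.sum_insert hb, Finset.sum_insert hb]
      exact (ENNReal.rpow_add_le_add_rpow _ _ hr.le hr1).trans (by gcongr)
  rw [ENNReal.tsum_eq_iSup_sum, ← ENNReal.orderIsoRpow_apply r hr, OrderIso.map_iSup]
  exact iSup_le fun s => (h1 s).trans (ENNReal.sum_le_tsum s)
lemma dI_le {d : ℝ} (hd : 1 < d) (M : ℕ) : ∃ C : ℝ, 0 < C ∧ ∀ (j ν : ℕ) (m : Fin n → ℤ) (x y' : Rn n),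
    y' ∈ dQ d ν m → dI (M + (n+1)) j x (dQ d ν m) ≤
      ENNReal.ofReal (C / (2^(max j ν))^n * (1 / (1 + 2^(min j ν) * ‖x - y'‖)^M)) := by
  obtain ⟨C1, hC1, h1⟩ := Tk_one (n := n)
  set V := volume (closedBall (0:Rn n) (n*d))
  have hV : V ≠ ∞ := measure_closedBall_lt_top.ne
  have hnd : (0:ℝ) ≤ n * d := by positivity
  refine ⟨(1 + n*d)^M * (C1.toReal + V.toReal + 1), by positivity, fun j ν m x y' hy' => ?_⟩
  set i := min j ν
  have hS : MeasurableSet (dQ d ν m) := (dQ_closed _ _ _).measurableSet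
  have hpt : ∀ y ∈ dQ d ν m, 1 / (1 + 2^j * ‖x - y‖)^(M + (n+1)) ≤
      ((1 + n*d)^M * (1 / (1 + 2^i * ‖x - y'‖)^M)) * (1 / (1 + 2^j * ‖x - y‖)^(n+1)) := by
    intro y hy
    have h2 := dQ_dist hd hy hy'
    have hi1 : (2:ℝ)^i ≤ 2^j := pow_le_pow_right₀ one_le_two (min_le_left _ _)
    have hi2 : (2:ℝ)^i ≤ 2^ν := pow_le_pow_right₀ one_le_two (min_le_right _ _)
    have h3 : 1 + 2^i * ‖x - y'‖ ≤ (1 + n*d) * (1 + 2^j * ‖x - y‖) := by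
      have t : ‖x - y'‖ ≤ ‖x - y‖ + ‖y - y'‖ := by
        have := norm_add_le (x - y) (y - y'); rwa [sub_add_sub_cancel] at this
      have t2 : 2^i * ‖x - y'‖ ≤ 2^j * ‖x - y‖ + n * d := by
        calc _ ≤ 2^i * (‖x - y‖ + ‖y - y'‖) := by gcongr
          _ = 2^i * ‖x - y‖ + 2^i * ‖y - y'‖ := by ring
          _ ≤ 2^j * ‖x - y‖ + 2^ν * ‖y - y'‖ := by gcongr
          _ ≤ _ := by gcongr
      have : 0 ≤ n * d * (2^j * ‖x - y‖) := by positivity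
      nlinarith
    have h4 := pow_le_pow_left₀ (by positivity) h3 M
    rw [pow_add, mul_one_div ((1 + n*d)^M : ℝ), div_mul_div_comm, mul_one]
    rw [div_le_div_iff₀ (by positivity) (by positivity), one_mul, ← mul_assoc]
    rw [mul_pow] at h4
    gcongr
  have hb : ∫⁻ y in dQ d ν m, ENNReal.ofReal (1 / (1 + 2^j * ‖x - y‖)^(n+1)) ≤
      ENNReal.ofReal ((C1.toReal + V.toReal + 1) / (2^(max j ν))^n) := by
    rcases le_total j ν with hj | hj
    · rw [max_eq_right hj]
      calc _ ≤ ∫⁻ y in dQ d ν m, 1 := by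
            refine lintegral_mono fun y => ?_
            rw [← ENNReal.ofReal_one]
            apply ENNReal.ofReal_le_ofReal
            rw [div_le_one (by positivity)]
            exact one_le_pow₀ (by simp)
        _ = volume (dQ d ν m) := by simp
        _ ≤ _ := dQ_vol hd ν m
        _ = ENNReal.ofReal (V.toReal / (2^ν)^n) := by
            change _ * V = _
            conv_lhs => rw [← ENNReal.ofReal_toReal hV]
            rw [← ENNReal.ofReal_mul (by positivity)]
            congr 1; rw [inv_pow]; ring
        _ ≤ _ := by
            apply ENNReal.ofReal_le_ofReal
            gcongr
            linarith [ENNReal.toReal_nonneg (a := C1)]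
    · rw [max_eq_left hj]
      calc _ ≤ ∫⁻ y, ENNReal.ofReal (1 / (1 + 2^j * ‖x - y‖)^(n+1)) := setLIntegral_le_lintegral _ _
        _ = ∫⁻ y, ENNReal.ofReal (((2^j)^n)⁻¹) * ker j (x - y) := by
            congr with y
            rw [ker, ← ENNReal.ofReal_mul (by positivity)]
            congr 1; field_simp
        _ ≤ ENNReal.ofReal (((2^j)^n)⁻¹) * C1 := by
            rw [lintegral_const_mul' _ _ ENNReal.ofReal_ne_top]
            gcongr; exact h1 _ _
        _ = ENNReal.ofReal (C1.toReal / (2^j)^n) := by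
            conv_lhs => rw [← ENNReal.ofReal_toReal hC1]
            rw [← ENNReal.ofReal_mul (by positivity)]
            congr 1; ring
        _ ≤ _ := by
            apply ENNReal.ofReal_le_ofReal
            gcongr
            linarith [ENNReal.toReal_nonneg (a := V)]
  calc dI (M + (n+1)) j x (dQ d ν m) ≤ ∫⁻ y in dQ d ν m,
        ENNReal.ofReal ((1 + n*d)^M * (1 / (1 + 2^i * ‖x - y'‖)^M)) *
          ENNReal.ofReal (1 / (1 + 2^j * ‖x - y‖)^(n+1)) := by
        refine setLIntegral_mono' hS fun y hy => ?_
        rw [← ENNReal.ofReal_mul (by positivity)]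
        exact ENNReal.ofReal_le_ofReal (hpt y hy)
    _ ≤ _ := by
        rw [lintegral_const_mul' _ _ ENNReal.ofReal_ne_top]
        refine (mul_le_mul' le_rfl hb).trans ?_
        rw [← ENNReal.ofReal_mul (by positivity)]
        apply ENNReal.ofReal_le_ofReal
        apply le_of_eq; ring
def AtB (K : ℕ) (d : ℝ) (ν : ℕ) (m : Fin n → ℤ) (A : ℝ) (a : Rn n → E) : Prop :=
  ContDiff ℝ K a ∧ Function.support a ⊆ dQ d ν m ∧
    ∀ l : List (Fin n), l.length ≤ K → ∀ x, ‖LD l a x‖ ≤ A * (2^ν)^l.length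
lemma AtB_of {K : ℕ} {d s : ℝ} {p : ℝ≥0∞} {a : ℕ → (Fin n → ℤ) → Rn n → E}
    (h0 : ∀ m, Is1Atom K d m (a 0 m)) (h1 : ∀ ν m, 0 < ν → IsSPAtom s p K (-1) d ν m (a ν m))
    (ν : ℕ) (m : Fin n → ℤ) : AtB K d ν m ((2:ℝ)^(-(ν:ℝ) * (s - n/p.toReal))) (a ν m) := by
  rcases Nat.eq_zero_or_pos ν with rfl | hν
  · refine ⟨(h0 m).1, (h0 m).2.1, fun l hl x => ?_⟩
    rw [LD_eq_mderiv (h0 m).1 l hl]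
    simpa using (h0 m).2.2 _ (by rwa [mdeg_count]) x
  · have h := h1 ν m hν
    refine ⟨h.1, h.2.1, fun l hl x => ?_⟩
    rw [LD_eq_mderiv h.1 l hl]
    refine (h.2.2.1 _ (by rwa [mdeg_count]) x).trans (le_of_eq ?_)
    rw [mdeg_count, Real.rpow_add (by norm_num), mul_comm (l.length:ℝ), Real.rpow_mul two_pos.le (ν:ℝ),
      Real.rpow_natCast, Real.rpow_natCast]
def gam (n K j ν : ℕ) : ℝ := if ν < j then ((2:ℝ)^ν/2^j)^K else ((2:ℝ)^j/2^ν)^n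
lemma atom_est {φ : ℕ → Sch n} (hφ : SmoothResolution n φ) {d : ℝ} (hd : 1 < d) (K M : ℕ) :
    ∃ C : ℝ, 0 < C ∧ ∀ (j ν : ℕ) (m : Fin n → ℤ) (a : Rn n → E) (A : ℝ) (x y' : Rn n), 0 ≤ A →
      AtB K d ν m A a → y' ∈ dQ 1 ν m →
      ‖∫ y, (𝓕⁻ (φ j)) (x - y) • a y‖ₑ ≤
        ENNReal.ofReal (C * A * gam n K j ν * (1 / (1 + 2^(min j ν) * ‖x - y'‖)^M)) := by
  have hAF : AF (fun j => if j = 0 then 0 else Th φ j) := by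
    refine ⟨fun k l => ?_, fun j x hx => ?_⟩
    · obtain ⟨C, hC⟩ := Th_BF hφ k l
      refine ⟨C, fun j => ?_⟩
      dsimp only
      split_ifs
      · rw [map_zero]; exact (apply_nonneg _ _).trans (hC 0)
      · exact hC j
    · dsimp only at hx
      split_ifs at hx with h
      · simp at hx
      · have := Th_supp hφ j x hx
        exact ⟨this.2 (by omega), this.1⟩
  obtain ⟨C0, hC0, h0⟩ := est0 (E := E) ((Th_BF hφ).map iF) (M + (n+1))
  obtain ⟨C1, hC1, h1⟩ := estA (E := E) (M + (n+1)) K hAF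
  obtain ⟨C2, hC2, h2⟩ := dI_le (n := n) hd M
  refine ⟨(C0 + C1) * C2, by positivity, fun j ν m a A x y' hA ⟨ha, has, hab⟩ hy' => ?_⟩
  have e : ∫ y, (𝓕⁻ (φ j)) (x - y) • a y = ((2:ℝ)^j)^n • ∫ y, (𝓕⁻ (Th φ j)) ((2:ℝ)^j • (x - y)) • a y := by
    rw [← integral_smul]
    congr with y
    rw [iF_scale, smul_assoc]; rfl
  rw [e, enorm_smul, Real.enorm_of_nonneg (by positivity)]
  have h3 := h2 j ν m x y' (dQ_mono hd _ _ hy')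
  rw [gam]
  split_ifs with hj
  · have h4 := h1 j x a (dQ d ν m) (A * (2^ν)^K) (dQ_compact hd _ _) has ha
      (fun l hl y => hl ▸ hab l hl.le y) (by positivity)
    rw [if_neg (by omega)] at h4
    refine (mul_le_mul' le_rfl (h4.trans (mul_le_mul' le_rfl h3))).trans ?_
    rw [← ENNReal.ofReal_mul (by positivity), ← ENNReal.ofReal_mul (by positivity), max_eq_left hj.le]
    apply ENNReal.ofReal_le_ofReal
    calc _ = C1 * C2 * (A * (2^ν/2^j)^K * (1 / (1 + 2^(min j ν) * ‖x - y'‖)^M)) := by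
          rw [inv_pow, div_pow]
          have := (pow_pos (pow_pos (two_pos : (0:ℝ) < 2) j) n).ne'
          field_simp
      _ ≤ ((C0 + C1) * C2) * (A * (2^ν/2^j)^K * (1 / (1 + 2^(min j ν) * ‖x - y'‖)^M)) := by
          gcongr; linarith
      _ = _ := by ring
  · push Not at hj
    have h4 := h0 j x a (dQ d ν m) A (dQ_closed _ _ _).measurableSet has
      (fun y => by simpa [LD] using hab [] (by simp) y)
    rw [iF_eq] at h4
    refine (mul_le_mul' le_rfl (h4.trans (mul_le_mul' le_rfl h3))).trans ?_
    rw [← ENNReal.ofReal_mul (by positivity), ← ENNReal.ofReal_mul (by positivity), max_eq_right hj]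
    apply ENNReal.ofReal_le_ofReal
    calc _ = C0 * C2 * (A * (2^j/2^ν)^n * (1 / (1 + 2^(min j ν) * ‖x - y'‖)^M)) := by
          rw [div_pow]; ring
      _ ≤ ((C0 + C1) * C2) * (A * (2^j/2^ν)^n * (1 / (1 + 2^(min j ν) * ‖x - y'‖)^M)) := by
          gcongr; linarith
      _ = _ := by ring
def wt (δ : ℝ) (j ν : ℕ) : ℝ≥0∞ := ENNReal.ofReal ((2:ℝ)^(-δ * |(j:ℝ) - ν|))
lemma wt_symm (δ : ℝ) (j ν : ℕ) : wt δ j ν = wt δ ν j := by rw [wt, wt, abs_sub_comm]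
lemma wt_sum (δ : ℝ) (hδ : 0 < δ) : ∃ W : ℝ≥0∞, W ≠ ∞ ∧ ∀ j, ∑' ν, wt δ j ν ≤ W := by
  set ρ : ℝ≥0∞ := ENNReal.ofReal ((2:ℝ)^(-δ))
  have hρ : ρ < 1 := by
    rw [← ENNReal.ofReal_one]
    apply (ENNReal.ofReal_lt_ofReal_iff one_pos).2
    exact Real.rpow_lt_one_of_one_lt_of_neg one_lt_two (by linarith)
  have hw : ∀ (j ν k : ℕ), |(j:ℝ) - ν| = k → wt δ j ν = ρ^k := by
    intro j ν k h
    rw [wt, h, Real.rpow_mul (by norm_num), Real.rpow_natCast, ENNReal.ofReal_pow (by positivity)]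
  refine ⟨∑' k : ℕ, ρ^k + ∑' k : ℕ, ρ^k, ?_, fun j => ?_⟩
  · have h0 : 1 - ρ ≠ 0 := (tsub_pos_of_lt hρ).ne'
    simp [ENNReal.tsum_geometric, ENNReal.add_eq_top, h0]
  · rw [← ENNReal.summable.sum_add_tsum_nat_add' (k := j)]
    refine add_le_add ?_ (ENNReal.tsum_le_tsum fun k => le_of_eq ?_)
    · rw [← Finset.sum_range_reflect]
      refine le_trans (le_of_eq ?_) (ENNReal.sum_le_tsum ((Finset.range j).map (addRightEmbedding 1)))
      rw [Finset.sum_map]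
      refine Finset.sum_congr rfl fun k hk => ?_
      rw [Finset.mem_range] at hk
      apply hw
      have : (j:ℝ) - ((j - 1 - k : ℕ):ℝ) = ((k+1 : ℕ):ℝ) := by
        rw [Nat.sub_sub, Nat.cast_sub (by omega)]; push_cast; ring
      rw [this, abs_of_nonneg (by positivity)]; rfl
    · apply hw
      push_cast
      rw [show (j:ℝ) - (k + j) = -k by ring, abs_neg, abs_of_nonneg (by positivity)]
lemma wt_real {n : ℕ} {s r δ P : ℝ} {K M : ℕ} (_hr : 0 < r) (hM : (n + 1 : ℝ) ≤ M * r)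
    (hδ1 : δ ≤ (K - s) * r) (hδ2 : δ ≤ (s + n) * r - n) (j ν : ℕ) (u : ℝ) (hu : 0 ≤ u) :
    ((2:ℝ)^(j * s) * ((2:ℝ)^(-(ν:ℝ) * (s - P)) * gam n K j ν * (1 / (1 + u)^M)))^r ≤
      ((2:ℝ)^(ν * P))^r * (2:ℝ)^(-δ * |(j:ℝ) - ν|) * (((2:ℝ)^ν)⁻¹)^n * ((2^(min j ν))^n / (1 + u)^(n+1)) := by
  have hg : gam n K j ν = (2:ℝ)^(if ν < j then ((ν:ℝ) - j) * K else ((j:ℝ) - ν) * n) := by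
    rw [gam]
    split_ifs
    · rw [Real.rpow_mul (by norm_num), Real.rpow_sub (by norm_num), Real.rpow_natCast, Real.rpow_natCast, Real.rpow_natCast]
    · rw [Real.rpow_mul (by norm_num), Real.rpow_sub (by norm_num), Real.rpow_natCast, Real.rpow_natCast, Real.rpow_natCast]
  set G : ℝ := if ν < j then ((ν:ℝ) - j) * K else ((j:ℝ) - ν) * n with hG
  have h2 : (0:ℝ) < 2 := two_pos
  have hu1 : (1:ℝ) ≤ 1 + u := by linarith
  have e1 : (2:ℝ)^(j * s) * ((2:ℝ)^(-(ν:ℝ) * (s - P)) * gam n K j ν * (1 / (1 + u)^M)) =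
      (2:ℝ)^(j * s + (-(ν:ℝ) * (s - P) + G)) * (1 / (1 + u)^M) := by
    rw [hg, Real.rpow_add h2, Real.rpow_add h2]; ring
  have e2 : (((2:ℝ)^ν)⁻¹)^n * ((2^(min j ν))^n / (1 + u)^(n+1)) =
      (2:ℝ)^(((min j ν : ℕ) - (ν:ℝ)) * n) * (1 / (1+u)^(n+1)) := by
    rw [Real.rpow_mul h2.le, Real.rpow_sub h2, Real.rpow_natCast, Real.rpow_natCast, Real.rpow_natCast, div_pow, inv_pow]
    field_simp
  rw [e1, mul_assoc _ _ ((2 ^ min j ν)^n / _), e2, Real.mul_rpow (by positivity) (by positivity), ← Real.rpow_mul h2.le,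
    ← Real.rpow_mul h2.le, ← mul_assoc, ← Real.rpow_add h2, ← Real.rpow_add h2]
  have h3 : (1 / (1 + u)^M)^r ≤ 1 / (1+u)^(n+1) := by
    rw [Real.div_rpow (by norm_num) (by positivity), Real.one_rpow, ← Real.rpow_natCast, ← Real.rpow_mul (by positivity),
      ← Real.rpow_natCast]
    gcongr
    · push_cast; exact hM
  refine mul_le_mul ?_ h3 (by positivity) (by positivity)
  apply Real.rpow_le_rpow_of_exponent_le one_le_two
  rw [hG]
  split_ifs with h
  · have h' : (ν:ℝ) < j := by exact_mod_cast h
    rw [min_eq_right h.le, abs_of_pos (by linarith)]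
    nlinarith
  · push Not at h
    have h' : (j:ℝ) ≤ ν := by exact_mod_cast h
    rw [min_eq_left h, abs_of_nonpos (by linarith)]
    nlinarith
def gfun (p : ℝ≥0∞) (r : ℝ) (lam : ℕ → (Fin n → ℤ) → ℂ) (ν : ℕ) (y : Rn n) : ℝ≥0∞ :=
  (‖lam ν (mI ν y)‖ₑ * (2:ℝ≥0∞)^((ν:ℝ) * n / p.toReal))^r
lemma gfun_meas (p : ℝ≥0∞) (r : ℝ) (lam : ℕ → (Fin n → ℤ) → ℂ) (ν : ℕ) : Measurable (gfun p r lam ν) := by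
  unfold gfun
  have : Measurable fun y : Rn n => lam ν (mI ν y) := (measurable_of_countable (lam ν)).comp (mI_meas ν)
  exact (this.enorm.mul_const _).pow_const r
lemma tsum2_rpow_le (T : ℕ → (Fin n → ℤ) → ℝ≥0∞) (r : ℝ) (hr : 0 < r) (hr1 : r ≤ 1) :
    (∑' ν, ∑' m, T ν m)^r ≤ ∑' ν, ∑' m, (T ν m)^r :=
  (tsum_rpow_le _ r hr hr1).trans (ENNReal.tsum_le_tsum fun ν => tsum_rpow_le _ r hr hr1)
lemma A_point {φ : ℕ → Sch n} (hφ : SmoothResolution n φ) {d : ℝ} (hd : 1 < d) (K : ℕ) (p : ℝ≥0∞)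
    {s r δ : ℝ} (hr : 0 < r) (hr1 : r ≤ 1) (hδ1 : δ ≤ (K - s) * r) (hδ2 : δ ≤ (s + n) * r - n) :
    ∃ C : ℝ≥0∞, C ≠ ∞ ∧ ∀ (f : TDist n E) (lam : ℕ → (Fin n → ℤ) → ℂ) (a : ℕ → (Fin n → ℤ) → Rn n → E),
      (∀ m, Is1Atom K d m (a 0 m)) → (∀ ν m, 0 < ν → IsSPAtom s p K (-1) d ν m (a ν m)) →
      RepresentsAtomic f lam a → ∀ (j : ℕ) (x : Rn n),
        ((2:ℝ≥0∞)^((j:ℝ) * s) * ‖mOp (φ j) f x‖ₑ)^r ≤ C * Aop (wt δ) (gfun p r lam) j x := by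
  obtain ⟨M, hM⟩ := exists_nat_ge ((n + 1 : ℝ) / r)
  rw [div_le_iff₀ hr] at hM
  obtain ⟨C, hC, h⟩ := atom_est (E := E) hφ hd K M
  set c : ℝ := (2 * π) ^ (-(n : ℝ) / 2)
  have hc : 0 < c := by positivity
  refine ⟨ENNReal.ofReal (c * C) ^ r, ENNReal.rpow_ne_top_of_nonneg hr.le ENNReal.ofReal_ne_top,
    fun f lam a h0 h1 hrep j x => ?_⟩
  have hat := AtB_of h0 h1
  set A : ℕ → ℝ := fun ν => (2:ℝ)^(-(ν:ℝ) * (s - n/p.toReal))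
  have hm : ‖mOp (φ j) f x‖ₑ ≤ ∑' ν, ∑' m, ENNReal.ofReal c * (‖lam ν m‖ₑ * ‖∫ y, (𝓕⁻ (φ j)) (x - y) • a ν m y‖ₑ) := by
    have := hrep (shiftReflect (invFourierS (φ j)) x)
    rw [mOp, tdConv, enorm_smul, Real.enorm_of_nonneg hc.le, ← this.tsum_eq]
    simp_rw [ENNReal.tsum_mul_left]
    gcongr
    rw [← ENNReal.tsum_prod]
    refine (enorm_tsum_le_tsum_enorm).trans (le_of_eq ?_)
    congr with νm
    rw [enorm_smul]
    rfl
  have key : ∀ ν m, ((2:ℝ≥0∞)^((j:ℝ) * s) * (ENNReal.ofReal c * (‖lam ν m‖ₑ * ‖∫ y, (𝓕⁻ (φ j)) (x - y) • a ν m y‖ₑ)))^r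
      ≤ ENNReal.ofReal (c * C) ^ r * (wt δ j ν * ∫⁻ y in {y : Rn n | mI ν y = m}, ker (min j ν) (x - y) * gfun p r lam ν y) := by
    intro ν m
    set t := ((2:ℝ≥0∞)^((j:ℝ) * s) * (ENNReal.ofReal c * (‖lam ν m‖ₑ * ‖∫ y, (𝓕⁻ (φ j)) (x - y) • a ν m y‖ₑ)))^r with ht
    set v : ℝ≥0∞ := ENNReal.ofReal ((((2:ℝ)^ν)⁻¹)^n) with hv
    have hv0 : v ≠ 0 := by rw [hv]; simp only [ne_eq, ENNReal.ofReal_eq_zero, not_le]; positivity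
    have hpt : ∀ y : Rn n, mI ν y = m → t ≤ v * (ENNReal.ofReal (c * C)^r * (wt δ j ν * (ker (min j ν) (x - y) * gfun p r lam ν y))) := by
      intro y hy
      have h3 := h j ν m (a ν m) (A ν) x y (by positivity) (hat ν m) (hy ▸ mI_mem ν y)
      have h4 := wt_real (P := n / p.toReal) hr hM hδ1 hδ2 j ν (2^(min j ν) * ‖x - y‖) (by positivity)
      have e2 : (2:ℝ≥0∞)^((j:ℝ) * s) = ENNReal.ofReal ((2:ℝ)^((j:ℝ)*s)) := by
        rw [← ENNReal.ofReal_rpow_of_pos two_pos]; simp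
      have e3 : (2:ℝ≥0∞)^((ν:ℝ) * n / p.toReal) = ENNReal.ofReal ((2:ℝ)^((ν:ℝ) * (n / p.toReal))) := by
        rw [← ENNReal.ofReal_rpow_of_pos two_pos, mul_div_assoc]; simp
      have h5 := ENNReal.ofReal_le_ofReal h4
      have hg0 : 0 ≤ gam n K j ν := by rw [gam]; split_ifs <;> positivity
      rw [ENNReal.ofReal_mul (by positivity), ENNReal.ofReal_mul (by positivity), ENNReal.ofReal_mul (by positivity),
        ← ENNReal.ofReal_rpow_of_nonneg (by positivity) hr.le, ← ENNReal.ofReal_rpow_of_nonneg (by positivity) hr.le, ← e3] at h5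
      have s1 : t ≤ (ENNReal.ofReal (c * C) * ‖lam ν m‖ₑ * ENNReal.ofReal ((2:ℝ)^(j * s) * (A ν * gam n K j ν * (1 / (1 + 2^(min j ν) * ‖x - y‖)^M))))^r := by
        rw [ht]
        refine ENNReal.rpow_le_rpow ?_ hr.le
        refine (mul_le_mul' le_rfl (mul_le_mul' le_rfl (mul_le_mul' le_rfl h3))).trans (le_of_eq ?_)
        rw [e2, mul_assoc C, mul_assoc C, ENNReal.ofReal_mul hC.le, ENNReal.ofReal_mul hc.le, ENNReal.ofReal_mul (p := (2:ℝ)^(j * s)) (by positivity)]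
        ring
      rw [ENNReal.mul_rpow_of_nonneg _ _ hr.le, ENNReal.mul_rpow_of_nonneg _ _ hr.le] at s1
      refine (s1.trans (mul_le_mul' le_rfl h5)).trans (le_of_eq ?_)
      rw [gfun, hy, ENNReal.mul_rpow_of_nonneg _ _ hr.le, wt, ker, hv]
      ring
    have hF : MeasurableSet {y : Rn n | mI ν y = m} := mI_meas ν (measurableSet_singleton m)
    have h6 : t * v ≤ v * (ENNReal.ofReal (c * C)^r * (wt δ j ν * ∫⁻ y in {y : Rn n | mI ν y = m}, ker (min j ν) (x - y) * gfun p r lam ν y)) := by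
      calc t * v = ∫⁻ y in {y : Rn n | mI ν y = m}, t := by rw [setLIntegral_const, mI_vol]
        _ ≤ _ := setLIntegral_mono' hF hpt
        _ = _ := by
          have hfin : ENNReal.ofReal (c * C)^r ≠ ∞ := ENNReal.rpow_ne_top_of_nonneg hr.le ENNReal.ofReal_ne_top
          have hwf : wt δ j ν ≠ ∞ := ENNReal.ofReal_ne_top
          rw [lintegral_const_mul' _ _ ENNReal.ofReal_ne_top, lintegral_const_mul' _ _ hfin, lintegral_const_mul' _ _ hwf]
    rw [mul_comm] at h6
    exact (ENNReal.mul_le_mul_iff_right hv0 ENNReal.ofReal_ne_top).1 h6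
  have h7 := ENNReal.rpow_le_rpow (mul_le_mul' (le_refl ((2:ℝ≥0∞)^((j:ℝ) * s))) hm) hr.le
  simp_rw [← ENNReal.tsum_mul_left] at h7
  refine (h7.trans (tsum2_rpow_le _ r hr hr1)).trans ?_
  refine (ENNReal.tsum_le_tsum fun ν => ENNReal.tsum_le_tsum fun m => key ν m).trans (le_of_eq ?_)
  simp_rw [ENNReal.tsum_mul_left]
  rw [Aop]
  congr 1
  congr with ν
  rw [Tk, lint_fib ν]
lemma lqSum_mono (q : ℝ≥0∞) {a b : ℕ → ℝ≥0∞} (h : ∀ j, a j ≤ b j) : lqSum q a ≤ lqSum q b := by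
  unfold lqSum
  split_ifs
  · exact iSup_mono h
  · gcongr with j; exact h j
lemma lpNorm_mono (p : ℝ≥0∞) {a b : Rn n → ℝ≥0∞} (h : ∀ j, a j ≤ b j) : lpNormENN p a ≤ lpNormENN p b := by
  unfold lpNormENN
  split_ifs
  · exact essSup_mono_ae (Eventually.of_forall h)
  · gcongr with j; exact h j
lemma lqSum_const_mul {q : ℝ≥0∞} (hq : 0 < q) (c : ℝ≥0∞) (a : ℕ → ℝ≥0∞) :
    lqSum q (fun j => c * a j) = c * lqSum q a := by
  unfold lqSum
  split_ifs with h
  · rw [ENNReal.mul_iSup]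
  · have hq' : 0 < q.toReal := ENNReal.toReal_pos hq.ne' h
    simp_rw [ENNReal.mul_rpow_of_nonneg _ _ hq'.le]
    rw [ENNReal.tsum_mul_left, ENNReal.mul_rpow_of_nonneg _ _ (by positivity), ← ENNReal.rpow_mul, mul_one_div_cancel hq'.ne', ENNReal.rpow_one]
lemma lpNorm_const_mul {p : ℝ≥0∞} (hp : 0 < p) (hp' : p ≠ ∞) (c : ℝ≥0∞) (hc : c ≠ ∞) (a : Rn n → ℝ≥0∞) :
    lpNormENN p (fun j => c * a j) = c * lpNormENN p a := by
  unfold lpNormENN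
  rw [if_neg hp', if_neg hp']
  have hp1 : 0 < p.toReal := ENNReal.toReal_pos hp.ne' hp'
  simp_rw [ENNReal.mul_rpow_of_nonneg _ _ hp1.le]
  rw [lintegral_const_mul' _ _ (ENNReal.rpow_ne_top_of_nonneg hp1.le hc), ENNReal.mul_rpow_of_nonneg _ _ (by positivity), ← ENNReal.rpow_mul, mul_one_div_cancel hp1.ne', ENNReal.rpow_one]
lemma A_main {φ : ℕ → Sch n} (hφ : SmoothResolution n φ) {d : ℝ} (hd : 1 < d) (K : ℕ) (p q : ℝ≥0∞) (hp' : p ≠ ∞)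
    {s r δ : ℝ} (hr : 0 < r) (hr1 : r ≤ 1) (hrp : ENNReal.ofReal r < p) (hrq : ENNReal.ofReal r < q)
    (hδ : 0 < δ) (hδ1 : δ ≤ (K - s) * r) (hδ2 : δ ≤ (s + n) * r - n) :
    ∃ C : ℝ≥0∞, C ≠ ∞ ∧ ∀ (f : TDist n E) (lam : ℕ → (Fin n → ℤ) → ℂ) (a : ℕ → (Fin n → ℤ) → Rn n → E),
      (∀ m, Is1Atom K d m (a 0 m)) → (∀ ν m, 0 < ν → IsSPAtom s p K (-1) d ν m (a ν m)) →
      RepresentsAtomic f lam a → triebelNorm s p q φ f ≤ C * fNorm p q lam := by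
  obtain ⟨C1, hC1, h1⟩ := A_point (E := E) hφ hd K p hr hr1 hδ1 hδ2
  obtain ⟨W, hW, hwW⟩ := wt_sum δ hδ
  obtain ⟨C2, hC2, h2⟩ := VV (n := n) (wt δ) (wt_symm δ) W hW hwW p q hp' r hr hrp hrq
  have hp0 : 0 < p := pos_of_gt hrp
  have hq0 : 0 < q := pos_of_gt hrq
  have hCr : C1^(1/r) ≠ ∞ := ENNReal.rpow_ne_top_of_nonneg (by positivity) hC1
  refine ⟨C1^(1/r) * C2, ENNReal.mul_ne_top hCr hC2,
    fun f lam a ha0 ha1 hrep => ?_⟩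
  have h3 := h1 f lam a ha0 ha1 hrep
  have h4 := h2 (gfun p r lam) (gfun_meas p r lam)
  calc triebelNorm s p q φ f ≤ lpNormENN p (fun x => lqSum q fun j => C1^(1/r) * (Aop (wt δ) (gfun p r lam) j x)^(1/r)) := by
        refine lpNorm_mono _ fun x => lqSum_mono _ fun j => ?_
        rw [← ENNReal.mul_rpow_of_nonneg _ _ (by positivity)]
        have := ENNReal.rpow_le_rpow (h3 j x) (z := 1/r) (by positivity)
        rwa [← ENNReal.rpow_mul, mul_one_div_cancel hr.ne', ENNReal.rpow_one] at this
    _ = C1^(1/r) * lpNormENN p (fun x => lqSum q fun j => (Aop (wt δ) (gfun p r lam) j x)^(1/r)) := by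
        simp_rw [lqSum_const_mul hq0]
        rw [lpNorm_const_mul hp0 hp' _ hCr]
    _ ≤ C1^(1/r) * (C2 * lpNormENN p (fun x => lqSum q fun j => (gfun p r lam j x)^(1/r))) := by gcongr
    _ ≤ C1^(1/r) * (C2 * fNorm p q lam) := by
        gcongr
        refine lpNorm_mono _ fun x => ?_
        have e : ∀ j, (gfun p r lam j x)^(1/r) = (‖lam j (mI j x)‖₊ : ℝ≥0∞) * chiP p j (mI j x) x := by
          intro j
          rw [gfun, ← ENNReal.rpow_mul, mul_one_div_cancel hr.ne', ENNReal.rpow_one, chiP, if_pos (mI_mem j x)]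
          rfl
        simp_rw [e, lqSum]
        split_ifs
        · exact iSup_mono fun j => le_iSup (fun m => (‖lam j m‖₊ : ℝ≥0∞) * chiP p j m x) (mI j x)
        · gcongr with j
          exact ENNReal.le_tsum (f := fun m => ((‖lam j m‖₊ : ℝ≥0∞) * chiP p j m x)^q.toReal) (mI j x)
    _ = _ := by rw [mul_assoc]
def PG (u : Rn n → E) : Prop :=
  Continuous u ∧ ∃ (C : ℝ) (N : ℕ), 0 ≤ C ∧ ∀ y, ‖u y‖ ≤ C * (1 + ‖y‖)^N
def GG (H : Sch n) (u : Rn n → E) (x : Rn n) : E := ∫ y, H (x - y) • u y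
lemma BF_one (H : Sch n) : BF (fun _ : Unit => H) := fun _ _ => ⟨_, fun _ => le_rfl⟩
lemma sch_decay (H : Sch n) (N : ℕ) : ∃ C : ℝ, 0 < C ∧ ∀ z, ‖H z‖ ≤ C / (1 + ‖z‖)^N := by
  obtain ⟨C, hC, h⟩ := (BF_one H).decay0 N
  exact ⟨C, hC, h ()⟩
lemma sch_decay1 (H : Sch n) (N : ℕ) : ∃ C : ℝ, 0 < C ∧ ∀ z, ‖fderiv ℝ H z‖ ≤ C / (1 + ‖z‖)^N := by
  obtain ⟨C, hC, h⟩ := (BF_one H).decay N 1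
  refine ⟨C, hC, fun z => ?_⟩
  have := h () z
  rwa [← norm_iteratedFDeriv_fderiv, norm_iteratedFDeriv_zero] at this
lemma one_add_sub_le (x y : Rn n) : 1 + ‖y‖ ≤ (1 + ‖x‖) * (1 + ‖x - y‖) := by
  have : ‖y‖ ≤ ‖x‖ + ‖x - y‖ := by
    calc ‖y‖ = ‖x - (x - y)‖ := by simp
      _ ≤ _ := norm_sub_le _ _
  nlinarith [norm_nonneg x, norm_nonneg (x - y), mul_nonneg (norm_nonneg x) (norm_nonneg (x - y))]
lemma int_wt (n : ℕ) : Integrable (fun y : Rn n => 1 / (1 + ‖y‖)^(n+1)) := by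
  have := integrable_one_add_norm (E := Rn n) (μ := volume) (r := (n+1 : ℕ)) (by simp)
  refine this.congr (ae_of_all _ fun y => ?_)
  simp only
  rw [Real.rpow_neg (by positivity), Real.rpow_natCast, one_div]
lemma dom_bd {C : ℝ} {N : ℕ} {D a b : ℝ} (hD : 0 ≤ D) {x y : Rn n} {R : ℝ} (hx : ‖x‖ ≤ R)
    (ha : a ≤ D / (1 + ‖x - y‖)^(N + (n+1))) (hb0 : 0 ≤ b)
    (hb : b ≤ C * (1 + ‖y‖)^N) : a * b ≤ D * C * (1 + R)^(N + (n+1)) * (1 / (1 + ‖y‖)^(n+1)) := by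
  have h1 : (1 + ‖y‖)^(N + (n+1)) ≤ (1 + R)^(N + (n+1)) * (1 + ‖x - y‖)^(N + (n+1)) := by
    rw [← mul_pow]
    refine pow_le_pow_left₀ (by positivity) ((one_add_sub_le x y).trans ?_) _
    gcongr
  have h2 : D / (1 + ‖x - y‖)^(N + (n+1)) ≤ D * (1 + R)^(N + (n+1)) / (1 + ‖y‖)^(N + (n+1)) := by
    rw [div_le_div_iff₀ (by positivity) (by positivity)]
    calc _ ≤ D * ((1 + R)^(N + (n+1)) * (1 + ‖x - y‖)^(N + (n+1))) := by gcongr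
      _ = _ := by ring
  have hR : 0 ≤ R := (norm_nonneg x).trans hx
  calc a * b ≤ (D * (1 + R)^(N + (n+1)) / (1 + ‖y‖)^(N + (n+1))) * (C * (1 + ‖y‖)^N) :=
        mul_le_mul (ha.trans h2) hb hb0 (by positivity)
    _ = _ := by
      rw [pow_add (1 + ‖y‖)]
      field_simp
lemma GG_integrable (H : Sch n) {u : Rn n → E} (hu : PG u) (x : Rn n) :
    Integrable fun y => H (x - y) • u y := by
  obtain ⟨hc, C, N, hC, h⟩ := hu
  obtain ⟨D, hD, hH⟩ := sch_decay H (N + (n+1))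
  have hcont : Continuous fun y => H (x - y) • u y := (H.continuous.comp (by fun_prop)).smul hc
  refine ((int_wt n).const_mul (D * C * (1 + ‖x‖)^(N + (n+1)))).mono' hcont.aestronglyMeasurable
    (ae_of_all _ fun y => ?_)
  rw [norm_smul]
  exact dom_bd hD.le le_rfl (hH _) (norm_nonneg _) (h y)
lemma GG_fderiv (H : Sch n) {u : Rn n → E} (hu : PG u) (x : Rn n) :
    Integrable (fun y => (fderiv ℝ H (x - y)).smulRight (u y)) ∧
    HasFDerivAt (GG H u) (∫ y, (fderiv ℝ H (x - y)).smulRight (u y)) x := by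
  have hI := GG_integrable H hu
  obtain ⟨hc, C, N, hC, h⟩ := hu
  obtain ⟨D, hD, hH⟩ := sch_decay1 H (N + (n+1))
  have hcd : Continuous fun v => fderiv ℝ H v := (H.smooth 1).continuous_fderiv (by norm_num)
  have hcont : ∀ x, Continuous fun y => (fderiv ℝ H (x - y)).smulRight (u y) := fun x =>
    (((ContinuousLinearMap.lsmul ℝ ℂ : ℂ →L[ℝ] E →L[ℝ] E).flip.continuous.comp hc).clm_comp
      (hcd.comp (by fun_prop : Continuous fun y => x - y)))
  have hb : ∀ x' ∈ ball x 1, ∀ y, ‖(fderiv ℝ H (x' - y)).smulRight (u y)‖ ≤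
      D * C * (1 + (‖x‖+1))^(N + (n+1)) * (1 / (1 + ‖y‖)^(n+1)) := by
    intro x' hx' y
    refine (ContinuousLinearMap.opNorm_le_bound _ (by positivity) fun v => ?_ : _ ≤ ‖fderiv ℝ H (x' - y)‖ * ‖u y‖).trans ?_
    · rw [ContinuousLinearMap.smulRight_apply, norm_smul, mul_right_comm]
      gcongr
      exact ContinuousLinearMap.le_opNorm _ _
    refine dom_bd hD.le ?_ (hH _) (norm_nonneg _) (h y)
    have : ‖x' - x‖ < 1 := by simpa [dist_eq_norm] using hx'
    have := norm_le_norm_add_norm_sub' x' x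
    linarith
  have hint := (int_wt n).const_mul (D * C * (1 + (‖x‖+1))^(N + (n+1)))
  refine ⟨hint.mono' (hcont x).aestronglyMeasurable (ae_of_all _ (hb x (mem_ball_self one_pos))), ?_⟩
  refine hasFDerivAt_integral_of_dominated_of_fderiv_le (bound := fun y =>
    D * C * (1 + (‖x‖+1))^(N + (n+1)) * (1 / (1 + ‖y‖)^(n+1))) (ball_mem_nhds x one_pos)
    (Eventually.of_forall fun x' => (hI x').aestronglyMeasurable) (hI x)
    (hcont x).aestronglyMeasurable (ae_of_all _ fun y x' hx' => hb x' hx' y) hint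
    (ae_of_all _ fun y x' hx' => ?_)
  have h1 : HasFDerivAt (fun z : Rn n => H (z - y)) (fderiv ℝ H (x' - y)) x' := by
    have := (H.differentiableAt (x := x' - y)).hasFDerivAt.comp x' ((hasFDerivAt_id (𝕜 := ℝ) x').sub_const y)
    refine HasFDerivAt.congr_fderiv this ?_
    ext v
    rfl
  exact h1.smul_const (u y)
lemma GG_fderiv_apply [CompleteSpace E] (H : Sch n) {u : Rn n → E} (hu : PG u) (x v : Rn n) :
    fderiv ℝ (GG H u) x v = GG (LineDeriv.lineDerivOp v H) u x := by
  obtain ⟨h1, h2⟩ := GG_fderiv H hu x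
  rw [h2.fderiv, ContinuousLinearMap.integral_apply h1]
  simp [GG, SchwartzMap.lineDerivOp_apply_eq_fderiv]
lemma GG_contDiff [CompleteSpace E] {u : Rn n → E} (hu : PG u) (k : ℕ) : ∀ H : Sch n, ContDiff ℝ k (GG H u) := by
  induction k with
  | zero =>
    intro H
    exact contDiff_zero.2 (continuous_iff_continuousAt.2 fun x => (GG_fderiv H hu x).2.continuousAt)
  | succ k ih =>
    intro H
    push_cast
    refine (contDiff_succ_iff_fderiv (n := (k : WithTop ℕ∞))).2 ⟨fun x => (GG_fderiv H hu x).2.differentiableAt, by simp, ?_⟩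
    refine contDiff_clm_apply_iff.2 fun v => ?_
    simp_rw [GG_fderiv_apply H hu]
    exact ih _
def LDS (l : List (Fin n)) (H : Sch n) : Sch n := l.foldr (fun i h => LineDeriv.lineDerivOp (bv i) h) H
lemma LDS_coe (l : List (Fin n)) (H : Sch n) : (LDS l H : Rn n → ℂ) = LD l H := by
  induction l with
  | nil => rfl
  | cons i l ih =>
    rw [LD_cons, ← ih]
    ext x
    exact SchwartzMap.lineDerivOp_apply _ _ _
lemma LD_GG [CompleteSpace E] (H : Sch n) {u : Rn n → E} (hu : PG u) (l : List (Fin n)) :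
    LD l (GG H u) = GG (LDS l H) u := by
  induction l with
  | nil => rfl
  | cons i l ih =>
    rw [LD_cons, ih, pd_eq (GG_contDiff hu 1 _)]
    ext x
    exact GG_fderiv_apply _ hu x _
def LDC (l : List (Fin n)) : Sch n →L[ℂ] Sch n :=
  l.foldr (fun i T => (LineDeriv.lineDerivOpCLM ℂ (Sch n) (bv i)) ∘L T) (ContinuousLinearMap.id ℂ _)
lemma LDC_apply (l : List (Fin n)) (H : Sch n) : LDC l H = LDS l H := by
  induction l with
  | nil => rfl
  | cons i l ih =>
    change LineDeriv.lineDerivOp (bv i) (LDC l H) = _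
    rw [ih]; rfl
def ewt (K : ℕ) (x : Rn n) : ℂ := ((1 + ‖x‖^2)^K : ℝ)
lemma ewt_tg (K : ℕ) : Function.HasTemperateGrowth (ewt (n := n) K) := by
  have h1 : Function.HasTemperateGrowth fun x : Rn n => (1 + ‖x‖^2)^K := by
    fun_prop
  exact (Complex.ofRealCLM.hasTemperateGrowth).comp h1
lemma norm_ewt (K : ℕ) (x : Rn n) : ‖ewt K x‖ = (1 + ‖x‖^2)^K := by
  rw [ewt, Complex.norm_real, Real.norm_of_nonneg (by positivity)]
def JJ (n K L : ℕ) : Sch n →L[ℂ] ((Fin n → Fin (L+1)) → BoundedContinuousFunction (Rn n) ℂ) :=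
  ContinuousLinearMap.pi fun α => (SchwartzMap.toBoundedContinuousFunctionCLM ℂ (Rn n) ℂ) ∘L
    (SchwartzMap.smulLeftCLM ℂ (ewt K)) ∘L LDC (ml fun i => (α i : ℕ))
lemma JJ_apply (K L : ℕ) (H : Sch n) (α : Fin n → Fin (L+1)) (z : Rn n) :
    JJ n K L H α z = ewt K z * LDS (ml fun i => (α i : ℕ)) H z := by
  simp only [JJ, ContinuousLinearMap.pi_apply, ContinuousLinearMap.comp_apply]
  rw [SchwartzMap.toBoundedContinuousFunctionCLM_apply, SchwartzMap.smulLeftCLM_apply_apply (ewt_tg K),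
    LDC_apply, smul_eq_mul]
lemma td_bound (f : TDist n E) : ∃ (C : ℝ) (K L : ℕ), 0 ≤ C ∧ ∀ H, ‖f.toFun H‖ ≤ C * ‖JJ n K L H‖ := by
  obtain ⟨c, K, L, h⟩ := f.bound
  refine ⟨|c| * Fintype.card (Fin n → Fin (L+1)), K, L, by positivity, fun H => (h H).trans ?_⟩
  have h0 : 0 ≤ schSemi K L H := Real.iSup_nonneg fun x => mul_nonneg (by positivity)
    (Finset.sum_nonneg fun α _ => by split_ifs <;> positivity)
  refine (mul_le_mul_of_nonneg_right (le_abs_self c) h0).trans ?_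
  rw [mul_assoc]
  refine mul_le_mul_of_nonneg_left ?_ (abs_nonneg _)
  refine ciSup_le fun x => ?_
  rw [Finset.mul_sum]
  refine (Finset.sum_le_sum (g := fun _ => ‖JJ n K L H‖) fun α _ => ?_).trans (by simp)
  split_ifs
  · refine le_trans ?_ ((BoundedContinuousFunction.norm_coe_le_norm _ x).trans (norm_le_pi_norm (JJ n K L H) α))
    rw [JJ_apply, norm_mul, norm_ewt, LDS_coe, ← mderiv_eq]
    refine mul_le_mul_of_nonneg_right ?_ (norm_nonneg _)
    rw [← Real.rpow_natCast (1 + ‖x‖^2) K]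
    exact Real.rpow_le_rpow_of_exponent_le (le_add_of_nonneg_right (sq_nonneg _)) (by
      have : (0:ℝ) ≤ K := by positivity
      linarith)
  · simp
lemma LD_translate {F : Type*} [NormedAddCommGroup F] [NormedSpace ℝ F] (l : List (Fin n)) (h : Rn n → F) (y : Rn n) :
    LD l (fun z => h (z - y)) = fun z => LD l h (z - y) := by
  induction l with
  | nil => rfl
  | cons i l ih =>
    rw [LD_cons, LD_cons, ih]
    ext x
    simp only [pd, lineDeriv]
    congr 1
    ext t
    congr 1
    abel
lemma LDS_shift (l : List (Fin n)) (ψ : Sch n) (y z : Rn n) :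
    LDS l (shiftReflect ψ y) z = LDS l (shiftReflect ψ 0) (z - y) := by
  rw [LDS_coe, LDS_coe]
  rw [← show LD l (fun z => (shiftReflect ψ 0) (z - y)) z = _ from congrFun (LD_translate l _ y) z]
  congr 1
  ext w
  rw [shiftReflect_apply, shiftReflect_apply]
  congr 1
  abel
lemma sch_lip (H : Sch n) (N : ℕ) : ∃ C : ℝ, 0 < C ∧ ∀ w h : Rn n, ‖h‖ ≤ 1 →
    ‖H (w + h) - H w‖ ≤ C * ‖h‖ / (1 + ‖w‖)^N := by
  obtain ⟨C, hC, hH⟩ := sch_decay1 H N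
  refine ⟨C * 2^N, by positivity, fun w h hh => ?_⟩
  have := (convex_closedBall w 1).norm_image_sub_le_of_norm_fderiv_le (𝕜 := ℝ) (f := H)
    (C := C * 2^N / (1 + ‖w‖)^N) (fun v _ => H.differentiableAt) (fun v hv => ?_)
    (mem_closedBall_self zero_le_one) (y := w + h) (by simpa using hh)
  · refine this.trans_eq ?_
    simp only [add_sub_cancel_left]
    ring
  · refine (hH v).trans ?_
    rw [div_le_div_iff₀ (by positivity) (by positivity), mul_assoc, ← mul_pow]
    gcongr
    have h1 : ‖v - w‖ ≤ 1 := by simpa [dist_eq_norm] using hv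
    have h2 : ‖w‖ ≤ ‖v‖ + ‖v - w‖ := norm_le_norm_add_norm_sub v w
    linarith [norm_nonneg v]
lemma ewt_le (K : ℕ) (y z : Rn n) : (1 + ‖z‖^2)^K ≤ (1 + ‖y‖)^(2*K) * (1 + ‖z - y‖)^(2*K) := by
  rw [← mul_pow, pow_mul]
  refine pow_le_pow_left₀ (by positivity) ?_ _
  have h := one_add_sub_le y z
  rw [norm_sub_rev] at h
  have : 1 + ‖z‖^2 ≤ (1 + ‖z‖)^2 := by nlinarith [norm_nonneg z]
  exact this.trans (pow_le_pow_left₀ (by positivity) h 2)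
lemma JJ_PG (K L : ℕ) (ψ : Sch n) : PG fun y => JJ n K L (shiftReflect ψ y) := by
  have e : ∀ y α z, JJ n K L (shiftReflect ψ y) α z =
      ewt K z * LDS (ml fun i => (α i : ℕ)) (shiftReflect ψ 0) (z - y) := fun y α z => by
    rw [JJ_apply, LDS_shift]
  constructor
  · rw [continuous_pi_iff]
    intro α
    obtain ⟨C, hC, h⟩ := sch_lip (LDS (ml fun i => (α i : ℕ)) (shiftReflect ψ 0)) (2*K)
    rw [continuous_iff_continuousAt]
    intro y
    rw [ContinuousAt, tendsto_iff_norm_sub_tendsto_zero]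
    have hl : Tendsto (fun y' => C * (1 + ‖y‖)^(2*K) * ‖y - y'‖) (𝓝 y) (𝓝 0) := by
      have : Continuous fun y' => C * (1 + ‖y‖)^(2*K) * ‖y - y'‖ := by fun_prop
      simpa using this.tendsto y
    refine squeeze_zero' (Eventually.of_forall fun _ => norm_nonneg _) ?_ hl
    filter_upwards [closedBall_mem_nhds y one_pos] with y' hy'
    rw [BoundedContinuousFunction.norm_le (by positivity)]
    intro z
    rw [BoundedContinuousFunction.sub_apply, e, e, ← mul_sub, norm_mul, norm_ewt]
    have h1 := h (z - y) (y - y') (by rw [norm_sub_rev]; simpa [dist_eq_norm] using hy')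
    rw [sub_add_sub_cancel] at h1
    calc _ ≤ ((1 + ‖y‖)^(2*K) * (1 + ‖z - y‖)^(2*K)) * (C * ‖y - y'‖ / (1 + ‖z - y‖)^(2*K)) :=
          mul_le_mul (ewt_le K y z) h1 (norm_nonneg _) (by positivity)
      _ = _ := by field_simp
  · choose C hC h using fun α : Fin n → Fin (L+1) =>
      sch_decay (LDS (ml fun i => (α i : ℕ)) (shiftReflect ψ 0)) (2*K)
    have hs : ∀ α, C α ≤ ∑ α, C α := fun α => Finset.single_le_sum (fun α _ => (hC α).le) (Finset.mem_univ α)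
    have hs0 : 0 ≤ ∑ α, C α := Finset.sum_nonneg fun α _ => (hC α).le
    refine ⟨∑ α, C α, 2*K, hs0, fun y => ?_⟩
    rw [pi_norm_le_iff_of_nonneg (by positivity)]
    intro α
    rw [BoundedContinuousFunction.norm_le (by positivity)]
    intro z
    rw [e, norm_mul, norm_ewt]
    calc _ ≤ ((1 + ‖y‖)^(2*K) * (1 + ‖z - y‖)^(2*K)) * (C α / (1 + ‖z - y‖)^(2*K)) :=
          mul_le_mul (ewt_le K y z) (h α _) (norm_nonneg _) (by positivity)
      _ = C α * (1 + ‖y‖)^(2*K) := by field_simp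
      _ ≤ _ := mul_le_mul_of_nonneg_right (hs α) (by positivity)
lemma td_PG (f : TDist n E) (ψ : Sch n) : PG fun y => f.toFun (shiftReflect ψ y) := by
  obtain ⟨C, K, L, hC, h⟩ := td_bound f
  obtain ⟨hJ, D, N, hD, hb⟩ := JJ_PG K L ψ
  constructor
  · rw [continuous_iff_continuousAt] at hJ ⊢
    intro y
    have := hJ y
    rw [ContinuousAt, tendsto_iff_norm_sub_tendsto_zero] at this ⊢
    refine squeeze_zero (fun _ => norm_nonneg _) (fun y' => ?_) (by simpa using this.const_mul C)
    rw [← map_sub, ← map_sub]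
    exact h _
  · refine ⟨C * D, N, by positivity, fun y => (h _).trans ?_⟩
    rw [mul_assoc]
    exact mul_le_mul_of_nonneg_left (hb y) hC
lemma sch_PG (g : Sch n) : PG (g : Rn n → ℂ) := by
  obtain ⟨C, hC, h⟩ := sch_decay g 0
  exact ⟨g.continuous, C, 0, hC.le, fun y => by simpa using h y⟩
lemma int_sch_smul (g : Sch n) {u : Rn n → E} (hu : PG u) : Integrable fun y => g y • u y := by
  have := GG_integrable (shiftReflect g 0) hu 0
  refine this.congr (ae_of_all _ fun y => ?_)
  simp [shiftReflect_apply]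
def cv (g H : Sch n) : Sch n := SchwartzMap.convolution (ContinuousLinearMap.mul ℂ ℂ) g H
lemma cv_apply (g H : Sch n) (z : Rn n) : cv g H z = ∫ y, g y * H (z - y) := by
  rw [cv, SchwartzMap.convolution_apply]
  rfl
lemma cv_coe (g H : Sch n) : (cv g H : Rn n → ℂ) = GG H g := by
  ext z
  rw [cv_apply, GG]
  simp only [smul_eq_mul, mul_comm]
lemma int_mem_closed {Y : Type*} [NormedAddCommGroup Y] [NormedSpace ℂ Y] [CompleteSpace Y] (M : Submodule ℂ Y)
    (hM : IsClosed (M : Set Y)) (F : Rn n → Y) (hF : Continuous F) (hI : Integrable F) (h : ∀ y, F y ∈ M) :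
    ∫ y, F y ∈ M := by
  have : CompleteSpace M := hM.completeSpace_coe
  have hc : Continuous fun y => (⟨F y, h y⟩ : M) := hF.subtype_mk h
  have hi : Integrable fun y => (⟨F y, h y⟩ : M) := by
    refine (integrable_norm_iff hc.aestronglyMeasurable).1 ?_
    exact hI.norm
  have := M.subtypeL.integral_comp_comm hi
  simp only [Submodule.subtypeL_apply] at this
  rw [this]
  exact Subtype.mem _
theorem comm_lemma [CompleteSpace E] (f : TDist n E) (g ψ : Sch n) :
    ∫ y, g y • f.toFun (shiftReflect ψ y) = f.toFun (cv g (shiftReflect ψ 0)) := by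
  obtain ⟨C, K, L, hC, h⟩ := td_bound f
  have hJ := JJ_PG K L ψ
  have hf := td_PG f ψ
  set T := (JJ n K L).toLinearMap.prod f.toFun with hT
  set M := (LinearMap.range T).topologicalClosure with hM
  have hMc : IsClosed (M : Set (((Fin n → Fin (L+1)) → BoundedContinuousFunction (Rn n) ℂ) × E)) :=
    Submodule.isClosed_topologicalClosure _
  have hTM : ∀ H, T H ∈ M := fun H => Submodule.le_topologicalClosure _ ⟨H, rfl⟩
  have hMb : ∀ w ∈ M, ‖w.2‖ ≤ C * ‖w.1‖ := by
    have hcl : IsClosed {w : ((Fin n → Fin (L+1)) → BoundedContinuousFunction (Rn n) ℂ) × E | ‖w.2‖ ≤ C * ‖w.1‖} :=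
      isClosed_le (by fun_prop) (by fun_prop)
    intro w hw
    refine closure_minimal ?_ hcl hw
    rintro _ ⟨H, rfl⟩
    exact h H
  have hI1 := int_sch_smul g hJ
  have hI2 := int_sch_smul g hf
  have hmem := int_mem_closed M hMc (fun y => (g y • JJ n K L (shiftReflect ψ y), g y • f.toFun (shiftReflect ψ y)))
    ((g.continuous.smul hJ.1).prodMk (g.continuous.smul hf.1)) (hI1.prodMk hI2) (fun y => by
      have := hTM (g y • shiftReflect ψ y)
      rw [map_smul] at this
      exact this)
  rw [integral_pair hI1 hI2] at hmem
  have e : ∫ y, g y • JJ n K L (shiftReflect ψ y) = JJ n K L (cv g (shiftReflect ψ 0)) := by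
    ext α z
    have h1 := (((BoundedContinuousFunction.evalCLM ℂ z) ∘L
      (ContinuousLinearMap.proj (R := ℂ) (φ := fun _ : Fin n → Fin (L+1) => BoundedContinuousFunction (Rn n) ℂ) α))).integral_comp_comm hI1
    simp only [ContinuousLinearMap.comp_apply, ContinuousLinearMap.proj_apply, BoundedContinuousFunction.evalCLM_apply] at h1
    rw [← h1, JJ_apply, LDS_coe, cv_coe, LD_GG _ (sch_PG g), GG, ← integral_const_mul]
    refine integral_congr_ae (ae_of_all _ fun y => ?_)
    simp only [Pi.smul_apply, BoundedContinuousFunction.smul_apply, smul_eq_mul]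
    rw [JJ_apply, LDS_shift]
    ring
  have h2 := hMb _ (M.sub_mem hmem (hTM (cv g (shiftReflect ψ 0))))
  simp only [hT, LinearMap.prod_apply, Function.prod_apply, e, ContinuousLinearMap.coe_coe, Prod.fst_sub, Prod.snd_sub, sub_self, norm_zero, mul_zero] at h2
  exact sub_eq_zero.1 (norm_le_zero_iff.1 h2)
lemma td_tendsto (f : TDist n E) {H : ℕ → Sch n} {H₀ : Sch n} (h : Tendsto H atTop (𝓝 H₀)) :
    Tendsto (fun j => f.toFun (H j)) atTop (𝓝 (f.toFun H₀)) := by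
  obtain ⟨C, K, L, hC, hb⟩ := td_bound f
  have h1 := ((JJ n K L).continuous.tendsto H₀).comp h
  rw [tendsto_iff_norm_sub_tendsto_zero] at h1 ⊢
  refine squeeze_zero (fun _ => norm_nonneg _) (fun j => ?_) (by simpa using h1.const_mul C)
  change _ ≤ C * ‖JJ n K L (H j) - JJ n K L H₀‖
  rw [← map_sub, ← map_sub]
  exact hb _
def pr (g H : Sch n) : Sch n := SchwartzMap.pairing (ContinuousLinearMap.mul ℂ ℂ) g H
lemma pr_apply (g H : Sch n) (x : Rn n) : pr g H x = g x * H x := rfl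
lemma fourierInv_reflect (g : Sch n) (x : Rn n) : (𝓕⁻ g) x = (𝓕 g) (-x) := by
  rw [SchwartzMap.fourierInv_coe, SchwartzMap.fourier_coe, Real.fourierInv_eq_fourier_neg]
lemma cv_eq (g H : Sch n) : cv g H = 𝓕 (pr (𝓕⁻ g) (𝓕⁻ H)) := by
  have : 𝓕⁻ (cv g H) = pr (𝓕⁻ g) (𝓕⁻ H) := by
    ext x
    rw [pr_apply, fourierInv_reflect, fourierInv_reflect, fourierInv_reflect, cv, SchwartzMap.fourier_convolution]
    rfl
  rw [← this, FourierTransform.fourier_fourierInv_eq]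
lemma cv_eq' (g H : Sch n) : cv g H = 𝓕⁻ (pr (𝓕 g) (𝓕 H)) := by
  have : 𝓕 (cv g H) = pr (𝓕 g) (𝓕 H) := by
    rw [cv, SchwartzMap.fourier_convolution]
    rfl
  rw [← this, FourierTransform.fourierInv_fourier_eq]
lemma refl_inv (ψ : Sch n) : shiftReflect (𝓕⁻ ψ) 0 = 𝓕 ψ := by
  ext x
  rw [shiftReflect_apply, fourierInv_reflect]
  simp
lemma phi_bd {φ : ℕ → Sch n} (hφ : SmoothResolution n φ) (l : ℕ) : ∃ C : ℝ, 0 ≤ C ∧ ∀ j x,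
    ‖iteratedFDeriv ℝ l (φ j) x‖ ≤ C := by
  choose c hc using hφ.deriv_bound
  have hB0 : 0 ≤ ∑ α : Fin n → Fin (l+1), |c (fun i => α i)| := Finset.sum_nonneg fun _ _ => abs_nonneg _
  refine ⟨(n:ℝ)^l * ∑ α : Fin n → Fin (l+1), |c (fun i => α i)|, by positivity, fun j x => ?_⟩
  refine norm_iteratedFDeriv_le ((φ j).smooth l) x _ (fun α hα => ?_) hB0
  have hle : ∀ i, α i < l + 1 := fun i => by
    have := Finset.single_le_sum (f := α) (fun i _ => Nat.zero_le _) (Finset.mem_univ i)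
    have h2 : mdeg α = ∑ i, α i := rfl
    omega
  refine (hc α j x).trans ?_
  have h2 : (2:ℝ) ^ (-(j : ℝ) * (mdeg α : ℝ)) ≤ 1 :=
    Real.rpow_le_one_of_one_le_of_nonpos (by norm_num) (by
      have : (0:ℝ) ≤ (j:ℝ) * (mdeg α : ℝ) := by positivity
      linarith)
  calc _ ≤ |c α| * 1 := mul_le_mul (le_abs_self _) h2 (by positivity) (abs_nonneg _)
    _ = |c (fun i => ((⟨α i, hle i⟩ : Fin (l+1)) : ℕ))| := by simp
    _ ≤ _ := Finset.single_le_sum (f := fun β : Fin n → Fin (l+1) => |c (fun i => β i)|)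
        (fun _ _ => abs_nonneg _) (Finset.mem_univ (fun i => (⟨α i, hle i⟩ : Fin (l+1))))
lemma phi_sum {φ : ℕ → Sch n} (hφ : SmoothResolution n φ) (J : ℕ) (x : Rn n) (hx : ‖x‖ < 2^J) :
    ∑ j ∈ Finset.range (J+1), φ j x = 1 := by
  rw [← hφ.sum_eq x]
  symm
  refine tsum_eq_sum fun j hj => ?_
  by_contra h0
  rw [Finset.mem_range, not_lt] at hj
  have h1 := (hφ.suppj j (by omega) h0).1
  have h2 : (2:ℝ)^J ≤ 2 ^ ((j:ℝ) - 1) := by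
    rw [← Real.rpow_natCast]
    refine Real.rpow_le_rpow_of_exponent_le (by norm_num) ?_
    have : ((J + 1 : ℕ) : ℝ) ≤ j := by exact_mod_cast hj
    push_cast at this
    linarith
  linarith
lemma S_tendsto {φ : ℕ → Sch n} (hφ : SmoothResolution n φ) (h : Sch n) :
    Tendsto (fun J => ∑ j ∈ Finset.range J, pr h (φ j)) atTop (𝓝 h) := by
  rw [← tendsto_add_atTop_iff_nat 1, (schwartz_withSeminorms ℝ (Rn n) ℂ).tendsto_nhds]
  rintro ⟨k, l⟩ ε hε
  choose C hC hb using fun i => phi_bd hφ i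
  choose D hD hd using fun i => (BF_one h).decay (k+1) i
  set A : ℝ := ∑ i ∈ Finset.range (l+1), (l.choose i : ℝ) * (C i + 1) * D (l-i) with hA
  have hA0 : 0 ≤ A := Finset.sum_nonneg fun i _ => by have := hC i; have := (hD (l-i)).le; positivity
  have key : ∀ J : ℕ, SchwartzMap.seminorm ℝ k l ((∑ j ∈ Finset.range (J+1), pr h (φ j)) - h) ≤ A * ((J+2) * (1/2)^J) := by
    intro J
    refine SchwartzMap.seminorm_le_bound _ _ _ _ (by positivity) fun x => ?_
    set T : Rn n → ℂ := fun x => (∑ j ∈ Finset.range (J+1), φ j x) - 1 with hT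
    have e : (((∑ j ∈ Finset.range (J+1), pr h (φ j)) - h : Sch n) : Rn n → ℂ) = fun x => T x * h x := by
      ext y
      simp only [sub_apply, sum_apply, pr_apply, hT]
      rw [← Finset.mul_sum]
      ring
    rw [e]
    have hTs : ContDiff ℝ l T := (ContDiff.sum fun j _ => (φ j).smooth l).sub contDiff_const
    by_cases hx : ‖x‖ < 2^J
    · have : (fun x => T x * h x) =ᶠ[𝓝 x] fun _ => 0 := by
        have : {y : Rn n | ‖y‖ < 2^J} ∈ 𝓝 x := (isOpen_lt continuous_norm continuous_const).mem_nhds hx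
        filter_upwards [this] with y hy
        simp [hT, phi_sum hφ J y hy]
      rw [Filter.EventuallyEq.eq_of_nhds (this.iteratedFDeriv ℝ l)]
      have h0 : iteratedFDeriv ℝ l (fun _ : Rn n => (0:ℂ)) x = 0 := by
        rw [iteratedFDeriv_fun_zero]; rfl
      rw [h0, norm_zero, mul_zero]
      positivity
    · push Not at hx
      have hT1 : ∀ i ≤ l, ‖iteratedFDeriv ℝ i T x‖ ≤ (J+2) * (C i + 1) := by
        intro i hi
        have hsub : iteratedFDeriv ℝ i T x = (∑ j ∈ Finset.range (J+1), iteratedFDeriv ℝ i (φ j) x) - iteratedFDeriv ℝ i (fun _ => (1:ℂ)) x := by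
          have e1 : T = (fun x => ∑ j ∈ Finset.range (J+1), φ j x) - fun _ => (1:ℂ) := rfl
          rw [e1, iteratedFDeriv_sub_apply, iteratedFDeriv_fun_sum_apply]
          · exact fun j _ => ((φ j).smooth i).contDiffAt
          · exact (ContDiff.sum fun j _ => (φ j).smooth i).contDiffAt
          · exact contDiffAt_const
        have h1 : ‖iteratedFDeriv ℝ i (fun _ : Rn n => (1:ℂ)) x‖ ≤ 1 := by
          rcases Nat.eq_zero_or_pos i with rfl | hi
          · simp
          · rw [iteratedFDeriv_const_of_ne hi.ne']; simp
        rw [hsub]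
        refine (norm_sub_le _ _).trans ?_
        have h2 : ‖∑ j ∈ Finset.range (J+1), iteratedFDeriv ℝ i (φ j) x‖ ≤ (J+1) * C i := by
          refine (norm_sum_le_of_le _ fun j _ => hb i j x).trans ?_
          simp
        have : (0:ℝ) ≤ J := by positivity
        nlinarith [hC i]
      have h3 := norm_iteratedFDeriv_mul_le (n := l) (N := l) hTs (h.smooth l) x le_rfl
      have hk : ‖x‖^k * (1 / (1 + ‖x‖)^(k+1)) ≤ (1/2)^J := by
        have h2J : (0:ℝ) < 2^J := by positivity
        rw [one_div_pow, ← div_eq_mul_one_div, div_le_div_iff₀ (by positivity) (by positivity), one_mul, pow_succ]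
        refine mul_le_mul (pow_le_pow_left₀ (norm_nonneg _) (by linarith) _) (by linarith) (by positivity) (by positivity)
      calc ‖x‖^k * ‖iteratedFDeriv ℝ l (fun x => T x * h x) x‖
          ≤ ‖x‖^k * ∑ i ∈ Finset.range (l+1), (l.choose i : ℝ) * ((J+2) * (C i + 1)) * (D (l-i) / (1 + ‖x‖)^(k+1)) := by
            gcongr
            refine h3.trans (Finset.sum_le_sum fun i hi => ?_)
            have h4 := hT1 i (by simp at hi; omega)
            have h5 := hd (l-i) () x
            have h6 := hC i
            gcongr
        _ = A * (J+2) * (‖x‖^k * (1 / (1 + ‖x‖)^(k+1))) := by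
            rw [hA, Finset.mul_sum, Finset.sum_mul, Finset.sum_mul]
            refine Finset.sum_congr rfl fun i _ => ?_
            ring
        _ ≤ A * (J+2) * (1/2)^J := by gcongr
        _ = _ := by ring
  have hlim : Tendsto (fun J : ℕ => A * (((J:ℝ)+2) * (1/2)^J)) atTop (𝓝 0) := by
    have h1 := tendsto_self_mul_const_pow_of_lt_one (r := (1/2 : ℝ)) (by norm_num) (by norm_num)
    have h2 := (tendsto_pow_atTop_nhds_zero_of_lt_one (r := (1/2 : ℝ)) (by norm_num) (by norm_num)).const_mul 2
    have h3 := (h1.add h2).const_mul A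
    simp only [mul_zero, add_zero] at h3
    refine h3.congr fun J => ?_
    ring
  filter_upwards [hlim.eventually (gt_mem_nhds hε)] with J hJ
  exact (key J).trans_lt hJ
def c2 (n : ℕ) : ℝ := (2 * π) ^ (-(n : ℝ) / 2)
lemma c2_pos (n : ℕ) : 0 < c2 n := by unfold c2; positivity
lemma mOp_eq (ψ : Sch n) (f : TDist n E) (x : Rn n) : mOp ψ f x = c2 n • f.toFun (shiftReflect (𝓕⁻ ψ) x) := rfl
lemma mOp_PG (ψ : Sch n) (f : TDist n E) : PG (mOp ψ f) := by
  obtain ⟨h1, C, N, hC, h⟩ := td_PG f (𝓕⁻ ψ)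
  refine ⟨h1.const_smul (c2 n), c2 n * C, N, mul_nonneg (c2_pos n).le hC, fun y => ?_⟩
  rw [mOp_eq, norm_smul, Real.norm_of_nonneg (c2_pos n).le, mul_assoc]
  exact mul_le_mul_of_nonneg_left (h y) (c2_pos n).le
lemma mOp_pair [CompleteSpace E] (ψ : Sch n) (f : TDist n E) (g : Sch n) :
    (c2 n)⁻¹ • ∫ y, g y • mOp ψ f y = f.toFun (𝓕 (pr (𝓕⁻ g) ψ)) := by
  have := comm_lemma f g (𝓕⁻ ψ)
  rw [refl_inv, cv_eq, FourierTransform.fourierInv_fourier_eq] at this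
  rw [← this, ← integral_smul]
  refine integral_congr_ae (ae_of_all _ fun y => ?_)
  simp only [mOp_eq]
  rw [smul_comm (g y), smul_smul, inv_mul_cancel₀ (c2_pos n).ne', one_smul]
lemma td_sum [CompleteSpace E] {φ : ℕ → Sch n} (hφ : SmoothResolution n φ) (f : TDist n E) (g : Sch n) :
    Tendsto (fun J => ∑ j ∈ Finset.range J, (c2 n)⁻¹ • ∫ y, g y • mOp (φ j) f y) atTop (𝓝 (f.toFun g)) := by
  have h1 := S_tendsto hφ (𝓕⁻ g)
  have h2 := td_tendsto f (((FourierTransform.fourierCLM ℂ (Sch n)).continuous.tendsto (𝓕⁻ g)).comp h1)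
  simp only [FourierTransform.fourierCLM_apply, FourierTransform.fourier_fourierInv_eq] at h2
  refine h2.congr fun J => ?_
  simp only [Function.comp_apply, map_sum, mOp_pair, FourierTransform.fourierCLM_apply]
def vv (φ : ℕ → Sch n) (f : TDist n E) (j : ℕ) (x : Rn n) : E := mOp (φ j) f (((2:ℝ)^j)⁻¹ • x)
lemma vv_PG (φ : ℕ → Sch n) (f : TDist n E) (j : ℕ) : PG (vv φ f j) := by
  obtain ⟨h1, C, N, hC, h⟩ := mOp_PG (φ j) f
  refine ⟨h1.comp (by fun_prop), C, N, hC, fun y => (h _).trans ?_⟩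
  gcongr
  rw [norm_smul, norm_inv, norm_pow, Real.norm_ofNat]
  exact mul_le_of_le_one_left (norm_nonneg _) (inv_le_one_of_one_le₀ (one_le_pow₀ (by norm_num)))
lemma exists_chi (n : ℕ) : ∃ χ : Sch n, ∀ x : Rn n, ‖x‖ ≤ 2 → χ x = 1 := by
  let b1 : ContDiffBump (0 : Rn n) := ⟨2, 3, by norm_num, by norm_num⟩
  have hc : HasCompactSupport fun x => ((b1 x : ℝ) : ℂ) :=
    b1.hasCompactSupport.comp_left (g := fun t : ℝ => (t : ℂ)) (by simp)
  have hs : ContDiff ℝ ((⊤:ℕ∞) : WithTop ℕ∞) fun x => ((b1 x : ℝ) : ℂ) :=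
    Complex.ofRealCLM.contDiff.comp b1.contDiff
  refine ⟨hc.toSchwartzMap hs, fun x hx => ?_⟩
  have : b1 x = 1 := b1.one_of_mem_closedBall (by simpa using hx)
  simp [this]
lemma vv_repr [CompleteSpace E] {φ : ℕ → Sch n} (hφ : SmoothResolution n φ) {χ : Sch n} (hχ : ∀ x : Rn n, ‖x‖ ≤ 2 → χ x = 1)
    (f : TDist n E) (j : ℕ) (x : Rn n) : vv φ f j x = GG (𝓕⁻ χ) (vv φ f j) x := by
  have h2 : (0:ℝ) < 2^j := by positivity
  set χj := dilate χ ((2:ℝ)^j)⁻¹ with hχj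
  have hd : dilate χj (2^j) = χ := by
    ext y
    rw [dilate_apply _ _ h2.ne', hχj, dilate_apply _ _ (inv_ne_zero h2.ne'), inv_smul_smul₀ h2.ne']
  have hp : pr χj (φ j) = φ j := by
    ext y
    rw [pr_apply]
    by_cases hy : φ j y = 0
    · simp [hy]
    · have := (Th_supp hφ j (((2:ℝ)^j)⁻¹ • y) (by rwa [Th_apply, smul_inv_smul₀ h2.ne'])).1
      rw [hχj, dilate_apply _ _ (inv_ne_zero h2.ne'), hχ _ this, one_mul]
  have hcv : cv (𝓕⁻ χj) (𝓕⁻ (φ j)) = 𝓕⁻ (φ j) := by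
    rw [cv_eq', FourierTransform.fourier_fourierInv_eq, FourierTransform.fourier_fourierInv_eq, hp]
  have key : ∀ x, mOp (φ j) f x = ∫ y, (𝓕⁻ χj) (x - y) • mOp (φ j) f y := by
    intro x
    have h3 : cv (shiftReflect (𝓕⁻ χj) x) (shiftReflect (𝓕⁻ (φ j)) 0) = shiftReflect (𝓕⁻ (φ j)) x := by
      ext z
      have h7 : (𝓕⁻ (φ j)) (x - z) = (cv (𝓕⁻ χj) (𝓕⁻ (φ j))) (x - z) := by rw [hcv]
      rw [shiftReflect_apply, h7, cv_apply, cv_apply]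
      refine Eq.trans ?_ (integral_sub_left_eq_self _ volume x)
      refine integral_congr_ae (ae_of_all _ fun y => ?_)
      simp only [shiftReflect_apply]
      congr 2
      abel
    have h4 := comm_lemma f (shiftReflect (𝓕⁻ χj) x) (𝓕⁻ (φ j))
    rw [h3] at h4
    rw [mOp_eq, ← h4, ← integral_smul]
    refine integral_congr_ae (ae_of_all _ fun y => ?_)
    simp only [mOp_eq, shiftReflect_apply]
    rw [smul_comm]
  rw [vv, key, GG]
  have h5 := Measure.integral_comp_smul (volume : Measure (Rn n)) (fun y => (𝓕⁻ χ) (x - y) • vv φ f j y) ((2:ℝ)^j)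
  have h6 : ∀ y, (𝓕⁻ χj) (((2:ℝ)^j)⁻¹ • x - y) • mOp (φ j) f y =
      ((2:ℝ)^j)^n • ((𝓕⁻ χ) (x - (2:ℝ)^j • y) • vv φ f j ((2:ℝ)^j • y)) := by
    intro y
    rw [iF_scale χj j, hd, smul_sub, smul_inv_smul₀ h2.ne', vv, inv_smul_smul₀ h2.ne', smul_assoc]
  simp_rw [h6]
  rw [integral_smul, h5, finrank_euclideanSpace, Fintype.card_fin, smul_smul,
    abs_of_pos (by positivity), mul_inv_cancel₀ (by positivity), one_smul]
def WW (z : Rn n) : ℝ≥0∞ := ENNReal.ofReal (1 / (1 + ‖z‖))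
lemma WW_le_one (z : Rn n) : WW z ≤ 1 := by
  unfold WW
  rw [ENNReal.ofReal_le_one, div_le_one (by positivity)]
  linarith [norm_nonneg z]
lemma WW_zero : WW (0 : Rn n) = 1 := by simp [WW]
lemma WW_mul (x y z : Rn n) : WW (x - z) * WW (z - y) ≤ WW (x - y) := by
  unfold WW
  rw [← ENNReal.ofReal_mul (by positivity)]
  refine ENNReal.ofReal_le_ofReal ?_
  rw [div_mul_div_comm, one_mul]
  refine one_div_le_one_div_of_le (by positivity) ?_
  have : ‖x - y‖ ≤ ‖x - z‖ + ‖z - y‖ := norm_sub_le_norm_sub_add_norm_sub x z y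
  nlinarith [mul_nonneg (norm_nonneg (x - z)) (norm_nonneg (z - y))]
lemma WW_meas (x : Rn n) : Measurable fun y => WW (x - y) := by
  unfold WW
  fun_prop
lemma absorb2 {P c I : ℝ≥0∞} {r : ℝ} (hr : 0 < r) (hr1 : r ≤ 1) (hP : P ≠ ∞) (h : P ≤ c * (P^(1-r) * I)) :
    P^r ≤ c * I := by
  rcases eq_or_ne P 0 with rfl | h0
  · simp [hr]
  have e : P = P^(1-r) * P^r := by
    rw [← ENNReal.rpow_add _ _ h0 hP]; simp
  have h1 : P^(1-r) * P^r ≤ P^(1-r) * (c * I) := by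
    rw [← e]; exact h.trans_eq (by ring)
  exact (ENNReal.mul_le_mul_iff_right (by simp [h0, hP]) (ENNReal.rpow_ne_top_of_nonneg (by linarith) hP)).1 h1
lemma peetre {r : ℝ} (hr : 0 < r) (hr1 : r ≤ 1) (N : ℕ) (A : ℕ → ℝ≥0∞) (hA0 : ∀ M, A M ≠ 0) (hA : ∀ M, A M ≠ ∞)
    (h : Rn n → ℝ≥0∞) (hm : Measurable h)
    (hyp : ∀ M x, h x ≤ A M * ∫⁻ y, WW (x - y)^M * h y)
    (fin : ∃ M, N ≤ M ∧ ∀ x, ⨆ y, WW (x - y)^M * h y ≠ ∞) (x : Rn n) :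
    ∫⁻ y, WW (x - y)^N * h y ≤ (A N)^((1-r)/r) * (∫⁻ y, (WW (x - y)^N * h y)^r)^(1/r) := by
  set P : ℕ → Rn n → ℝ≥0∞ := fun M x => ⨆ y, WW (x - y)^M * h y with hP
  set I : ℕ → Rn n → ℝ≥0∞ := fun M x => ∫⁻ y, (WW (x - y)^M * h y)^r with hI
  have hmeas : ∀ (M : ℕ) x, Measurable fun y => WW (x - y)^M * h y := fun M x => ((WW_meas x).pow_const M).mul hm
  have hB : ∀ M x, ∫⁻ y, WW (x - y)^M * h y ≤ P M x ^ (1-r) * I M x := by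
    intro M x
    rw [hI]
    simp only
    rw [← lintegral_const_mul _ ((hmeas M x).pow_const r)]
    refine lintegral_mono fun y => ?_
    calc WW (x - y)^M * h y = (WW (x - y)^M * h y)^(1-r) * (WW (x - y)^M * h y)^r := by
          rw [← ENNReal.rpow_add_of_nonneg _ _ (by linarith) hr.le]; simp
      _ ≤ _ := by
          gcongr
          exact le_iSup (fun y => WW (x - y)^M * h y) y
  have hC : ∀ M x z, WW (x - z)^M * ∫⁻ y, WW (z - y)^M * h y ≤ ∫⁻ y, WW (x - y)^M * h y := by
    intro M x z
    rw [← lintegral_const_mul _ (hmeas M z)]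
    refine lintegral_mono fun y => ?_
    rw [← mul_assoc, ← mul_pow]
    gcongr
    exact WW_mul x y z
  have hPP : ∀ M x, P M x ≤ A M * (P M x ^ (1-r) * I M x) := by
    intro M x
    refine iSup_le fun z => ?_
    calc WW (x - z)^M * h z ≤ WW (x - z)^M * (A M * ∫⁻ y, WW (z - y)^M * h y) := by gcongr; exact hyp M z
      _ = A M * (WW (x - z)^M * ∫⁻ y, WW (z - y)^M * h y) := by ring
      _ ≤ _ := mul_le_mul' le_rfl ((hC M x z).trans (hB M x))
  obtain ⟨M, hMN, hfin⟩ := fin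
  have h1 : ∀ y, (h y)^r ≤ A M * I N y := by
    intro y
    calc (h y)^r ≤ (P M y)^r := by
          gcongr
          refine le_trans ?_ (le_iSup (fun z => WW (y - z)^M * h z) y)
          simp [WW_zero]
      _ ≤ A M * I M y := absorb2 hr hr1 (hfin y) (hPP M y)
      _ ≤ _ := by
          gcongr
          refine lintegral_mono fun z => ?_
          refine ENNReal.rpow_le_rpow (mul_le_mul' ?_ le_rfl) hr.le
          exact pow_le_pow_of_le_one zero_le (WW_le_one _) hMN
  have h2 : (P N x)^r ≤ A M * I N x := by
    have : (P N x)^r = ⨆ y, (WW (x - y)^N * h y)^r := by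
      exact (ENNReal.orderIsoRpow r hr).map_iSup _
    rw [this]
    refine iSup_le fun y => ?_
    rw [ENNReal.mul_rpow_of_nonneg _ _ hr.le]
    calc _ ≤ (WW (x - y)^N)^r * (A M * I N y) := by gcongr; exact h1 y
      _ = A M * ((WW (x - y)^N)^r * I N y) := by ring
      _ ≤ _ := by
          gcongr
          rw [hI]
          simp only
          rw [← lintegral_const_mul _ ((hmeas N y).pow_const r)]
          refine lintegral_mono fun z => ?_
          rw [← ENNReal.mul_rpow_of_nonneg _ _ hr.le, ← mul_assoc, ← mul_pow]
          gcongr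
          exact WW_mul x z y
  rcases eq_or_ne (I N x) ∞ with hi | hi
  · change _ ≤ _ * (I N x)^(1/r)
    rw [hi, ENNReal.top_rpow_of_pos (by positivity), ENNReal.mul_top]
    · exact le_top
    · simp only [ne_eq, ENNReal.rpow_eq_zero_iff, not_or, not_and]
      exact ⟨fun h => absurd h (hA0 N), fun h => absurd h (hA N)⟩
  have h3 : P N x ≠ ∞ := by
    intro h
    rw [h, ENNReal.top_rpow_of_pos hr, top_le_iff] at h2
    exact ENNReal.mul_ne_top (hA M) hi h2
  have h4 := absorb2 hr hr1 h3 (hPP N x)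
  have h5 : (P N x)^(1-r) ≤ (A N * I N x)^((1-r)/r) := by
    calc (P N x)^(1-r) = ((P N x)^r)^((1-r)/r) := by
          rw [← ENNReal.rpow_mul]; congr 1; field_simp
      _ ≤ _ := ENNReal.rpow_le_rpow h4 (div_nonneg (by linarith) hr.le)
  refine (hB N x).trans ?_
  calc P N x ^ (1-r) * I N x ≤ (A N * I N x)^((1-r)/r) * I N x := by gcongr
    _ = (A N)^((1-r)/r) * ((I N x)^((1-r)/r) * (I N x)^(1:ℝ)) := by
        rw [ENNReal.mul_rpow_of_nonneg _ _ (div_nonneg (by linarith) hr.le), ENNReal.rpow_one, mul_assoc]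
    _ = _ := by
        rw [← ENNReal.rpow_add_of_nonneg _ _ (div_nonneg (by linarith) hr.le) zero_le_one]
        congr 2
        field_simp
        ring
lemma GG_le (H : Sch n) (M : ℕ) : ∃ C : ℝ, 0 < C ∧ ∀ (u : Rn n → E) (x : Rn n),
    ‖GG H u x‖ₑ ≤ ENNReal.ofReal C * ∫⁻ y, WW (x - y)^M * ‖u y‖ₑ := by
  obtain ⟨C, hC, h⟩ := sch_decay H M
  refine ⟨C, hC, fun u x => (enorm_integral_le_lintegral_enorm _).trans ?_⟩
  rw [← lintegral_const_mul' _ _ ENNReal.ofReal_ne_top]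
  refine lintegral_mono fun y => ?_
  rw [enorm_smul, ← mul_assoc]
  gcongr
  rw [WW, ← ENNReal.ofReal_pow (by positivity), ← ENNReal.ofReal_mul hC.le, ← ofReal_norm]
  refine ENNReal.ofReal_le_ofReal ((h _).trans_eq ?_)
  rw [one_div_pow]; ring
lemma peetre_LD [CompleteSpace E] (κ : Sch n) {r : ℝ} (hr : 0 < r) (hr1 : r ≤ 1) (l : List (Fin n)) :
    ∃ C : ℝ≥0∞, C ≠ ∞ ∧ ∀ v : Rn n → E, PG v → (∀ x, v x = GG κ v x) → ∀ x,
      ‖LD l v x‖ₑ^r ≤ C * Tk 0 (fun y => ‖v y‖ₑ^r) x := by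
  choose A hA hAb using fun M => GG_le (E := E) κ M
  obtain ⟨N, hN⟩ := exists_nat_ge (((n:ℝ)+1)/r)
  obtain ⟨D, hD, hDb⟩ := GG_le (E := E) (LDS l κ) N
  refine ⟨(ENNReal.ofReal D * (ENNReal.ofReal (A N))^((1-r)/r))^r, ?_, fun v hv hvv x => ?_⟩
  · refine ENNReal.rpow_ne_top_of_nonneg hr.le (ENNReal.mul_ne_top ENNReal.ofReal_ne_top ?_)
    exact ENNReal.rpow_ne_top_of_nonneg (div_nonneg (by linarith) hr.le) ENNReal.ofReal_ne_top
  have hve : v = GG κ v := funext hvv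
  have hm : Measurable fun y => ‖v y‖ₑ := hv.1.enorm.measurable
  have h1 := peetre hr hr1 N (fun M => ENNReal.ofReal (A M)) (fun M => by simpa using hA M)
    (fun M => ENNReal.ofReal_ne_top) (fun y => ‖v y‖ₑ) hm (fun M x => by
      conv_lhs => rw [hvv x]
      exact hAb M v x) (by
      obtain ⟨-, C, L, hC, h⟩ := hv
      refine ⟨max N L, le_max_left _ _, fun x => ?_⟩
      refine ne_top_of_le_ne_top (ENNReal.ofReal_ne_top (r := C * (1 + ‖x‖)^L)) (iSup_le fun y => ?_)
      calc WW (x - y)^(max N L) * ‖v y‖ₑ ≤ WW (x - y)^L * ‖v y‖ₑ := by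
            gcongr ?_ * _
            exact pow_le_pow_of_le_one zero_le (WW_le_one _) (le_max_right _ _)
        _ ≤ _ := by
            rw [WW, ← ENNReal.ofReal_pow (by positivity), ← ofReal_norm,
              ← ENNReal.ofReal_mul (by positivity)]
            refine ENNReal.ofReal_le_ofReal ?_
            rw [one_div_pow, one_div_mul_eq_div, div_le_iff₀ (by positivity), mul_assoc, ← mul_pow]
            refine (h y).trans ?_
            gcongr
            exact one_add_sub_le x y) x
  have h2 : ‖LD l v x‖ₑ ≤ ENNReal.ofReal D * ∫⁻ y, WW (x - y)^N * ‖v y‖ₑ := by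
    conv_lhs => rw [hve]
    rw [LD_GG _ hv]
    exact hDb v x
  calc ‖LD l v x‖ₑ^r ≤ (ENNReal.ofReal D * (ENNReal.ofReal (A N)^((1-r)/r) * (∫⁻ y, (WW (x - y)^N * ‖v y‖ₑ)^r)^(1/r)))^r := by
        gcongr
        exact h2.trans (by gcongr)
    _ = (ENNReal.ofReal D * (ENNReal.ofReal (A N))^((1-r)/r))^r * ∫⁻ y, (WW (x - y)^N * ‖v y‖ₑ)^r := by
        rw [← mul_assoc, ENNReal.mul_rpow_of_nonneg (ENNReal.ofReal D * _) _ hr.le, ← ENNReal.rpow_mul _ (1/r), one_div_mul_cancel hr.ne', ENNReal.rpow_one]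
    _ ≤ _ := by
        gcongr
        refine lintegral_mono fun y => ?_
        rw [ENNReal.mul_rpow_of_nonneg _ _ hr.le]
        gcongr
        rw [ker, WW, ← ENNReal.ofReal_pow (by positivity), ENNReal.ofReal_rpow_of_nonneg (by positivity) hr.le]
        refine ENNReal.ofReal_le_ofReal ?_
        simp only [pow_zero, one_pow, one_mul]
        rw [one_div_pow, Real.div_rpow zero_le_one (by positivity), Real.one_rpow]
        refine one_div_le_one_div_of_le (by positivity) ?_
        rw [← Real.rpow_natCast, ← Real.rpow_natCast, ← Real.rpow_mul (by positivity)]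
        refine Real.rpow_le_rpow_of_exponent_le (by linarith [norm_nonneg (x - y)]) ?_
        rw [div_le_iff₀ hr] at hN
        push_cast
        exact hN
lemma ker_gen (i k : ℕ) (x x' y : Rn n) (D : ℝ) (hD : 0 < D) (h : 1 + 2^k * ‖x' - y‖ ≤ D * (1 + 2^i * ‖x - y‖)) :
    ker i (x - y) ≤ ENNReal.ofReal ((2^i)^n * D^(n+1) / (2^k)^n) * ker k (x' - y) := by
  rw [ker, ker, ← ENNReal.ofReal_mul (by positivity)]
  refine ENNReal.ofReal_le_ofReal ?_
  rw [div_mul_div_comm, mul_comm ((2^i)^n * D^(n+1)), mul_div_mul_left _ _ (by positivity),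
    div_le_div_iff₀ (by positivity) (by positivity), mul_assoc, ← mul_pow]
  gcongr
lemma Tk_near (j : ℕ) (h : Rn n → ℝ≥0∞) {x x' : Rn n} {c : ℝ} (hc : 2^j * ‖x - x'‖ ≤ c) :
    Tk j h x ≤ ENNReal.ofReal ((1+c)^(n+1)) * Tk j h x' := by
  have hc0 : 0 ≤ c := le_trans (by positivity) hc
  rw [Tk, Tk, ← lintegral_const_mul' _ _ ENNReal.ofReal_ne_top]
  refine lintegral_mono fun y => ?_
  rw [← mul_assoc]
  gcongr
  refine (ker_gen j j x x' y (1+c) (by positivity) ?_).trans_eq ?_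
  · have h1 : ‖x' - y‖ ≤ ‖x - x'‖ + ‖x - y‖ := by
      rw [norm_sub_rev x x']; exact norm_sub_le_norm_sub_add_norm_sub x' x y
    have h2 : (2:ℝ)^j * ‖x' - y‖ ≤ c + 2^j * ‖x - y‖ := by
      calc _ ≤ (2:ℝ)^j * (‖x - x'‖ + ‖x - y‖) := by gcongr
        _ ≤ _ := by rw [mul_add]; gcongr
    have : 0 ≤ c * (2^j * ‖x - y‖) := by positivity
    linarith
  · rw [mul_div_cancel_left₀ _ (by positivity)]
lemma Tk_far (j : ℕ) (h : Rn n → ℝ≥0∞) (x x' : Rn n) :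
    Tk j h x ≤ ENNReal.ofReal ((2^j)^n * (1+‖x - x'‖)^(n+1)) * Tk 0 h x' := by
  rw [Tk, Tk, ← lintegral_const_mul' _ _ ENNReal.ofReal_ne_top]
  refine lintegral_mono fun y => ?_
  rw [← mul_assoc]
  gcongr
  refine (ker_gen j 0 x x' y (1+‖x - x'‖) (by positivity) ?_).trans_eq ?_
  · have h1 : ‖x' - y‖ ≤ ‖x - x'‖ + ‖x - y‖ := by
      rw [norm_sub_rev x x']; exact norm_sub_le_norm_sub_add_norm_sub x' x y
    have h2 : ‖x - y‖ ≤ 2^j * ‖x - y‖ := le_mul_of_one_le_left (norm_nonneg _) (one_le_pow₀ (by norm_num))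
    have : 0 ≤ ‖x - x'‖ * (2^j * ‖x - y‖) := by positivity
    simp only [pow_zero, one_mul]
    linarith
  · simp
lemma Tk_scale (j : ℕ) {h : Rn n → ℝ≥0∞} (hm : Measurable h) (x : Rn n) :
    Tk 0 (fun y => h (((2:ℝ)^j)⁻¹ • y)) ((2:ℝ)^j • x) = Tk j h x := by
  have h0 : (0:ℝ) < 2^j := by positivity
  have hk := meas_ker (n := n) 0
  have h1 := lintegral_map (μ := (volume : Measure (Rn n))) (f := fun z => ker 0 ((2:ℝ)^j • (x - z)) * h z)
    (g := fun y : Rn n => ((2:ℝ)^j)⁻¹ • y) (by fun_prop) (by fun_prop)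
  rw [Measure.map_addHaar_smul _ (inv_ne_zero h0.ne'), lintegral_smul_measure] at h1
  rw [Tk, Tk]
  calc _ = ∫⁻ y, ker 0 ((2:ℝ)^j • (x - ((2:ℝ)^j)⁻¹ • y)) * h (((2:ℝ)^j)⁻¹ • y) := by
        congr with y
        rw [smul_sub, smul_inv_smul₀ h0.ne']
    _ = _ := by
        rw [← h1, smul_eq_mul, ← lintegral_const_mul' _ _ ENNReal.ofReal_ne_top]
        congr with y
        rw [← mul_assoc, ker, ker, ← ENNReal.ofReal_mul (by positivity), norm_smul, norm_pow, Real.norm_ofNat]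
        congr 2
        rw [abs_of_pos (by positivity), finrank_euclideanSpace_fin, inv_pow, inv_inv]
        simp [div_eq_mul_inv]
lemma peetre_j [CompleteSpace E] {φ : ℕ → Sch n} (hφ : SmoothResolution n φ) {r : ℝ} (hr : 0 < r) (hr1 : r ≤ 1) (K : ℕ) :
    ∃ C : ℝ≥0∞, C ≠ ∞ ∧ ∀ (f : TDist n E) j x α, mdeg α ≤ K → ‖mderiv α (vv φ f j) ((2:ℝ)^j • x)‖ₑ^r ≤
      C * Tk j (fun y => ‖mOp (φ j) f y‖ₑ^r) x := by
  obtain ⟨χ, hχ⟩ := exists_chi n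
  choose C hC h using fun l => peetre_LD (E := E) (𝓕⁻ χ) hr hr1 l
  refine ⟨∑ α : Fin n → Fin (K+1), C (ml fun i => α i), ENNReal.sum_ne_top.2 fun α _ => hC _, fun f j x α hα => ?_⟩
  have hle : ∀ i, α i < K + 1 := fun i => by
    have := Finset.single_le_sum (f := α) (fun i _ => Nat.zero_le _) (Finset.mem_univ i)
    have h2 : mdeg α = ∑ i, α i := rfl
    omega
  have hm : Measurable fun y => ‖mOp (φ j) f y‖ₑ^r := (mOp_PG (φ j) f).1.enorm.measurable.pow_const r
  rw [mderiv_eq, ← Tk_scale j hm]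
  refine (h (ml α) (vv φ f j) (vv_PG φ f j) (fun y => vv_repr hφ hχ f j y) _).trans ?_
  refine mul_le_mul' ?_ le_rfl
  exact Finset.single_le_sum (f := fun β : Fin n → Fin (K+1) => C (ml fun i => β i))
        (fun _ _ => zero_le) (Finset.mem_univ (fun i => (⟨α i, hle i⟩ : Fin (K+1))))
lemma vv_contDiff [CompleteSpace E] {φ : ℕ → Sch n} (hφ : SmoothResolution n φ) (f : TDist n E) (j k : ℕ) :
    ContDiff ℝ k (vv φ f j) := by
  obtain ⟨χ, hχ⟩ := exists_chi n
  rw [show vv φ f j = GG (𝓕⁻ χ) (vv φ f j) from funext fun y => vv_repr hφ hχ f j y]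
  exact GG_contDiff (vv_PG φ f j) k _
lemma atom_bd {ψ : Rn n → ℝ} {K : ℕ} (hψ : ContDiff ℝ K ψ) (hb : ∀ i ≤ K, ∃ C, ∀ y, ‖iteratedFDeriv ℝ i ψ y‖ ≤ C) :
    ∃ C : ℝ, 0 < C ∧ ∀ (v : Rn n → E), ContDiff ℝ K v → ∀ (y m : Rn n) (R : ℝ), 0 ≤ R →
      (∀ α, mdeg α ≤ K → ‖mderiv α v y‖ ≤ R) → ∀ k ≤ K,
      ‖iteratedFDeriv ℝ k (fun z => ψ (z - m) • v z) y‖ ≤ C * R := by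
  choose! c hc using hb
  refine ⟨∑ k ∈ Finset.range (K+1), (∑ i ∈ Finset.range (k+1), (k.choose i : ℝ) * |c i| * (n:ℝ)^(k-i)) + 1, by positivity, ?_⟩
  intro v hv y m R hR hvR k hk
  have h1 := norm_iteratedFDeriv_smul_le (𝕜 := ℝ) (N := K) (f := fun z => ψ (z - m)) (g := v)
    (hψ.comp (contDiff_id.sub contDiff_const)) hv y (n := k) (by exact_mod_cast hk)
  refine h1.trans ?_
  calc _ ≤ ∑ i ∈ Finset.range (k+1), (k.choose i : ℝ) * |c i| * (n:ℝ)^(k-i) * R := by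
        refine Finset.sum_le_sum fun i hi => ?_
        rw [Finset.mem_range] at hi
        rw [iteratedFDeriv_comp_sub, mul_assoc _ ((n:ℝ)^(k-i))]
        gcongr
        · exact (hc i (by omega) _).trans (le_abs_self _)
        · exact norm_iteratedFDeriv_le (hv.of_le (by norm_cast; omega)) y R (fun α hα => hvR α (by omega)) hR
    _ = (∑ i ∈ Finset.range (k+1), (k.choose i : ℝ) * |c i| * (n:ℝ)^(k-i)) * R := by rw [Finset.sum_mul]
    _ ≤ _ := by
        gcongr
        refine le_trans ?_ (le_add_of_nonneg_right zero_le_one)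
        exact Finset.single_le_sum (f := fun k => ∑ i ∈ Finset.range (k+1), (k.choose i : ℝ) * |c i| * (n:ℝ)^(k-i))
          (fun _ _ => by positivity) (Finset.mem_range.2 (by omega))
def th (ε t : ℝ) : ℝ := smoothTransition ((t + 1/2) / ε + 1/2) - smoothTransition ((t - 1/2) / ε + 1/2)
lemma th_nonneg {ε : ℝ} (hε : 0 < ε) (t : ℝ) : 0 ≤ th ε t := by
  refine sub_nonneg.2 (smoothTransition.monotone ?_)
  gcongr
  linarith
lemma th_supp {ε : ℝ} (hε : 0 < ε) {t : ℝ} (ht : th ε t ≠ 0) : |t| < (1 + ε) / 2 := by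
  by_contra h
  apply ht
  rw [not_lt, le_abs] at h
  unfold th
  rcases h with h | h
  · rw [smoothTransition.one_of_one_le, smoothTransition.one_of_one_le, sub_self]
    · have : 1/2 ≤ (t - 1/2) / ε := by rw [le_div_iff₀ hε]; linarith
      linarith
    · have : 1/2 ≤ (t + 1/2) / ε := by rw [le_div_iff₀ hε]; linarith
      linarith
  · rw [smoothTransition.zero_of_nonpos, smoothTransition.zero_of_nonpos, sub_self]
    · have : (t - 1/2) / ε ≤ -(1/2) := by rw [div_le_iff₀ hε]; linarith
      linarith
    · have : (t + 1/2) / ε ≤ -(1/2) := by rw [div_le_iff₀ hε]; linarith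
      linarith
lemma th_contDiff (ε : ℝ) : ContDiff ℝ ((⊤:ℕ∞) : WithTop ℕ∞) (th ε) := by
  unfold th
  refine ContDiff.sub (smoothTransition.contDiff.comp ?_) (smoothTransition.contDiff.comp ?_) <;> fun_prop
lemma th_sum {ε : ℝ} (hε : 0 < ε) (hε1 : ε ≤ 1) (t : ℝ) :
    ∑ m ∈ Finset.Icc (⌊t + 1/2⌋ - 1) (⌊t + 1/2⌋ + 1), th ε (t - m) = 1 := by
  set k := ⌊t + 1/2⌋ with hk
  have h1 := Int.floor_le (t + 1/2)
  have h2 := Int.lt_floor_add_one (t + 1/2)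
  rw [← hk] at h1 h2
  have e : Finset.Icc (k - 1) (k + 1) = {k - 1, k, k + 1} := by
    ext m; simp only [Finset.mem_Icc, Finset.mem_insert, Finset.mem_singleton]; omega
  rw [e, Finset.sum_insert (by simp; omega), Finset.sum_insert (by simp), Finset.sum_singleton]
  unfold th
  push_cast
  have e1 : smoothTransition ((t - ((k:ℝ) - 1) + 1/2) / ε + 1/2) = 1 := by
    apply smoothTransition.one_of_one_le
    have : 1/2 ≤ (t - ((k:ℝ) - 1) + 1/2) / ε := by rw [le_div_iff₀ hε]; linarith
    linarith
  have e2 : smoothTransition ((t - ((k:ℝ) + 1) - 1/2) / ε + 1/2) = 0 := by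
    apply smoothTransition.zero_of_nonpos
    have : (t - ((k:ℝ) + 1) - 1/2) / ε ≤ -(1/2) := by rw [div_le_iff₀ hε]; linarith
    linarith
  rw [e1, e2, show t - ((k:ℝ) - 1) - 1/2 = t - k + 1/2 by ring, show t - ((k:ℝ) + 1) + 1/2 = t - k - 1/2 by ring]
  ring
lemma exists_psi {d : ℝ} (hd : 1 < d) : ∃ ψ : Rn n → ℝ, ContDiff ℝ ((⊤:ℕ∞) : WithTop ℕ∞) ψ ∧ (∀ x, 0 ≤ ψ x) ∧
    (∀ x, ψ x ≠ 0 → ∀ i, |x i| ≤ d / 2) ∧ (∀ x, HasSum (fun m : Fin n → ℤ => ψ (x - zpt m)) 1) ∧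
    ∀ i : ℕ, ∃ C, ∀ y, ‖iteratedFDeriv ℝ i ψ y‖ ≤ C := by
  set ε := min 1 (d - 1)
  have hε : 0 < ε := lt_min one_pos (by linarith)
  have hε1 : ε ≤ 1 := min_le_left _ _
  have hεd : ε ≤ d - 1 := min_le_right _ _
  have hsm : ContDiff ℝ ((⊤:ℕ∞) : WithTop ℕ∞) fun x : Rn n => ∏ i, th ε (x i) :=
    contDiff_prod fun i _ => (th_contDiff ε).comp (by fun_prop)
  have hsupp : ∀ x : Rn n, ∏ i, th ε (x i) ≠ 0 → ∀ i, |x i| ≤ d / 2 := fun x hx i => by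
    have := th_supp hε (Finset.prod_ne_zero_iff.1 hx i (Finset.mem_univ i))
    linarith
  refine ⟨fun x => ∏ i, th ε (x i), hsm, fun x => Finset.prod_nonneg fun i _ => th_nonneg hε _, hsupp, fun x => ?_, fun i => ?_⟩
  · have : ∑ m ∈ Fintype.piFinset fun i => Finset.Icc (⌊x i + 1/2⌋ - 1) (⌊x i + 1/2⌋ + 1), ∏ i, th ε ((x - zpt m) i) = 1 := by
      have := Finset.prod_univ_sum (fun i => Finset.Icc (⌊x i + 1/2⌋ - 1) (⌊x i + 1/2⌋ + 1)) (fun i (m : ℤ) => th ε (x i - m))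
      simp only [th_sum hε hε1, Finset.prod_const_one] at this
      rw [this]
      rfl
    rw [← this]
    refine hasSum_sum_of_ne_finset_zero fun m hm => ?_
    by_contra h0
    apply hm
    rw [Fintype.mem_piFinset]
    intro i
    have h1 := th_supp hε (Finset.prod_ne_zero_iff.1 h0 i (Finset.mem_univ i))
    have h2 : |x i - m i| < 1 := lt_of_lt_of_le h1 (by linarith)
    rw [abs_lt] at h2
    rw [Finset.mem_Icc]
    have h3 := Int.floor_le (x i + 1/2)
    have h4 := Int.lt_floor_add_one (x i + 1/2)
    constructor
    · have : (⌊x i + 1/2⌋ : ℝ) < (m i : ℝ) + 2 := by linarith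
      have : ⌊x i + 1/2⌋ < m i + 2 := by exact_mod_cast this
      omega
    · have : (m i : ℝ) < (⌊x i + 1/2⌋ : ℝ) + 2 := by linarith
      have : m i < ⌊x i + 1/2⌋ + 2 := by exact_mod_cast this
      omega
  · have hc : HasCompactSupport fun x : Rn n => ∏ i, th ε (x i) := by
      refine HasCompactSupport.intro (dQ_compact hd 0 0) fun x hx => ?_
      by_contra h0
      apply hx
      intro i
      have := hsupp x h0 i
      simpa using this
    exact (hc.iteratedFDeriv i).exists_bound_of_continuous (hsm.continuous_iteratedFDeriv (by exact_mod_cast le_top))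
lemma le_lqSum {q : ℝ≥0∞} (hq : 0 < q) (a : ℕ → ℝ≥0∞) (j : ℕ) : a j ≤ lqSum q a := by
  unfold lqSum
  split_ifs with h
  · exact le_iSup a j
  · have hq1 : 0 < q.toReal := ENNReal.toReal_pos hq.ne' h
    calc a j = ((a j)^q.toReal)^(1/q.toReal) := by
          rw [← ENNReal.rpow_mul, mul_one_div_cancel hq1.ne', ENNReal.rpow_one]
      _ ≤ _ := by
          gcongr
          exact ENNReal.le_tsum (f := fun j => (a j)^q.toReal) j
def tt (r : ℝ) (φ : ℕ → Sch n) (f : TDist n E) (j : ℕ) (y : Rn n) : ℝ≥0∞ := ‖mOp (φ j) f y‖ₑ^r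
lemma tt_meas (r : ℝ) (φ : ℕ → Sch n) (f : TDist n E) (j : ℕ) : Measurable (tt r φ f j) :=
  (mOp_PG (φ j) f).1.enorm.measurable.pow_const r
def gg (s r : ℝ) (φ : ℕ → Sch n) (f : TDist n E) (j : ℕ) (y : Rn n) : ℝ≥0∞ :=
  (2:ℝ≥0∞)^((j:ℝ)*s*r) * tt r φ f j y
lemma two_ne_top (t : ℝ) : (2:ℝ≥0∞)^t ≠ ∞ := by simp
lemma two_eq (t : ℝ) : (2:ℝ≥0∞)^t = ENNReal.ofReal ((2:ℝ)^t) := by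
  rw [← ENNReal.ofReal_rpow_of_pos two_pos]; simp
lemma gg_Tk (s r : ℝ) (φ : ℕ → Sch n) (f : TDist n E) (j k : ℕ) (x : Rn n) :
    Tk k (gg s r φ f j) x = (2:ℝ≥0∞)^((j:ℝ)*s*r) * Tk k (tt r φ f j) x := by
  rw [Tk, Tk, ← lintegral_const_mul' _ _ (two_ne_top _)]
  congr with y
  rw [gg]; ring
lemma VVf {φ : ℕ → Sch n} (p q : ℝ≥0∞) (hp' : p ≠ ∞) (s : ℝ) {r δ : ℝ} (hr : 0 < r)
    (hrp : ENNReal.ofReal r < p) (hrq : ENNReal.ofReal r < q) (hδ : 0 < δ) :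
    ∃ C : ℝ≥0∞, C ≠ ∞ ∧ ∀ f : TDist n E,
      lpNormENN p (fun x => lqSum q fun j => (Aop (wt δ) (gg s r φ f) j x)^(1/r)) ≤ C * triebelNorm s p q φ f := by
  obtain ⟨W, hW, hwW⟩ := wt_sum δ hδ
  obtain ⟨C, hC, h⟩ := VV (n := n) (wt δ) (wt_symm δ) W hW hwW p q hp' r hr hrp hrq
  refine ⟨C, hC, fun f => (h _ fun v => (tt_meas r φ f v).const_mul _).trans_eq ?_⟩
  rw [triebelNorm]
  refine congrArg (C * ·) (congrArg (lpNormENN p) (funext fun x => congrArg (lqSum q) (funext fun j => ?_)))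
  simp only [tt]
  rw [ENNReal.mul_rpow_of_nonneg _ _ (by positivity), ← ENNReal.rpow_mul, ← ENNReal.rpow_mul, mul_one_div_cancel hr.ne',
    ENNReal.rpow_one, mul_assoc, mul_one_div_cancel hr.ne', mul_one]
  rfl
lemma B_fin {φ : ℕ → Sch n} (p q : ℝ≥0∞) (hp' : p ≠ ∞) (s : ℝ) {r δ : ℝ} (hr : 0 < r)
    (hrp : ENNReal.ofReal r < p) (hrq : ENNReal.ofReal r < q) (hδ : 0 < δ) (f : TDist n E)
    (hf : triebelNorm s p q φ f < ∞) :
    ∃ (x₀ : Rn n) (D : ℝ≥0∞), D ≠ ∞ ∧ ∀ j : ℕ, Tk 0 (tt r φ f j) x₀ ≤ D * (2:ℝ≥0∞)^((δ - s * r) * j) := by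
  obtain ⟨C, hC, h⟩ := VVf (E := E) (φ := φ) p q hp' s hr hrp hrq hδ
  have hp0 : 0 < p := lt_of_le_of_lt zero_le hrp
  have hq0 : 0 < q := lt_of_le_of_lt zero_le hrq
  have hp1 : 0 < p.toReal := ENNReal.toReal_pos hp0.ne' hp'
  have h1 : lpNormENN p (fun x => (Aop (wt δ) (gg s r φ f) 0 x)^(1/r)) < ∞ := by
    refine lt_of_le_of_lt ((lpNorm_mono p fun x => ?_).trans (h f)) (ENNReal.mul_lt_top hC.lt_top hf)
    exact le_lqSum hq0 (fun j => (Aop (wt δ) (gg s r φ f) j x)^(1/r)) 0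
  rw [lpNormENN, if_neg hp', ENNReal.rpow_lt_top_iff_of_pos (by positivity)] at h1
  have hm : Measurable (Aop (wt δ) (gg s r φ f) 0) := meas_Aop _ (fun v => (tt_meas r φ f v).const_mul _) 0
  obtain ⟨x₀, hx₀⟩ := (ae_lt_top ((hm.pow_const (1/r)).pow_const p.toReal) h1.ne).exists
  rw [ENNReal.rpow_lt_top_iff_of_pos hp1, ENNReal.rpow_lt_top_iff_of_pos (by positivity)] at hx₀
  refine ⟨x₀, _, hx₀.ne, fun j => ?_⟩
  have h2 : wt δ 0 j * Tk (min 0 j) (gg s r φ f j) x₀ ≤ Aop (wt δ) (gg s r φ f) 0 x₀ :=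
    ENNReal.le_tsum (f := fun j => wt δ 0 j * Tk (min 0 j) (gg s r φ f j) x₀) j
  rw [Nat.zero_min, gg_Tk, wt, ← two_eq, ← mul_assoc, ← ENNReal.rpow_add _ _ two_ne_zero ENNReal.ofNat_ne_top] at h2
  calc Tk 0 (tt r φ f j) x₀ = (2:ℝ≥0∞)^((-δ * |((0:ℕ):ℝ) - j| + j * s * r) + (δ - s * r) * j) * Tk 0 (tt r φ f j) x₀ := by
        rw [show (-δ * |((0:ℕ):ℝ) - j| + j * s * r) + (δ - s * r) * j = 0 by
          rw [Nat.cast_zero, zero_sub, abs_neg, Nat.abs_cast]; ring]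
        simp
    _ ≤ _ := by
        rw [ENNReal.rpow_add _ _ two_ne_zero ENNReal.ofNat_ne_top, mul_right_comm]
        gcongr
lemma B_sum [CompleteSpace E] {φ : ℕ → Sch n} (hφ : SmoothResolution n φ) {s : ℝ} {r δ : ℝ} (hr : 0 < r) (hr1 : r ≤ 1)
    (hδ2 : δ < (s + n) * r - n) (f : TDist n E) (x₀ : Rn n) (D : ℝ≥0∞) (hD : D ≠ ∞)
    (h : ∀ j : ℕ, Tk 0 (tt r φ f j) x₀ ≤ D * (2:ℝ≥0∞)^((δ - s * r) * j)) (g : Sch n) :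
    ∑' j, ∫⁻ x, ‖g x‖ₑ * ‖mOp (φ j) f x‖ₑ ≠ ∞ := by
  obtain ⟨C, hC, hP⟩ := peetre_j (E := E) hφ hr hr1 0
  set β := (1 - r) / r with hβ
  have hβ0 : 0 ≤ β := div_nonneg (by linarith) hr.le
  obtain ⟨M, hM⟩ := exists_nat_ge (((n:ℝ)+1) * β)
  obtain ⟨c, hc, hg⟩ := sch_decay g (M + (n + 1))
  set c' := c * (1 + ‖x₀‖)^(M + (n+1)) with hc'
  have hgk : ∀ x, ‖g x‖ₑ * (ENNReal.ofReal ((1 + ‖x - x₀‖)^(n+1)))^β ≤ ENNReal.ofReal c' * ker 0 (x₀ - x) := by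
    intro x
    rw [ker, ENNReal.ofReal_rpow_of_nonneg (by positivity) hβ0, ← ofReal_norm, ← ENNReal.ofReal_mul (by positivity),
      ← ENNReal.ofReal_mul (by positivity)]
    refine ENNReal.ofReal_le_ofReal ?_
    have h1 : ((1 + ‖x - x₀‖)^(n+1))^β ≤ (1 + ‖x - x₀‖)^M := by
      rw [← Real.rpow_natCast (1 + ‖x - x₀‖) (n+1), ← Real.rpow_natCast (1 + ‖x - x₀‖) M, ← Real.rpow_mul (by positivity)]
      refine Real.rpow_le_rpow_of_exponent_le (by linarith [norm_nonneg (x - x₀)]) ?_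
      push_cast; exact hM
    have h2 : 1 + ‖x - x₀‖ ≤ (1 + ‖x₀‖) * (1 + ‖x‖) := by
      have := norm_sub_le x x₀
      nlinarith [mul_nonneg (norm_nonneg x) (norm_nonneg x₀)]
    have e : (1:ℝ) + 2^0 * ‖x₀ - x‖ = 1 + ‖x - x₀‖ := by rw [norm_sub_rev]; ring
    rw [e, pow_zero, one_pow, mul_one_div, le_div_iff₀ (by positivity)]
    calc _ ≤ c / (1 + ‖x‖)^(M + (n+1)) * (1 + ‖x - x₀‖)^M * (1 + ‖x - x₀‖)^(n+1) := by
          gcongr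
          exact hg x
      _ = c / (1 + ‖x‖)^(M + (n+1)) * (1 + ‖x - x₀‖)^(M + (n+1)) := by rw [pow_add (1 + ‖x - x₀‖)]; ring
      _ ≤ c / (1 + ‖x‖)^(M + (n+1)) * ((1 + ‖x₀‖) * (1 + ‖x‖))^(M + (n+1)) := by gcongr
      _ = c' := by rw [hc', mul_pow]; field_simp
  have hone : ∀ j, ∫⁻ x, ‖g x‖ₑ * ‖mOp (φ j) f x‖ₑ ≤
      ENNReal.ofReal c' * ((C * (2:ℝ≥0∞)^((n:ℝ)*j) * Tk 0 (tt r φ f j) x₀)^β * Tk 0 (tt r φ f j) x₀) := by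
    intro j
    set B := Tk 0 (tt r φ f j) x₀ with hB
    have hBt : B ≠ ∞ := ne_top_of_le_ne_top (ENNReal.mul_ne_top hD (two_ne_top _)) (h j)
    have hQ : (C * (2:ℝ≥0∞)^((n:ℝ)*j) * B)^β ≠ ∞ :=
      ENNReal.rpow_ne_top_of_nonneg hβ0 (ENNReal.mul_ne_top (ENNReal.mul_ne_top hC (two_ne_top _)) hBt)
    calc _ ≤ ∫⁻ x, (ENNReal.ofReal c' * (C * (2:ℝ≥0∞)^((n:ℝ)*j) * B)^β) * (ker 0 (x₀ - x) * tt r φ f j x) := by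
          refine lintegral_mono fun x => ?_
          have h1 : tt r φ f j x ≤ (C * (2:ℝ≥0∞)^((n:ℝ)*j) * B) * ENNReal.ofReal ((1 + ‖x - x₀‖)^(n+1)) := by
            have h3 := (hP f j x 0 (by simp [mdeg])).trans (mul_le_mul' le_rfl (Tk_far j (tt r φ f j) x x₀))
            have h0 : ml (0 : Fin n → ℕ) = [] := List.length_eq_zero_iff.1 (by rw [ml_length]; simp [mdeg])
            rw [mderiv_eq, h0] at h3
            have e1 : LD [] (vv φ f j) ((2:ℝ)^j • x) = mOp (φ j) f x := by
              change vv φ f j ((2:ℝ)^j • x) = _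
              rw [vv, inv_smul_smul₀ (by positivity)]
            rw [e1] at h3
            refine h3.trans_eq ?_
            rw [ENNReal.ofReal_mul (by positivity), two_eq, ← hB, mul_comm (n:ℝ), Real.rpow_mul (by norm_num), Real.rpow_natCast, Real.rpow_natCast]
            ring
          have h2 : ‖mOp (φ j) f x‖ₑ = tt r φ f j x * (tt r φ f j x)^β := by
            rw [tt, ← ENNReal.rpow_mul, ← ENNReal.rpow_add_of_nonneg _ _ hr.le (mul_nonneg hr.le hβ0), hβ, mul_div_cancel₀ _ hr.ne']
            simp
          rw [h2]
          calc _ ≤ ‖g x‖ₑ * (tt r φ f j x * ((C * (2:ℝ≥0∞)^((n:ℝ)*j) * B) * ENNReal.ofReal ((1 + ‖x - x₀‖)^(n+1)))^β) := by gcongr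
            _ = (‖g x‖ₑ * (ENNReal.ofReal ((1 + ‖x - x₀‖)^(n+1)))^β) * ((C * (2:ℝ≥0∞)^((n:ℝ)*j) * B)^β * tt r φ f j x) := by
                rw [ENNReal.mul_rpow_of_nonneg _ _ hβ0]; ring
            _ ≤ (ENNReal.ofReal c' * ker 0 (x₀ - x)) * ((C * (2:ℝ≥0∞)^((n:ℝ)*j) * B)^β * tt r φ f j x) := by
                gcongr ?_ * _
                exact hgk x
            _ = _ := by ring
      _ = _ := by
          rw [lintegral_const_mul' _ _ (ENNReal.mul_ne_top ENNReal.ofReal_ne_top hQ), mul_assoc]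
          rfl
  set ρ : ℝ≥0∞ := (2:ℝ≥0∞)^(((n:ℝ) + (δ - s * r)) * β + (δ - s * r)) with hρ
  have hρ1 : ρ < 1 := by
    refine ENNReal.rpow_lt_one_of_one_lt_of_neg (by norm_num) ?_
    rw [hβ]
    have : ((n:ℝ) + (δ - s * r)) * ((1 - r) / r) + (δ - s * r) = (δ - ((s + n) * r - n)) / r := by field_simp; ring
    rw [this]
    exact div_neg_of_neg_of_pos (by linarith) hr
  have htwo : ∀ j, ∫⁻ x, ‖g x‖ₑ * ‖mOp (φ j) f x‖ₑ ≤ (ENNReal.ofReal c' * ((C * D)^β * D)) * ρ^j := by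
    intro j
    refine (hone j).trans ?_
    rw [mul_assoc (ENNReal.ofReal c')]
    refine mul_le_mul' le_rfl ?_
    calc _ ≤ (C * (2:ℝ≥0∞)^((n:ℝ)*j) * (D * (2:ℝ≥0∞)^((δ - s * r) * j)))^β * (D * (2:ℝ≥0∞)^((δ - s * r) * j)) := by
          gcongr <;> exact h j
      _ = ((C * D)^β * D) * ((2:ℝ≥0∞)^((n:ℝ)*j) * (2:ℝ≥0∞)^((δ - s * r) * j))^β * (2:ℝ≥0∞)^((δ - s * r) * j) := by
          rw [show C * (2:ℝ≥0∞)^((n:ℝ)*j) * (D * (2:ℝ≥0∞)^((δ - s * r) * j)) =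
            (C * D) * ((2:ℝ≥0∞)^((n:ℝ)*j) * (2:ℝ≥0∞)^((δ - s * r) * j)) by ring, ENNReal.mul_rpow_of_nonneg _ _ hβ0]
          ring
      _ = _ := by
          rw [hρ, ← ENNReal.rpow_add _ _ two_ne_zero ENNReal.ofNat_ne_top, ← ENNReal.rpow_mul, mul_assoc,
            ← ENNReal.rpow_add _ _ two_ne_zero ENNReal.ofNat_ne_top, ← ENNReal.rpow_natCast, ← ENNReal.rpow_mul]
          congr 2
          ring
  refine ne_top_of_le_ne_top ?_ (ENNReal.tsum_le_tsum htwo)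
  rw [ENNReal.tsum_mul_left, ENNReal.tsum_geometric]
  refine ENNReal.mul_ne_top (ENNReal.mul_ne_top ENNReal.ofReal_ne_top (ENNReal.mul_ne_top
    (ENNReal.rpow_ne_top_of_nonneg hβ0 (ENNReal.mul_ne_top hC hD)) hD)) ?_
  simp [tsub_eq_zero_iff_le, hρ1]
def cc (j : ℕ) (m : Fin n → ℤ) : Rn n := ((2:ℝ)^j)⁻¹ • zpt m
lemma cc_mem (j : ℕ) (m : Fin n → ℤ) : cc j m ∈ dQ 1 j m := by
  intro i
  have : cc j m i = ((2:ℝ)^j)⁻¹ * m i := rfl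
  rw [two_rpow_neg, this, sub_self, abs_zero]
  positivity
def RR (r : ℝ) (φ : ℕ → Sch n) (f : TDist n E) (j : ℕ) (m : Fin n → ℤ) : ℝ :=
  ((Tk j (tt r φ f j) (cc j m))^(1/r)).toReal
lemma RR_nonneg (r : ℝ) (φ : ℕ → Sch n) (f : TDist n E) (j : ℕ) (m : Fin n → ℤ) : 0 ≤ RR r φ f j m :=
  ENNReal.toReal_nonneg
lemma RR_eq {r : ℝ} (hr : 0 < r) (φ : ℕ → Sch n) (f : TDist n E) (j : ℕ) (m : Fin n → ℤ)
    (h : Tk j (tt r φ f j) (cc j m) ≠ ∞) : ENNReal.ofReal (RR r φ f j m) = (Tk j (tt r φ f j) (cc j m))^(1/r) :=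
  ENNReal.ofReal_toReal (ENNReal.rpow_ne_top_of_nonneg (by positivity) h)
lemma RR_bd [CompleteSpace E] {φ : ℕ → Sch n} (hφ : SmoothResolution n φ) {r : ℝ} (hr : 0 < r) (hr1 : r ≤ 1) (K : ℕ)
    {d : ℝ} (hd : 1 < d) : ∃ C : ℝ, 0 < C ∧ ∀ f : TDist n E, (∀ j x, Tk j (tt r φ f j) x ≠ ∞) → ∀ j m, ∀ x ∈ dQ d j m,
      ∀ α, mdeg α ≤ K → ‖mderiv α (vv φ f j) ((2:ℝ)^j • x)‖ ≤ C * RR r φ f j m := by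
  obtain ⟨C, hC, h⟩ := peetre_j (E := E) hφ hr hr1 K
  set C' : ℝ≥0∞ := (C * ENNReal.ofReal ((1 + n * d)^(n+1)))^(1/r) with hC'
  have hCt : C' ≠ ∞ := ENNReal.rpow_ne_top_of_nonneg (by positivity) (ENNReal.mul_ne_top hC ENNReal.ofReal_ne_top)
  refine ⟨C'.toReal + 1, by positivity, fun f hf j m x hx α hα => ?_⟩
  have h1 : ‖mderiv α (vv φ f j) ((2:ℝ)^j • x)‖ₑ ≤ C' * ENNReal.ofReal (RR r φ f j m) := by
    rw [RR_eq hr _ _ _ _ (hf j _), hC', ← ENNReal.mul_rpow_of_nonneg _ _ (by positivity), one_div, ENNReal.le_rpow_inv_iff hr, mul_assoc]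
    refine (h f j x α hα).trans (mul_le_mul' le_rfl ?_)
    exact Tk_near j (tt r φ f j) (dQ_dist hd hx (dQ_mono hd j m (cc_mem j m)))
  rw [← ENNReal.ofReal_toReal hCt, ← ENNReal.ofReal_mul ENNReal.toReal_nonneg, ← ofReal_norm,
    ENNReal.ofReal_le_ofReal_iff (mul_nonneg ENNReal.toReal_nonneg (RR_nonneg ..))] at h1
  refine h1.trans (mul_le_mul_of_nonneg_right (by linarith) (RR_nonneg ..))
def bb (ψ : Rn n → ℝ) (φ : ℕ → Sch n) (f : TDist n E) (j : ℕ) (m : Fin n → ℤ) (x : Rn n) : E :=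
  ψ ((2:ℝ)^j • x - zpt m) • mOp (φ j) f x
def la (A s r : ℝ) (p : ℝ≥0∞) (φ : ℕ → Sch n) (f : TDist n E) (j : ℕ) (m : Fin n → ℤ) : ℝ :=
  A * (2:ℝ)^((j:ℝ) * (s - n / p.toReal)) * RR r φ f j m
lemma bb_eq (ψ : Rn n → ℝ) (φ : ℕ → Sch n) (f : TDist n E) (j : ℕ) (m : Fin n → ℤ) :
    bb ψ φ f j m = fun x => (fun z => ψ (z - zpt m) • vv φ f j z) ((2:ℝ)^j • x) := by
  ext x
  simp only [bb, vv]
  rw [inv_smul_smul₀ (by positivity)]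
lemma bb_supp {ψ : Rn n → ℝ} {d : ℝ} (hs : ∀ x, ψ x ≠ 0 → ∀ i, |x i| ≤ d / 2) (j : ℕ)
    (m : Fin n → ℤ) (x : Rn n) (hx : ψ ((2:ℝ)^j • x - zpt m) ≠ 0) : x ∈ dQ d j m := by
  intro i
  have h := hs _ hx i
  have e : ((2:ℝ)^j • x - zpt m) i = 2^j * x i - m i := rfl
  rw [e] at h
  have h2 : (0:ℝ) < 2^j := by positivity
  rw [two_rpow_neg]
  have e2 : x i - ((2:ℝ)^j)⁻¹ * m i = ((2:ℝ)^j)⁻¹ * (2^j * x i - m i) := by field_simp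
  rw [e2, abs_mul, abs_of_pos (inv_pos.2 h2)]
  calc _ ≤ ((2:ℝ)^j)⁻¹ * (d / 2) := by gcongr
    _ = _ := by ring
lemma aa_atom [CompleteSpace E] {φ : ℕ → Sch n} (hφ : SmoothResolution n φ) {r : ℝ} (hr : 0 < r) (hr1 : r ≤ 1) (K : ℕ)
    {d : ℝ} (hd : 1 < d) {ψ : Rn n → ℝ} (hψ : ContDiff ℝ ((⊤:ℕ∞) : WithTop ℕ∞) ψ)
    (hs : ∀ x, ψ x ≠ 0 → ∀ i, |x i| ≤ d / 2) (hb : ∀ i : ℕ, ∃ C, ∀ y, ‖iteratedFDeriv ℝ i ψ y‖ ≤ C) (p : ℝ≥0∞) (s : ℝ) :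
    ∃ A : ℝ, 0 < A ∧ ∀ f : TDist n E, (∀ j x, Tk j (tt r φ f j) x ≠ ∞) → ∀ j m,
      IsSPAtom s p K (-1) d j m (fun x => ((la A s r p φ f j m)⁻¹ * (c2 n)⁻¹) • bb ψ φ f j m x) ∧
      ∀ x, ((la A s r p φ f j m : ℝ) : ℂ) • (((la A s r p φ f j m)⁻¹ * (c2 n)⁻¹) • bb ψ φ f j m x) =
        (c2 n)⁻¹ • bb ψ φ f j m x := by
  have hψK : ContDiff ℝ K ψ := hψ.of_le (by exact_mod_cast le_top)
  obtain ⟨c0, hc0, h0⟩ := RR_bd (E := E) hφ hr hr1 K hd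
  obtain ⟨c1, hc1, h1⟩ := atom_bd (E := E) hψK (fun i _ => hb i)
  have hc2 := c2_pos n
  set A := c1 * c0 / c2 n with hA
  have hA0 : 0 < A := by positivity
  refine ⟨A, hA0, fun f hf j m => ?_⟩
  have h2 : (0:ℝ) < 2^j := by positivity
  have hR := RR_nonneg r φ f j m
  have hBc : ContDiff ℝ K fun z => ψ (z - zpt m) • vv φ f j z :=
    (hψK.comp (contDiff_id.sub contDiff_const)).smul (vv_contDiff hφ f j K)
  have hbc : ContDiff ℝ K (bb ψ φ f j m) := by
    rw [bb_eq]
    exact hBc.comp (contDiff_id.const_smul _)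
  have hbs : Function.support (bb ψ φ f j m) ⊆ dQ d j m := fun x hx =>
    bb_supp hs j m x fun h => hx (by rw [bb, h, zero_smul])
  have hbd : ∀ x ∈ dQ d j m, ∀ k ≤ K, ‖iteratedFDeriv ℝ k (bb ψ φ f j m) x‖ ≤ (2^j)^k * (c1 * (c0 * RR r φ f j m)) := by
    intro x hx k hk
    rw [bb_eq, iteratedFDeriv_comp_const_smul _ (hBc.of_le (by exact_mod_cast hk)), norm_smul, norm_pow, norm_pow, Real.norm_ofNat]
    gcongr
    exact h1 _ (vv_contDiff hφ f j K) _ _ _ (by positivity) (h0 f hf j m x hx) k hk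
  set L := la A s r p φ f j m with hL
  have hL0 : 0 ≤ L := by rw [hL, la]; positivity
  have has : Function.support (fun x => (L⁻¹ * (c2 n)⁻¹) • bb ψ φ f j m x) ⊆ dQ d j m := fun x hx => hbs fun h => hx (by
    simp only [h, smul_zero])
  have hac : ContDiff ℝ K (fun x => (L⁻¹ * (c2 n)⁻¹) • bb ψ φ f j m x) := hbc.const_smul _
  refine ⟨⟨hac, has, fun α hα x => ?_, fun β hβ => ?_⟩, fun x => ?_⟩
  · by_cases hx : x ∈ dQ d j m
    · refine (norm_mderiv_le hac α hα x).trans ?_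
      have e : iteratedFDeriv ℝ (mdeg α) (fun x => (L⁻¹ * (c2 n)⁻¹) • bb ψ φ f j m x) x =
          (L⁻¹ * (c2 n)⁻¹) • iteratedFDeriv ℝ (mdeg α) (bb ψ φ f j m) x :=
        iteratedFDeriv_const_smul_apply ((hbc.of_le (by exact_mod_cast hα)).contDiffAt)
      rw [e, norm_smul, Real.norm_of_nonneg (by positivity)]
      calc _ ≤ L⁻¹ * (c2 n)⁻¹ * ((2^j)^(mdeg α) * (c1 * (c0 * RR r φ f j m))) := by
            gcongr
            exact hbd x hx _ hα
        _ = (L⁻¹ * (A * RR r φ f j m)) * (2^j)^(mdeg α) := by rw [hA]; field_simp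
        _ ≤ (2:ℝ)^(-(j:ℝ) * (s - n / p.toReal)) * (2^j)^(mdeg α) := by
            gcongr
            rcases hR.eq_or_lt with h | h
            · rw [← h]; simp; positivity
            · rw [hL, la, neg_mul, Real.rpow_neg (by norm_num)]
              refine le_of_eq ?_
              field_simp
        _ = _ := by
            rw [Real.rpow_add (by norm_num), mul_comm (mdeg α : ℝ), Real.rpow_mul (by norm_num) (j:ℝ) (mdeg α : ℝ), Real.rpow_natCast, Real.rpow_natCast]
    · have : mderiv α (fun x => (L⁻¹ * (c2 n)⁻¹) • bb ψ φ f j m x) x = 0 := by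
        rw [mderiv_eq]
        by_contra h
        exact hx (LD_support (dQ_closed d j m) has _ h)
      rw [this, norm_zero]
      positivity
  · have : (0:ℤ) ≤ mdeg β := by positivity
    omega
  · rcases hL0.eq_or_lt with h | h
    · have hR0 : RR r φ f j m = 0 := by
        rw [hL, la] at h
        have : (0:ℝ) < A * (2:ℝ)^((j:ℝ) * (s - n / p.toReal)) := by positivity
        rcases mul_eq_zero.1 h.symm with h | h
        · exact absurd h this.ne'
        · exact h
      have : bb ψ φ f j m x = 0 := by
        by_contra h3
        have := hbd x (hbs h3) 0 (Nat.zero_le _)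
        rw [hR0, norm_iteratedFDeriv_zero] at this
        simp at this
        exact h3 this
      rw [this]; simp
    · rw [Complex.coe_smul, smul_smul, ← mul_assoc, mul_inv_cancel₀ h.ne', one_mul]
lemma near_m {j : ℕ} {m : Fin n → ℤ} {x : Rn n} (hx : x ∈ dQ 1 j m) :
    m ∈ Fintype.piFinset fun i => Finset.Icc (mI j x i - 1) (mI j x i + 1) := by
  rw [Fintype.mem_piFinset]
  intro i
  have h1 := hx i
  have h2 := mI_mem j x i
  rw [two_rpow_neg] at h1 h2
  have h3 : (0:ℝ) < 2^j := by positivity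
  have e : ∀ z : ℝ, x i - ((2:ℝ)^j)⁻¹ * z = ((2:ℝ)^j)⁻¹ * (2^j * x i - z) := fun z => by field_simp
  have e2 : ∀ z : ℝ, |x i - ((2:ℝ)^j)⁻¹ * z| ≤ 1 * ((2:ℝ)^j)⁻¹ / 2 → |2^j * x i - z| ≤ 1/2 := by
    intro z hz
    rw [e, abs_mul, abs_of_pos (inv_pos.2 h3)] at hz
    have := mul_le_mul_of_nonneg_left hz h3.le
    rw [← mul_assoc, mul_inv_cancel₀ h3.ne', one_mul] at this
    refine this.trans_eq ?_
    field_simp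
  have a1 := abs_le.1 (e2 _ h1)
  have a2 := abs_le.1 (e2 _ h2)
  rw [Finset.mem_Icc]
  constructor
  · have : ((mI j x i : ℤ) : ℝ) ≤ ((m i + 1 : ℤ) : ℝ) := by push_cast; linarith
    have := Int.cast_le.1 this
    omega
  · have : (m i : ℝ) ≤ ((mI j x i + 1 : ℤ) : ℝ) := by push_cast; linarith
    exact Int.cast_le.1 this
lemma fNorm_le (p : ℝ≥0∞) {q : ℝ≥0∞} (hq : 0 < q) (lam : ℕ → (Fin n → ℤ) → ℂ) (U : ℕ → Rn n → ℝ≥0∞)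
    (h : ∀ j m x, x ∈ dQ 1 j m → (‖lam j m‖₊ : ℝ≥0∞) * chiP p j m x ≤ U j x) :
    fNorm p q lam ≤ lpNormENN p fun x => lqSum q fun j => ((3:ℝ≥0∞)^n)^(1/q.toReal) * U j x := by
  have h' : ∀ j m x, (‖lam j m‖₊ : ℝ≥0∞) * chiP p j m x ≤ U j x := by
    intro j m x
    by_cases hx : x ∈ dQ 1 j m
    · exact h j m x hx
    · rw [chiP, if_neg hx, mul_zero]; exact zero_le
  rw [fNorm]
  refine lpNorm_mono p fun x => ?_
  rw [lqSum]
  split_ifs with hq'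
  · refine iSup_le fun j => iSup_le fun m => ?_
    refine le_trans ?_ (le_iSup (fun j => ((3:ℝ≥0∞)^n)^(1/q.toReal) * U j x) j)
    simp only [hq', ENNReal.toReal_top, div_zero, ENNReal.rpow_zero, one_mul]
    exact h' j m x
  · have hq1 : 0 < q.toReal := ENNReal.toReal_pos hq.ne' hq'
    gcongr with j
    rw [ENNReal.mul_rpow_of_nonneg _ _ hq1.le, ← ENNReal.rpow_mul, one_div_mul_cancel hq1.ne', ENNReal.rpow_one]
    rw [tsum_eq_sum (s := Fintype.piFinset fun i => Finset.Icc (mI j x i - 1) (mI j x i + 1))]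
    · refine (Finset.sum_le_card_nsmul _ _ ((U j x)^q.toReal) fun m _ => ?_).trans_eq ?_
      · gcongr
        exact h' j m x
      · rw [nsmul_eq_mul, Fintype.card_piFinset]
        have : ∀ i, (Finset.Icc (mI j x i - 1) (mI j x i + 1)).card = 3 := fun i => by
          rw [Int.card_Icc]; omega
        simp [this]
    · intro m hm
      rw [chiP, if_neg fun hx => hm (near_m hx), mul_zero, ENNReal.zero_rpow_of_pos hq1]
lemma B_norm {φ : ℕ → Sch n} (p q : ℝ≥0∞) (hp' : p ≠ ∞) (s : ℝ) {r δ d A : ℝ} (hd : 1 < d) (hr : 0 < r)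
    (hrp : ENNReal.ofReal r < p) (hrq : ENNReal.ofReal r < q) (hδ : 0 < δ) (hA : 0 < A) :
    ∃ C : ℝ≥0∞, C ≠ ∞ ∧ ∀ f : TDist n E, (∀ j x, Tk j (tt r φ f j) x ≠ ∞) →
      fNorm p q (fun j m => ((la A s r p φ f j m : ℝ) : ℂ)) ≤ C * triebelNorm s p q φ f := by
  obtain ⟨C, hC, h⟩ := VVf (E := E) (φ := φ) p q hp' s hr hrp hrq hδ
  have hp0 : 0 < p := lt_of_le_of_lt zero_le hrp
  have hq0 : 0 < q := lt_of_le_of_lt zero_le hrq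
  set c0 : ℝ≥0∞ := ENNReal.ofReal A * (ENNReal.ofReal ((1 + n * d)^(n+1)))^(1/r) with hc0
  have hc0t : c0 ≠ ∞ := ENNReal.mul_ne_top ENNReal.ofReal_ne_top
    (ENNReal.rpow_ne_top_of_nonneg (by positivity) ENNReal.ofReal_ne_top)
  set c1 : ℝ≥0∞ := ((3:ℝ≥0∞)^n)^(1/q.toReal) with hc1
  have hc1t : c1 ≠ ∞ := ENNReal.rpow_ne_top_of_nonneg (by positivity) (by finiteness)
  refine ⟨c1 * c0 * C, ENNReal.mul_ne_top (ENNReal.mul_ne_top hc1t hc0t) hC, fun f hf => ?_⟩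
  refine (fNorm_le p hq0 _ (fun j x => c0 * (Aop (wt δ) (gg s r φ f) j x)^(1/r)) fun j m x hx => ?_).trans ?_
  · have hRR := RR_eq hr φ f j m (hf j _)
    have hla : ((‖((la A s r p φ f j m : ℝ) : ℂ)‖₊ : ℝ≥0) : ℝ≥0∞) =
        ENNReal.ofReal A * (2:ℝ≥0∞)^((j:ℝ) * (s - n / p.toReal)) * (Tk j (tt r φ f j) (cc j m))^(1/r) := by
      have hn : (0:ℝ) ≤ la A s r p φ f j m := by have := RR_nonneg r φ f j m; rw [la]; positivity
      rw [← enorm_eq_nnnorm, ← ofReal_norm, Complex.norm_real, Real.norm_of_nonneg hn, la,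
        ENNReal.ofReal_mul (by positivity), ENNReal.ofReal_mul hA.le, hRR, two_eq]
    have hT : Tk j (tt r φ f j) (cc j m) ≤ ENNReal.ofReal ((1 + n * d)^(n+1)) * Tk j (tt r φ f j) x :=
      Tk_near j (tt r φ f j) (dQ_dist hd (dQ_mono hd j m (cc_mem j m)) (dQ_mono hd j m hx))
    have hD : (2:ℝ≥0∞)^((j:ℝ)*s*r) * Tk j (tt r φ f j) x ≤ Aop (wt δ) (gg s r φ f) j x := by
      have := ENNReal.le_tsum (f := fun v => wt δ j v * Tk (min j v) (gg s r φ f v) x) j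
      refine le_trans (le_of_eq ?_) this
      simp [wt, gg_Tk]
    rw [hla, chiP, if_pos hx]
    calc _ = ENNReal.ofReal A * (2:ℝ≥0∞)^((j:ℝ)*s) * (Tk j (tt r φ f j) (cc j m))^(1/r) := by
          rw [show (j:ℝ)*s = (j:ℝ) * (s - n / p.toReal) + (j:ℝ) * n / p.toReal by ring,
            ENNReal.rpow_add _ _ two_ne_zero ENNReal.ofNat_ne_top]
          ring
      _ ≤ ENNReal.ofReal A * (2:ℝ≥0∞)^((j:ℝ)*s) * (ENNReal.ofReal ((1 + n * d)^(n+1)) * Tk j (tt r φ f j) x)^(1/r) :=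
          mul_le_mul' le_rfl (ENNReal.rpow_le_rpow hT (by positivity))
      _ = c0 * ((2:ℝ≥0∞)^((j:ℝ)*s*r) * Tk j (tt r φ f j) x)^(1/r) := by
          rw [ENNReal.mul_rpow_of_nonneg _ _ (by positivity), ENNReal.mul_rpow_of_nonneg _ _ (by positivity),
            ← ENNReal.rpow_mul _ _ (1/r), mul_assoc (_ * s) r, mul_one_div_cancel hr.ne', mul_one, hc0]
          ring
      _ ≤ _ := mul_le_mul' le_rfl (ENNReal.rpow_le_rpow hD (by positivity))
  · simp only [lqSum_const_mul hq0]
    rw [lpNorm_const_mul hp0 hp' _ hc1t, lpNorm_const_mul hp0 hp' _ hc0t, mul_assoc c1, mul_assoc c1, mul_assoc c0]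
    exact mul_le_mul' le_rfl (mul_le_mul' le_rfl (h f))
lemma B_hasSum [CompleteSpace E] {φ : ℕ → Sch n} (hφ : SmoothResolution n φ) {ψ : Rn n → ℝ} (hψ : Continuous ψ)
    (h0 : ∀ x, 0 ≤ ψ x) (h1 : ∀ x, HasSum (fun m : Fin n → ℤ => ψ (x - zpt m)) 1) (f : TDist n E) (g : Sch n)
    (hg : ∑' j, ∫⁻ x, ‖g x‖ₑ * ‖mOp (φ j) f x‖ₑ ≠ ∞) :
    HasSum (fun νm : ℕ × (Fin n → ℤ) => (c2 n)⁻¹ • ∫ x, g x • bb ψ φ f νm.1 νm.2 x) (f.toFun g) := by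
  have hbc : ∀ j m, Continuous (bb ψ φ f j m) := fun j m => by
    have h2 := (mOp_PG (φ j) f).1
    unfold bb
    fun_prop
  have hgb : ∀ j m, Continuous fun x => g x • bb ψ φ f j m x := fun j m => g.continuous.smul (hbc j m)
  have hen : ∀ j m x, ‖g x • bb ψ φ f j m x‖ₑ = ENNReal.ofReal (ψ ((2:ℝ)^j • x - zpt m)) * (‖g x‖ₑ * ‖mOp (φ j) f x‖ₑ) := by
    intro j m x
    rw [enorm_smul, bb, enorm_smul, Real.enorm_of_nonneg (h0 _)]
    ring
  have hone : ∀ x : Rn n, ∑' m : Fin n → ℤ, ENNReal.ofReal (ψ (x - zpt m)) = 1 := fun x => by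
    rw [← ENNReal.ofReal_tsum_of_nonneg (fun m => h0 _) (h1 x).summable, (h1 x).tsum_eq, ENNReal.ofReal_one]
  have hfib : ∀ j, ∑' m, ∫⁻ x, ‖g x • bb ψ φ f j m x‖ₑ = ∫⁻ x, ‖g x‖ₑ * ‖mOp (φ j) f x‖ₑ := by
    intro j
    rw [← lintegral_tsum fun m => (hgb j m).enorm.measurable.aemeasurable]
    congr with x
    simp only [hen]
    rw [ENNReal.tsum_mul_right, hone, one_mul]
  have hjt : ∀ j, ∫⁻ x, ‖g x‖ₑ * ‖mOp (φ j) f x‖ₑ ≠ ∞ := fun j => ENNReal.ne_top_of_tsum_ne_top hg j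
  have hmt : ∀ j m, ∫⁻ x, ‖g x • bb ψ φ f j m x‖ₑ ≠ ∞ := fun j m =>
    ENNReal.ne_top_of_tsum_ne_top (by rw [hfib]; exact hjt j) m
  have hint : ∀ j m, Integrable fun x => g x • bb ψ φ f j m x := fun j m =>
    ⟨(hgb j m).aestronglyMeasurable, (hmt j m).lt_top⟩
  have hS0 : ∑' νm : ℕ × (Fin n → ℤ), ∫⁻ x, ‖g x • bb ψ φ f νm.1 νm.2 x‖ₑ ≠ ∞ := by
    rw [ENNReal.tsum_prod (f := fun j m => ∫⁻ x, ‖g x • bb ψ φ f j m x‖ₑ)]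
    simp only [hfib]
    exact hg
  have hS1 : Summable fun νm : ℕ × (Fin n → ℤ) => ∫ x, g x • bb ψ φ f νm.1 νm.2 x := by
    refine Summable.of_norm_bounded (ENNReal.summable_toReal hS0) fun νm => ?_
    rw [← toReal_enorm]
    exact ENNReal.toReal_mono (hmt _ _) (enorm_integral_le_lintegral_enorm _)
  have hin : ∀ j, HasSum (fun m => ∫ x, g x • bb ψ φ f j m x) (∫ x, g x • mOp (φ j) f x) := by
    intro j
    have := hasSum_integral_of_summable_integral_norm (fun m => hint j m) (by
      have h2 : ∑' m, ∫⁻ x, ‖g x • bb ψ φ f j m x‖ₑ ≠ ∞ := by rw [hfib]; exact hjt j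
      refine (ENNReal.summable_toReal h2).congr fun m => ?_
      rw [integral_norm_eq_lintegral_enorm (hgb j m).aestronglyMeasurable])
    convert this using 1
    congr with x
    have h3 : HasSum (fun m => g x • bb ψ φ f j m x) (g x • ((1:ℝ) • mOp (φ j) f x)) :=
      ((h1 ((2:ℝ)^j • x)).smul_const (mOp (φ j) f x)).const_smul (g x)
    rw [h3.tsum_eq, one_smul]
  have hS2 : Summable fun νm : ℕ × (Fin n → ℤ) => (c2 n)⁻¹ • ∫ x, g x • bb ψ φ f νm.1 νm.2 x := hS1.const_smul _
  obtain ⟨I, hI⟩ := hS2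
  have h4 := hI.prod_fiberwise (fun j => (hin j).const_smul ((c2 n)⁻¹))
  rwa [tendsto_nhds_unique h4.tendsto_sum_nat (td_sum hφ f g)] at hI
lemma B_main [CompleteSpace E] {φ : ℕ → Sch n} (hφ : SmoothResolution n φ) {d : ℝ} (hd : 1 < d) (K : ℕ)
    (p q : ℝ≥0∞) (hp' : p ≠ ∞) {s r δ : ℝ} (hr : 0 < r) (hr1 : r ≤ 1)
    (hrp : ENNReal.ofReal r < p) (hrq : ENNReal.ofReal r < q) (hδ : 0 < δ) (hδ2 : δ < (s + n) * r - n) :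
    ∃ C : ℝ≥0∞, C ≠ ∞ ∧ ∀ f : TDist n E, triebelNorm s p q φ f < ∞ →
      ∃ (lam : ℕ → (Fin n → ℤ) → ℂ) (a : ℕ → (Fin n → ℤ) → Rn n → E),
        (∀ m, Is1Atom K d m (a 0 m)) ∧
        (∀ ν m, 0 < ν → IsSPAtom s p K (-1) d ν m (a ν m)) ∧
        RepresentsAtomic f lam a ∧ fNorm p q lam ≤ C * triebelNorm s p q φ f := by
  obtain ⟨ψ, hψ, hψ0, hψs, hψ1, hψb⟩ := exists_psi (n := n) hd
  obtain ⟨A, hA, hat⟩ := aa_atom (E := E) hφ hr hr1 K hd hψ hψs hψb p s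
  obtain ⟨C, hC, hN⟩ := B_norm (E := E) (φ := φ) p q hp' s hd hr hrp hrq hδ hA
  refine ⟨C, hC, fun f hf => ?_⟩
  obtain ⟨x₀, D, hD, hB⟩ := B_fin p q hp' s hr hrp hrq hδ f hf
  have hfin : ∀ j x, Tk j (tt r φ f j) x ≠ ∞ := fun j x =>
    ((Tk_far j _ x x₀).trans_lt (ENNReal.mul_lt_top ENNReal.ofReal_lt_top
      ((hB j).trans_lt (ENNReal.mul_lt_top hD.lt_top (two_ne_top _).lt_top)))).ne
  have hat := hat f hfin
  refine ⟨fun j m => ((la A s r p φ f j m : ℝ) : ℂ), fun j m x => ((la A s r p φ f j m)⁻¹ * (c2 n)⁻¹) • bb ψ φ f j m x,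
    fun m => ?_, fun ν m _ => (hat ν m).1, fun g => ?_, hN f hfin⟩
  · obtain ⟨h1, h2, h3, -⟩ := (hat 0 m).1
    refine ⟨h1, h2, fun α hα x => (h3 α hα x).trans_eq ?_⟩
    simp
  · convert B_hasSum hφ hψ.continuous hψ0 hψ1 f g (B_sum hφ hr hr1 hδ2 f x₀ D hD hB g) using 1
    funext νm
    rw [← integral_smul, ← integral_smul]
    refine integral_congr_ae (Eventually.of_forall fun x => ?_)
    simp only
    rw [smul_comm, (hat νm.1 νm.2).2 x, smul_comm]
lemma exists_r (n : ℕ) (p q : ℝ≥0∞) (hp : 0 < p) (hp' : p ≠ ∞) (hq : 0 < q) (s : ℝ) (hs : sigmaPQ n p q < s) :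
    ∃ r : ℝ, 0 < r ∧ r ≤ 1 ∧ ENNReal.ofReal r < p ∧ ENNReal.ofReal r < q ∧ (n:ℝ) < (s + n) * r := by
  rw [sigmaPQ, max_lt_iff] at hs
  obtain ⟨h1, h2⟩ := hs
  have ht : min p q ≠ ∞ := ne_top_of_le_ne_top hp' (min_le_left _ _)
  set M := (min p q).toReal with hM
  have hM0 : 0 < M := ENNReal.toReal_pos (lt_min hp hq).ne' ht
  have hn : (0:ℝ) ≤ n := Nat.cast_nonneg n
  have h3 : (n:ℝ) / (s + n) < min 1 M := by
    rw [lt_min_iff, div_lt_iff₀ (by linarith), div_lt_iff₀ (by linarith)]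
    refine ⟨by linarith, ?_⟩
    have := mul_lt_mul_of_pos_right h1 hM0
    have e : (n:ℝ) * (1 / M - 1) * M = n - n * M := by field_simp
    rw [e] at this
    linarith
  obtain ⟨r, hr1, hr2⟩ := exists_between h3
  have hr0 : 0 < r := lt_of_le_of_lt (by positivity) hr1
  have h4 : ENNReal.ofReal r < min p q := by
    rw [ENNReal.ofReal_lt_iff_lt_toReal hr0.le ht]
    exact hr2.trans_le (min_le_right _ _)
  refine ⟨r, hr0, (hr2.trans_le (min_le_left _ _)).le, h4.trans_le (min_le_left _ _), h4.trans_le (min_le_right _ _), ?_⟩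
  rw [div_lt_iff₀ (by linarith)] at hr1
  linarith
end AT

/-- atomic characterization of `F^s_{p,q}(E)` without moment
conditions, for `n/(n+1) < p < ∞` and `s > σ_{p,q}`. -/
theorem statement16 (n : ℕ) (E : Type*) [NormedAddCommGroup E] [NormedSpace ℂ E]
    [CompleteSpace E] (p q : ℝ≥0∞) (hp : ENNReal.ofReal ((n : ℝ) / ((n : ℝ) + 1)) < p)
    (hp' : p ≠ ∞) (hq : 0 < q) (s : ℝ) (hs : sigmaPQ n p q < s)
    (d : ℝ) (hd : 1 < d) (K : ℕ) (hK : 1 + ⌊s⌋ ≤ (K : ℤ))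
    (φ : ℕ → Sch n) (hφ : SmoothResolution n φ) :
    (∀ f : TDist n E, triebelNorm s p q φ f < ∞ ↔
      ∃ (lam : ℕ → (Fin n → ℤ) → ℂ) (a : ℕ → (Fin n → ℤ) → Rn n → E),
        (∀ m, Is1Atom K d m (a 0 m)) ∧
        (∀ ν m, 0 < ν → IsSPAtom s p K (-1) d ν m (a ν m)) ∧
        fNorm p q lam < ∞ ∧ RepresentsAtomic f lam a) ∧
    ∃ c₁ > (0 : ℝ), ∃ c₂ > (0 : ℝ), ∀ f : TDist n E, triebelNorm s p q φ f < ∞ →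
      ENNReal.ofReal c₁ * triebelNorm s p q φ f ≤ sInf (atomRepSetF s p q K d f) ∧
      sInf (atomRepSetF s p q K d f) ≤ ENNReal.ofReal c₂ * triebelNorm s p q φ f := by
  have hp0 : 0 < p := lt_of_le_of_lt zero_le hp
  obtain ⟨r, hr, hr1, hrp, hrq, hrs⟩ := AT.exists_r n p q hp0 hp' hq s hs
  have hKs : s < K := by
    have h1 := Int.lt_floor_add_one s
    have h2 : ((1 + ⌊s⌋ : ℤ) : ℝ) ≤ ((K : ℤ) : ℝ) := Int.cast_le.2 hK
    push_cast at h2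
    linarith
  set δ := min (((K:ℝ) - s) * r) ((s + n) * r - n) with hδd
  have hδ : 0 < δ := lt_min (mul_pos (sub_pos.2 hKs) hr) (by linarith)
  obtain ⟨CA, hCA, hA⟩ := AT.A_main (E := E) hφ hd K p q hp' hr hr1 hrp hrq hδ (min_le_left _ _) (min_le_right _ _)
  obtain ⟨CB, hCB, hB⟩ := AT.B_main (E := E) hφ hd K p q hp' hr hr1 hrp hrq (half_pos hδ)
    (lt_of_lt_of_le (half_lt_self hδ) (min_le_right _ _))
  refine ⟨fun f => ⟨fun hf => ?_, ?_⟩, ?_⟩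
  · obtain ⟨lam, a, h1, h2, h3, h4⟩ := hB f hf
    exact ⟨lam, a, h1, h2, h4.trans_lt (ENNReal.mul_lt_top hCB.lt_top hf), h3⟩
  · rintro ⟨lam, a, h1, h2, h3, h4⟩
    exact (hA f lam a h1 h2 h4).trans_lt (ENNReal.mul_lt_top hCA.lt_top h3)
  · have hA1 : (0:ℝ) < CA.toReal + 1 := by positivity
    refine ⟨(CA.toReal + 1)⁻¹, by positivity, CB.toReal + 1, by positivity, fun f hf => ⟨?_, ?_⟩⟩
    · refine le_sInf ?_
      rintro _ ⟨lam, a, h1, h2, h3, h4, rfl⟩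
      rw [ENNReal.ofReal_inv_of_pos hA1]
      refine (ENNReal.inv_mul_le_iff (by simpa using hA1) ENNReal.ofReal_ne_top).2 ?_
      refine (hA f lam a h1 h2 h4).trans (mul_le_mul' ?_ le_rfl)
      rw [ENNReal.le_ofReal_iff_toReal_le hCA hA1.le]
      linarith
    · obtain ⟨lam, a, h1, h2, h3, h4⟩ := hB f hf
      have h5 := h4.trans_lt (ENNReal.mul_lt_top hCB.lt_top hf)
      have h6 : fNorm p q lam ∈ atomRepSetF s p q K d f := ⟨lam, a, h1, h2, h5, h3, rfl⟩
      refine (sInf_le h6).trans (h4.trans (mul_le_mul' ?_ le_rfl))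
      rw [ENNReal.le_ofReal_iff_toReal_le hCB (by positivity)]
      linarith

end
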